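/- arXiv:0807.4996 — 2 statements merged into one kernel-verified Lean document; each statement's English description precedes it below -/
import Mathlib

section
/- Let n be an odd integer with n ≥ 3. Then the preordering of ℝ[[x,y]] generated by y and y − x^n is saturated: every f ∈ ℝ[[x,y]] that is nonnegative at every ordering of the field ℝ((x,y)) at which y ≥ 0 and y − x^n ≥ 0 belongs to the preordering of ℝ[[x,y]] generated by y and y − x^n. -/
noncomputable section

open MvPowerSeries MvPolynomial

/-- `ℝ[[x,y]]` is an integral domain. -/
instance : IsDomain (MvPowerSeries (Fin 2) ℝ) := NoZeroDivisors.to_isDomain _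

/-- The ring of formal power series `ℝ[[x,y]]`. -/
abbrev PS : Type := MvPowerSeries (Fin 2) ℝ

/-- The field `ℝ((x,y))`, the quotient field of `ℝ[[x,y]]`. -/
abbrev FF : Type := FractionRing PS

/-- The canonical embedding `ℝ[[x,y]] → ℝ((x,y))`. -/
abbrev ι : PS →+* FF := algebraMap PS FF

/-- The power series `x`. -/
abbrev psX : PS := MvPowerSeries.X 0

/-- The power series `y`. -/
abbrev psY : PS := MvPowerSeries.X 1

/-- The preordering of a commutative ring `A` generated by a subset `S`:
the smallest subsemiring of `A` containing `S` together with all squares. -/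
def preorderingGen {A : Type*} [CommRing A] (S : Set A) : Set A :=
  (Subsemiring.closure (S ∪ {a | ∃ b, a = b ^ 2}) : Set A)

/-- An ordering of a field `F`: a subset `P` with `P + P ⊆ P`, `P·P ⊆ P`,
`P ∪ (−P) = F` and `P ∩ (−P) = {0}`. -/
def IsOrderingF {F : Type*} [Field F] (P : Set F) : Prop :=
  (∀ a ∈ P, ∀ b ∈ P, a + b ∈ P) ∧ (∀ a ∈ P, ∀ b ∈ P, a * b ∈ P) ∧
  (∀ a : F, a ∈ P ∨ -a ∈ P) ∧ (∀ a : F, a ∈ P → -a ∈ P → a = 0)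



theorem adicComplete_of_finite {R O : Type*} [CommRing R] [IsNoetherianRing R] [IsLocalRing R]
    [CommRing O] [Algebra R O] [Module.Finite R O] (I : Ideal R) (hI : I ≠ ⊤) [IsAdicComplete I R] :
    IsAdicComplete (I.map (algebraMap R O)) O := by
  rw [IsAdicComplete.map_algebraMap_iff]
  rw [← AdicCompletion.of_bijective_iff]
  have hH : IsHausdorff I O := IsHausdorff.of_isLocalRing _ _ hI
  refine ⟨AdicCompletion.of_injective I O, ?_⟩
  intro z
  obtain ⟨t, rfl⟩ := AdicCompletion.ofTensorProduct_surjective_of_finite I O z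
  induction t using TensorProduct.induction_on with
  | zero => exact ⟨0, by simp⟩
  | tmul r m =>
    obtain ⟨r, rfl⟩ := (AdicCompletion.of_bijective_iff.2 (inferInstanceAs (IsAdicComplete I R))).2 r
    refine ⟨r • m, ?_⟩
    rw [AdicCompletion.ofTensorProduct_tmul, map_smul]
    ext n
    simp
    rfl
  | add a b ha hb =>
    obtain ⟨a', ha⟩ := ha
    obtain ⟨b', hb⟩ := hb
    exact ⟨a' + b', by rw [map_add, map_add, ha, hb]⟩

theorem sumSq_div_form {V E : Type*} [CommRing V] [IsDomain V] [ValuationRing V] [Field E]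
    [Algebra V E] [IsFractionRing V E] (hres : ¬ IsSumSq (-1 : IsLocalRing.ResidueField V))
    (s : E) (hs : IsSumSq s) :
    s = 0 ∨ ∃ (c : E) (t : V), c ≠ 0 ∧ s = c ^ 2 * algebraMap V E t ∧
      IsSumSq (IsLocalRing.residue V t) ∧ IsLocalRing.residue V t ≠ 0 := by
  induction hs with
  | zero => exact Or.inl rfl
  | @sq_add g s hs ih =>
    have key : ∀ (a : IsLocalRing.ResidueField V) (b : IsLocalRing.ResidueField V), IsSumSq b →
        b ≠ 0 → a * a + b ≠ 0 := by
      intro a b hb hb0 h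
      apply hres
      have ha : a ≠ 0 := by
        rintro rfl
        apply hb0; simpa using h
      have : (-1 : IsLocalRing.ResidueField V) = (a⁻¹ * a⁻¹) * b := by
        have : b = - (a * a) := by linear_combination h
        rw [this]; field_simp
      rw [this]
      exact (IsSumSq.mul_self _).mul hb
    have key1 : ∀ (a : IsLocalRing.ResidueField V) (b : IsLocalRing.ResidueField V), IsSumSq b →
         1 + a * a * b ≠ 0 := by
      intro a b hb h
      apply hres
      have : (-1 : IsLocalRing.ResidueField V) = (a * a) * b := by linear_combination -h
      rw [this]
      exact (IsSumSq.mul_self _).mul hb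
    rcases ih with rfl | ⟨c, t, hc, rfl, ht, ht0⟩
    · by_cases hg : g = 0
      · left; simp [hg]
      · right
        exact ⟨g, 1, hg, by simp [sq], by simp, by simp⟩
    · right
      rcases ValuationRing.isInteger_or_isInteger V (g / c) with ⟨w, hw⟩ | ⟨w, hw⟩
      · refine ⟨c, w * w + t, hc, ?_, ?_, ?_⟩
        · rw [map_add, map_mul, hw]; field_simp
        · rw [map_add, map_mul]; exact (IsSumSq.mul_self _).add ht
        · rw [map_add, map_mul]; exact key _ _ ht ht0
      · by_cases hg : g = 0
        · subst hg
          exact ⟨c, t, hc, by simp, ht, ht0⟩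
        refine ⟨g, 1 + w * w * t, hg, ?_, ?_, ?_⟩
        · rw [map_add, map_mul, map_mul, hw, map_one]; field_simp
        · rw [map_add, map_mul, map_mul, map_one]
          exact IsSumSq.one.add ((IsSumSq.mul_self _).mul ht)
        · rw [map_add, map_mul, map_mul, map_one]; exact key1 _ _ ht

theorem neg_one_sumSq_residue {V E : Type*} [CommRing V] [IsDomain V] [ValuationRing V] [Field E]
    [Algebra V E] [IsFractionRing V E] (h : IsSumSq (-1 : E)) :
    IsSumSq (-1 : IsLocalRing.ResidueField V) := by
  by_contra hres
  rcases sumSq_div_form hres (-1 : E) h with h0 | ⟨c, t, hc, hct, ht, ht0⟩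
  · simp at h0
  have htu : IsUnit t := by
    by_contra hh
    exact ht0 ((IsLocalRing.residue_eq_zero_iff t).2 ((IsLocalRing.mem_maximalIdeal t).2 hh))
  obtain ⟨t', htt'⟩ := htu.exists_right_inv
  apply hres
  have h1 : algebraMap V E t * algebraMap V E t' = 1 := by rw [← map_mul, htt', map_one]
  have hc2 : c ^ 2 = algebraMap V E (-t') := by
    rw [map_neg]
    linear_combination algebraMap V E t' * (-hct) - c ^ 2 * h1
  obtain ⟨w, hw⟩ := IsIntegrallyClosed.exists_algebraMap_eq_of_isIntegral_pow (R := V) (K := E)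
     (x := c) (n := 2) (by norm_num) (by rw [hc2]; exact isIntegral_algebraMap)
  have h2 : w ^ 2 * t = -1 := by
    apply IsFractionRing.injective V E
    rw [map_mul, map_pow, hw, ← hct]; simp
  have : (-1 : IsLocalRing.ResidueField V) =
      IsLocalRing.residue V w * IsLocalRing.residue V w * IsLocalRing.residue V t := by
    rw [← map_mul, ← map_mul, ← sq, h2]; simp
  rw [this]
  exact (IsSumSq.mul_self _).mul ht

theorem isSumSq_map {A B : Type*} [CommRing A] [CommRing B] (φ : A →+* B) {s : A}
    (h : IsSumSq s) : IsSumSq (φ s) := by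
  induction h with
  | zero => simp
  | sq_add a _ ih => rw [map_add, map_mul]; exact (IsSumSq.mul_self _).add ih

theorem exists_sq_neg_one_real (F : Type*) [Field F] [Algebra ℝ F] [Algebra.IsAlgebraic ℝ F]
    (h : IsSumSq (-1 : F)) : ∃ z : F, z ^ 2 = -1 := by
  rcases Real.nonempty_algEquiv_or F with ⟨⟨e⟩⟩ | ⟨⟨e⟩⟩
  · exfalso
    have := isSumSq_map (e : F →+* ℝ) h
    have := this.nonneg
    simp at this
    linarith
  · exact ⟨e.symm Complex.I, by rw [← map_pow]; simp⟩

theorem exists_sq_neg_one_quot {O E : Type*} [CommRing O] [IsDedekindDomain O]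
    [Field E] [Algebra O E] [IsFractionRing O E] (h : IsSumSq (-1 : E))
    (M : Ideal O) [hM : M.IsMaximal] (hM0 : M ≠ ⊥) : IsSumSq (-1 : O ⧸ M) := by
  have hdvr := IsLocalization.AtPrime.isDiscreteValuationRing_of_dedekind_domain O hM0
    (Localization.AtPrime M)
  have hu : ∀ y : M.primeCompl, IsUnit (algebraMap O E y) := by
    intro y
    have : (y : O) ≠ 0 := by
      intro h0
      exact y.2 (by rw [h0]; exact M.zero_mem)
    exact isUnit_iff_ne_zero.2 (by simpa using this)
  let φ : Localization.AtPrime M →+* E := IsLocalization.lift (M := M.primeCompl) hu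
  let : Algebra (Localization.AtPrime M) E := φ.toAlgebra
  have : IsScalarTower O (Localization.AtPrime M) E := IsScalarTower.of_algebraMap_eq (by
    intro x; exact (IsLocalization.lift_eq hu x).symm)
  have : IsFractionRing (Localization.AtPrime M) E :=
    IsFractionRing.isFractionRing_of_isDomain_of_isLocalization M.primeCompl _ _
  have h1 : IsSumSq (-1 : Localization.AtPrime M ⧸
      IsLocalRing.maximalIdeal (Localization.AtPrime M)) :=
    neg_one_sumSq_residue (V := Localization.AtPrime M) h
  have e := IsLocalization.AtPrime.equivQuotMaximalIdeal M (Localization.AtPrime M)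
  have := isSumSq_map (e.symm : (Localization.AtPrime M ⧸
      IsLocalRing.maximalIdeal (Localization.AtPrime M)) →+* O ⧸ M) (s := -1) h1
  simpa using this

theorem hensel_sq {O : Type*} [CommRing O] (J : Ideal O) [HenselianRing O J] (h2' : IsUnit (2 : O))
    (z : O) (hrad : z ^ 2 + 1 ∈ J.radical) : ∃ a : O, a ^ 2 + 1 = 0 := by
  obtain ⟨k, hk⟩ := hrad
  have h2 : IsUnit (2 : O ⧸ J) := by
    have := h2'.map (Ideal.Quotient.mk J)
    rwa [map_ofNat] at this
  have hnil : IsNilpotent ((Ideal.Quotient.mk J z) ^ 2 + 1) :=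
    ⟨k, by rw [← Ideal.Quotient.eq_zero_iff_mem] at hk; simpa using hk⟩
  have hzu : IsUnit (Ideal.Quotient.mk J z) := by
    have := hnil.isUnit_sub_one
    rw [add_sub_cancel_right] at this
    exact (isUnit_pow_iff (by norm_num)).1 this
  obtain ⟨w, ⟨hw1, hw2⟩, -⟩ := Polynomial.existsUnique_nilpotent_sub_and_aeval_eq_zero
    (R := O ⧸ J) (P := (Polynomial.X ^ 2 + 1 : Polynomial (O ⧸ J))) (x := Ideal.Quotient.mk J z)
    (by simpa using hnil) (by simpa [one_add_one_eq_two] using h2.mul hzu)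
  simp only [map_add, map_pow, Polynomial.aeval_X, map_one] at hw2
  obtain ⟨w, rfl⟩ := Ideal.Quotient.mk_surjective w
  have hw3 : w ^ 2 + 1 ∈ J := by
    rw [← Ideal.Quotient.eq_zero_iff_mem]; simpa using hw2
  have hwu : IsUnit (Ideal.Quotient.mk J w) := by
    have : (Ideal.Quotient.mk J w) * (-(Ideal.Quotient.mk J w)) = 1 := by
      linear_combination -hw2
    exact IsUnit.of_mul_eq_one _ this
  obtain ⟨a, ha, -⟩ := HenselianRing.is_henselian (I := J) (Polynomial.X ^ 2 + 1 : Polynomial O)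
    (by
      have : (Polynomial.X ^ 2 + 1 : Polynomial O) = Polynomial.X ^ 2 + Polynomial.C 1 := by simp
      rw [this]; exact Polynomial.monic_X_pow_add_C 1 (by norm_num)) w (by simpa using hw3)
    (by simpa [one_add_one_eq_two] using And.intro (h2'.map (Ideal.Quotient.mk J)) hwu)
  refine ⟨a, by simpa using ha⟩

theorem factF {K E : Type*} [Field K] [Algebra (PowerSeries ℝ) K] [IsFractionRing (PowerSeries ℝ) K]
    [Field E] [Algebra K E] [FiniteDimensional K E] (h : IsSumSq (-1 : E)) :
    ∃ z : E, z ^ 2 = -1 := by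
  let : Algebra (PowerSeries ℝ) E := ((algebraMap K E).comp (algebraMap (PowerSeries ℝ) K)).toAlgebra
  have : IsScalarTower (PowerSeries ℝ) K E := IsScalarTower.of_algebraMap_eq (fun x => rfl)
  have : CharZero (PowerSeries ℝ) :=
    charZero_of_injective_ringHom (f := PowerSeries.C (R := ℝ)) PowerSeries.C_injective
  have : CharZero K := charZero_of_injective_algebraMap (IsFractionRing.injective (PowerSeries ℝ) K)
  let O := integralClosure (PowerSeries ℝ) E
  have : IsDedekindDomain O := integralClosure.isDedekindDomain (PowerSeries ℝ) K E
  have : IsFractionRing O E := integralClosure.isFractionRing_of_finite_extension K E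
  have : Module.Finite (PowerSeries ℝ) O := IsIntegralClosure.finite (PowerSeries ℝ) K E O
  have hI : (Ideal.span {(PowerSeries.X : PowerSeries ℝ)}) ≠ ⊤ := by
    rw [← PowerSeries.maximalIdeal_eq_span_X]
    exact Ideal.IsPrime.ne_top'
  have := adicComplete_of_finite (O := O) (Ideal.span {(PowerSeries.X : PowerSeries ℝ)}) hI
  set J := (Ideal.span {(PowerSeries.X : PowerSeries ℝ)}).map (algebraMap (PowerSeries ℝ) O) with hJ
  have : HenselianRing O J := inferInstance
  -- residue fields
  have hXM : ∀ M : Ideal O, M.IsMaximal → J ≤ M := by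
    intro M hM
    have := Ideal.isMaximal_comap_of_isIntegral_of_isMaximal (R := PowerSeries ℝ) M
    rw [hJ, Ideal.map_le_iff_le_comap, ← PowerSeries.maximalIdeal_eq_span_X,
      IsLocalRing.eq_maximalIdeal this]
  have hinj : Function.Injective (algebraMap (PowerSeries ℝ) O) := by
    have h1 : Function.Injective (algebraMap (PowerSeries ℝ) E) :=
      (algebraMap K E).injective.comp (IsFractionRing.injective (PowerSeries ℝ) K)
    intro a b hab
    apply h1
    rw [IsScalarTower.algebraMap_apply (PowerSeries ℝ) O E, hab,
      ← IsScalarTower.algebraMap_apply (PowerSeries ℝ) O E]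
  have hJ0 : J ≠ ⊥ := by
    intro h0
    have : algebraMap (PowerSeries ℝ) O PowerSeries.X ∈ J :=
      Ideal.mem_map_of_mem _ (Ideal.mem_span_singleton_self _)
    rw [h0, Ideal.mem_bot, map_eq_zero_iff _ hinj] at this
    exact PowerSeries.X_ne_zero this
  have hq : ∀ M : Ideal O, M.IsMaximal → ∃ z : O, z ^ 2 + 1 ∈ M := by
    intro M hM
    have hM0 : M ≠ ⊥ := fun h0 => hJ0 (le_bot_iff.1 (h0 ▸ hXM M hM))
    have h1 := exists_sq_neg_one_quot (E := E) h M hM0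
    let : Field (O ⧸ M) := Ideal.Quotient.field M
    let g : PowerSeries ℝ →+* O ⧸ M := (Ideal.Quotient.mk M).comp (algebraMap (PowerSeries ℝ) O)
    let : Algebra ℝ (O ⧸ M) := (g.comp PowerSeries.C).toAlgebra
    have hg : g = (g.comp PowerSeries.C).comp (PowerSeries.constantCoeff (R := ℝ)) := by
      ext r
      have h2 : r - PowerSeries.C (PowerSeries.constantCoeff r) ∈
          Ideal.span {(PowerSeries.X : PowerSeries ℝ)} := by
        rw [Ideal.mem_span_singleton, PowerSeries.X_dvd_iff]; simp
      have h3 : g (r - PowerSeries.C (PowerSeries.constantCoeff r)) = 0 := by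
        refine Ideal.Quotient.eq_zero_iff_mem.2 (hXM M hM ?_)
        exact Ideal.mem_map_of_mem _ h2
      rw [map_sub, sub_eq_zero] at h3
      exact h3
    have : Algebra.IsIntegral ℝ (O ⧸ M) := by
      refine ⟨fun z => ?_⟩
      obtain ⟨z, rfl⟩ := Ideal.Quotient.mk_surjective z
      obtain ⟨p, hp, he⟩ := Algebra.IsIntegral.isIntegral (R := PowerSeries ℝ) z
      refine ⟨p.map PowerSeries.constantCoeff, hp.map _, ?_⟩
      rw [Polynomial.eval₂_map]
      have : (algebraMap ℝ (O ⧸ M)).comp (PowerSeries.constantCoeff (R := ℝ)) = g := hg.symm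
      rw [this, ← Polynomial.hom_eval₂, he, map_zero]
    obtain ⟨z, hz⟩ := exists_sq_neg_one_real (O ⧸ M) h1
    obtain ⟨z, rfl⟩ := Ideal.Quotient.mk_surjective z
    refine ⟨z, ?_⟩
    rw [← Ideal.Quotient.eq_zero_iff_mem]
    simp [hz]
  classical
  let s := (UniqueFactorizationMonoid.normalizedFactors J).toFinset
  have hs : ∀ M ∈ s, M.IsMaximal ∧ Prime M := by
    intro M hM
    have hp : Prime M := UniqueFactorizationMonoid.prime_of_normalized_factor M
      (Multiset.mem_toFinset.1 hM)
    exact ⟨(Ideal.isPrime_of_prime hp).isMaximal hp.ne_zero, hp⟩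
  choose! zz hzz using hq
  obtain ⟨z, hz⟩ := IsDedekindDomain.exists_forall_sub_mem_ideal (s := s) (fun M => M) (fun _ => 1)
    (fun M hM => (hs M hM).2) (fun M hM N hN hne => hne) (fun M => zz M.1)
  have hrad : z ^ 2 + 1 ∈ J.radical := by
    rw [Ideal.radical_eq_sInf, Ideal.mem_sInf]
    rintro M ⟨hJM, hMp⟩
    have hM0 : M ≠ ⊥ := fun h0 => hJ0 (le_bot_iff.1 (h0 ▸ hJM))
    have hMs : M ∈ s := by
      rw [Multiset.mem_toFinset]
      exact (Ideal.mem_normalizedFactors_iff hJ0).2 ⟨hMp, hJM⟩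
    have h1 := hz M hMs
    rw [pow_one] at h1
    have h2 := hzz M (hs M hMs).1
    have : z ^ 2 + 1 = (z - zz M) * (z + zz M) + (zz M ^ 2 + 1) := by ring
    rw [this]
    exact M.add_mem (M.mul_mem_right _ h1) h2
  have h2 : IsUnit (2 : O) := by
    have h3 : IsUnit (2 : PowerSeries ℝ) := by
      have := (isUnit_iff_ne_zero.2 (two_ne_zero (α := ℝ))).map (PowerSeries.C (R := ℝ))
      rwa [map_ofNat] at this
    have := h3.map (algebraMap (PowerSeries ℝ) O)
    rwa [map_ofNat] at this
  obtain ⟨a, ha'⟩ := hensel_sq J h2 z hrad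
  refine ⟨(a : E), ?_⟩
  have := congrArg (fun t : O => (t : E)) ha'
  simp only [Subalgebra.coe_add, Subalgebra.coe_pow, Subalgebra.coe_one, Subalgebra.coe_zero] at this
  linear_combination this

open Polynomial in
theorem poly_two_sq_ne {K : Type*} [Field K] (hK : ∀ a b : K, a ^ 2 + b ^ 2 = 0 → a = 0)
    (r s : Polynomial K) (h : r ^ 2 + s ^ 2 = 0) : r = 0 := by
  by_contra hr
  have h1 : r ^ 2 = - s ^ 2 := by linear_combination h
  have h2 : (r ^ 2).leadingCoeff = (- s ^ 2).leadingCoeff := by rw [h1]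
  rw [Polynomial.leadingCoeff_neg, Polynomial.leadingCoeff_pow, Polynomial.leadingCoeff_pow] at h2
  exact hr (Polynomial.leadingCoeff_eq_zero.1 (hK _ s.leadingCoeff (by linear_combination h2)))

theorem thue {K : Type*} [Field K] (hK : ∀ a b : K, a ^ 2 + b ^ 2 = 0 → a = 0)
    (π g : Polynomial K) (hπ : π ≠ 0) (h : π ∣ g ^ 2 + 1) :
    ∃ (c : K) (r s : Polynomial K), c ≠ 0 ∧ π = Polynomial.C c * (r ^ 2 + s ^ 2) := by
  let d := π.natDegree / 2
  let V := Polynomial.degreeLT K (d + 1)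
  let f : (V × V) →ₗ[K] AdjoinRoot π :=
    { toFun := fun v => AdjoinRoot.mk π ((v.1 : Polynomial K) - g * (v.2 : Polynomial K))
      map_add' := by
        intro v w
        rw [← map_add]; congr 1
        simp; ring
      map_smul' := by
        intro c v
        simp only [RingHom.id_apply]
        rw [AdjoinRoot.smul_mk]; congr 1
        simp [smul_sub] }
  have hfin : FiniteDimensional K (AdjoinRoot π) :=
    (AdjoinRoot.powerBasis hπ).finite
  have hVfin : FiniteDimensional K V :=
    (Polynomial.degreeLTEquiv K (d + 1)).symm.finiteDimensional
  have hdim : Module.finrank K V = d + 1 := by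
    rw [(Polynomial.degreeLTEquiv K (d + 1)).finrank_eq]; simp
  have hlt : Module.finrank K (AdjoinRoot π) < Module.finrank K (V × V) := by
    rw [Module.finrank_prod, hdim, (AdjoinRoot.powerBasis hπ).finrank, AdjoinRoot.powerBasis_dim]
    omega
  obtain ⟨v, hv, hv0⟩ := Submodule.exists_mem_ne_zero_of_ne_bot (f.ker_ne_bot_of_finrank_lt hlt)
  obtain ⟨⟨r, hr⟩, ⟨s, hs⟩⟩ := v
  have hv1 : π ∣ r - g * s := by
    have : AdjoinRoot.mk π (r - g * s) = 0 := hv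
    rwa [AdjoinRoot.mk_eq_zero] at this
  have hdvd : π ∣ r ^ 2 + s ^ 2 := by
    have : r ^ 2 + s ^ 2 = (r - g * s) * (r + g * s) + (g ^ 2 + 1) * s ^ 2 := by ring
    rw [this]
    exact dvd_add (hv1.mul_right _) (h.mul_right _)
  have hne : r ^ 2 + s ^ 2 ≠ 0 := by
    intro h0
    have h1 := poly_two_sq_ne hK r s h0
    have h2 := poly_two_sq_ne hK s r (by rw [add_comm]; exact h0)
    apply hv0
    subst h1; subst h2; rfl
  obtain ⟨q, hq⟩ := hdvd
  have hq0 : q ≠ 0 := by rintro rfl; exact hne (by simpa using hq)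
  have hdr : r.natDegree ≤ d := by
    have := Polynomial.mem_degreeLT.1 hr
    by_cases hr0 : r = 0
    · simp [hr0]
    rw [Polynomial.degree_eq_natDegree hr0] at this
    norm_cast at this
    omega
  have hds : s.natDegree ≤ d := by
    have := Polynomial.mem_degreeLT.1 hs
    by_cases hr0 : s = 0
    · simp [hr0]
    rw [Polynomial.degree_eq_natDegree hr0] at this
    norm_cast at this
    omega
  have hdeg : (r ^ 2 + s ^ 2).natDegree ≤ 2 * d := by
    refine Polynomial.natDegree_add_le_of_degree_le ?_ ?_
    · exact Polynomial.natDegree_pow_le.trans (by omega)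
    · exact Polynomial.natDegree_pow_le.trans (by omega)
  rw [hq, Polynomial.natDegree_mul hπ hq0] at hdeg
  have hqd : q.natDegree = 0 := by omega
  obtain ⟨c, rfl⟩ := Polynomial.natDegree_eq_zero.1 hqd
  have hc : c ≠ 0 := by simpa using hq0
  refine ⟨c⁻¹, r, s, inv_ne_zero hc, ?_⟩
  rw [hq, mul_comm π, ← mul_assoc, ← Polynomial.C_mul, inv_mul_cancel₀ hc]; simp

theorem sumSq_dvd {K : Type*} [Field K] (π : Polynomial K) [Fact (Irreducible π)]
    (hE : ¬ IsSumSq (-1 : AdjoinRoot π)) (s : Polynomial K) (hs : IsSumSq s) (hd : π ∣ s) :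
    ∃ s', IsSumSq s' ∧ s = π ^ 2 * s' := by
  induction hs with
  | zero => exact ⟨0, by simp, by simp⟩
  | @sq_add f t ht ih =>
    have hf : π ∣ f := by
      by_contra hf
      apply hE
      have hf0 : AdjoinRoot.mk π f ≠ 0 := by rwa [Ne, AdjoinRoot.mk_eq_zero]
      have h1 : AdjoinRoot.mk π (f * f + t) = 0 := by rwa [AdjoinRoot.mk_eq_zero]
      rw [map_add, map_mul] at h1
      have h2 : IsSumSq (AdjoinRoot.mk π t) := by
        clear ih hd h1 hE
        induction ht with
        | zero => simp
        | sq_add a _ ih => rw [map_add, map_mul]; exact (IsSumSq.mul_self _).add ih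
      have : (-1 : AdjoinRoot π) = ((AdjoinRoot.mk π f)⁻¹ * (AdjoinRoot.mk π f)⁻¹) *
          AdjoinRoot.mk π t := by
        have : AdjoinRoot.mk π t = - (AdjoinRoot.mk π f * AdjoinRoot.mk π f) := by
          linear_combination h1
        rw [this]; field_simp
      rw [this]
      exact (IsSumSq.mul_self _).mul h2
    have ht' : π ∣ t := by
      rwa [dvd_add_right (hf.mul_right _)] at hd
    obtain ⟨t', ht1, ht2⟩ := ih ht'
    obtain ⟨f', rfl⟩ := hf
    exact ⟨f' * f' + t', (IsSumSq.mul_self _).add ht1, by rw [ht2]; ring⟩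

theorem sumSq_dvd_pow {K : Type*} [Field K] (π : Polynomial K) [hπ : Fact (Irreducible π)]
    (hE : ¬ IsSumSq (-1 : AdjoinRoot π)) (k : ℕ) : ∀ (s : Polynomial K), IsSumSq s →
    π ^ (2 * k + 1) ∣ s → π ^ (2 * k + 2) ∣ s := by
  induction k with
  | zero =>
    intro s hs hd
    obtain ⟨s', -, rfl⟩ := sumSq_dvd π hE s hs (by simpa using hd)
    simp
  | succ k ih =>
    intro s hs hd
    obtain ⟨s', hs', rfl⟩ := sumSq_dvd π hE s hs ((dvd_pow_self π (by omega)).trans hd)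
    have h1 : π ^ (2 * (k + 1) + 1) = π ^ 2 * π ^ (2 * k + 1) := by ring
    have h2 : π ^ (2 * (k + 1) + 2) = π ^ 2 * π ^ (2 * k + 2) := by ring
    have h0 : π ^ 2 ≠ 0 := pow_ne_zero _ hπ.out.ne_zero
    rw [h1, mul_dvd_mul_iff_left h0] at hd
    rw [h2, mul_dvd_mul_iff_left h0]
    exact ih s' hs' hd

def NN (K : Type*) [Field K] : Submonoid (Polynomial K) where
  carrier := {p | ∃ (c : K) (r s : Polynomial K), p = Polynomial.C c * (r ^ 2 + s ^ 2)}
  one_mem' := ⟨1, 1, 0, by simp⟩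
  mul_mem' := by
    rintro _ _ ⟨c, r, s, rfl⟩ ⟨c', r', s', rfl⟩
    refine ⟨c * c', r * r' - s * s', r * s' + s * r', ?_⟩
    rw [Polynomial.C_mul]; ring

theorem mem_NN {K : Type*} [Field K] (hK : ∀ a b : K, a ^ 2 + b ^ 2 = 0 → a = 0)
    (P : Polynomial K) (hP : P ≠ 0)
    (h : ∀ π : Polynomial K, Irreducible π → ∀ k, π ^ (2 * k + 1) ∣ P → ¬ π ^ (2 * k + 2) ∣ P →
      ∃ g, π ∣ g ^ 2 + 1) : P ∈ NN K := by
  classical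
  obtain ⟨u, hu⟩ := UniqueFactorizationMonoid.prod_normalizedFactors hP
  rw [← hu]
  refine (NN K).mul_mem ?_ ?_
  · rw [Finset.prod_multiset_count]
    refine Submonoid.prod_mem _ ?_
    intro π hπ
    have hirr := UniqueFactorizationMonoid.irreducible_of_normalized_factor π
      (Multiset.mem_toFinset.1 hπ)
    have hnorm := UniqueFactorizationMonoid.normalize_normalized_factor π
      (Multiset.mem_toFinset.1 hπ)
    have hmul := UniqueFactorizationMonoid.emultiplicity_eq_count_normalizedFactors hirr hP
    rw [hnorm] at hmul
    set e := Multiset.count π (UniqueFactorizationMonoid.normalizedFactors P) with he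
    have hsq : ∀ k, π ^ (2 * k) ∈ NN K := fun k => ⟨1, π ^ k, 0, by simp; ring⟩
    rcases Nat.even_or_odd' e with ⟨k, hk | hk⟩
    · rw [hk]; exact hsq k
    · rw [hk, pow_succ]
      refine (NN K).mul_mem (hsq k) ?_
      rw [emultiplicity_eq_coe, hk] at hmul
      obtain ⟨g, hg⟩ := h π hirr k hmul.1 hmul.2
      obtain ⟨c, r, s, -, h1⟩ := thue hK π g hirr.ne_zero hg
      exact ⟨c, r, s, h1⟩
  · obtain ⟨c, hc, h1⟩ := Polynomial.isUnit_iff.1 u.isUnit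
    exact ⟨c, 1, 0, by rw [← h1]; simp⟩

theorem two_sq_of_mem_NN {K : Type*} [Field K]
    (P : Polynomial K) (hP : P ∈ NN K) (w : K) (hw : w ≠ 0) (h0 : P.eval 0 = w ^ 2) :
    ∃ H1 H2 : Polynomial K, P = H1 ^ 2 + H2 ^ 2 := by
  obtain ⟨c, r, s, rfl⟩ := hP
  simp only [Polynomial.eval_mul, Polynomial.eval_C, Polynomial.eval_add, Polynomial.eval_pow] at h0
  set r0 := r.eval 0
  set s0 := s.eval 0
  have hN : r0 ^ 2 + s0 ^ 2 ≠ 0 := by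
    intro h; rw [h] at h0; apply hw; simpa using h0.symm
  have hc : c = (w * r0 / (r0 ^ 2 + s0 ^ 2)) ^ 2 + (w * s0 / (r0 ^ 2 + s0 ^ 2)) ^ 2 := by
    field_simp
    linear_combination h0
  set a := w * r0 / (r0 ^ 2 + s0 ^ 2)
  set b := w * s0 / (r0 ^ 2 + s0 ^ 2)
  refine ⟨Polynomial.C a * r - Polynomial.C b * s, Polynomial.C a * s + Polynomial.C b * r, ?_⟩
  rw [hc, Polynomial.C_add, Polynomial.C_pow, Polynomial.C_pow]; ring

/-- The transform of `q` under the substitution `y = ((a + z / a) / 2) ^ 2`, denominators cleared. -/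
def PP {R : Type*} [CommRing R] (z : R) (q : Polynomial R) : Polynomial R :=
  ∑ j ∈ Finset.range (q.natDegree + 1), Polynomial.C (q.coeff j) *
    (Polynomial.X ^ 2 + Polynomial.C z) ^ (2 * j) * (4 * Polynomial.X ^ 2) ^ (q.natDegree - j)

theorem PP_aeval {R B : Type*} [CommRing R] [CommRing B] [Algebra R B] (z : R) (q : Polynomial R)
    (θ y : B) (h : 4 * θ ^ 2 * y = (θ ^ 2 + algebraMap R B z) ^ 2) :
    Polynomial.aeval θ (PP z q) = (4 * θ ^ 2) ^ q.natDegree * Polynomial.aeval y q := by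
  rw [PP, map_sum, Polynomial.aeval_eq_sum_range, Finset.mul_sum]
  refine Finset.sum_congr rfl fun j hj => ?_
  have hj' : j ≤ q.natDegree := by simpa [Nat.lt_succ_iff] using hj
  simp only [map_mul, map_pow, map_add, Polynomial.aeval_X, Polynomial.aeval_C, map_ofNat]
  rw [pow_mul, ← h, Algebra.smul_def]
  obtain ⟨k, hk⟩ := Nat.exists_eq_add_of_le hj'
  rw [hk, Nat.add_sub_cancel_left]
  ring

theorem PP_eval_zero {R : Type*} [CommRing R] (z : R) (q : Polynomial R) (hq : q.Monic) :
    (PP z q).eval 0 = (z ^ q.natDegree) ^ 2 := by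
  rw [PP, Polynomial.eval_finsetSum, Finset.sum_eq_single q.natDegree]
  · simp [hq]; ring
  · intro j hj hne
    have hj' : j < q.natDegree := by
      have := Finset.mem_range.1 hj
      omega
    simp only [Polynomial.eval_mul, Polynomial.eval_pow, Polynomial.eval_X, Polynomial.eval_ofNat]
    rw [zero_pow (by norm_num), mul_zero, zero_pow (by omega), mul_zero]
  · intro h; simp at h

instance instAdic : IsAdicComplete (IsLocalRing.maximalIdeal (PowerSeries ℝ)) (PowerSeries ℝ) := by
  rw [PowerSeries.maximalIdeal_eq_span_X]; infer_instance

theorem exists_hom {R B : Type*} [CommRing R] [IsLocalRing R]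
    [IsAdicComplete (IsLocalRing.maximalIdeal R) R] [CommRing B] [Algebra R B] (y : B)
    (p : Polynomial R)
    (hp : p.IsDistinguishedAt (IsLocalRing.maximalIdeal R))
    (M : ℕ) (hM : (Polynomial.aeval y p) ^ M = 0) :
    ∃ Φ : PowerSeries R →+* B, ∀ q : Polynomial R,
      Φ (q : PowerSeries R) = Polynomial.aeval y q := by
  have hpM : (p ^ M).IsDistinguishedAt (IsLocalRing.maximalIdeal R) := by
    clear hM
    induction M with
    | zero => 
      rw [pow_zero]
      exact ⟨⟨by intro n hn; simp at hn⟩, Polynomial.monic_one⟩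
    | succ M ih => rw [pow_succ]; exact ih.mul hp
  let e := hpM.algEquivQuotient
  let ψ : (Polynomial R ⧸ Ideal.span {p ^ M}) →+* B :=
    Ideal.Quotient.lift _ (Polynomial.aeval y : Polynomial R →ₐ[R] B).toRingHom
      (by
        intro a ha
        obtain ⟨b, rfl⟩ := Ideal.mem_span_singleton.1 ha
        simp [hM])
  refine ⟨ψ.comp (e.symm.toAlgHom.toRingHom.comp (Ideal.Quotient.mk _)), fun q => ?_⟩
  have : e (Ideal.Quotient.mk _ q) = Ideal.Quotient.mk _ (q : PowerSeries R) := by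
    simp [e]
  simp only [RingHom.comp_apply]
  rw [← this]
  simp [ψ]


theorem isSumSq_lift {A B : Type*} [CommRing A] [CommRing B] (φ : A →+* B)
    (hφ : Function.Surjective φ) {s : B} (h : IsSumSq s) : ∃ t, IsSumSq t ∧ φ t = s := by
  induction h with
  | zero => exact ⟨0, by simp, by simp⟩
  | sq_add a _ ih =>
    obtain ⟨t, ht, rfl⟩ := ih
    obtain ⟨b, rfl⟩ := hφ a
    exact ⟨b * b + t, (IsSumSq.mul_self _).add ht, by simp⟩

theorem isSumSq_of_closure {A B : Type*} [CommRing A] [CommRing B] (φ : A →+* B) (S : Set A)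
    (hS : ∀ s ∈ S, IsSumSq (φ s)) (t : A) (ht : t ∈ preorderingGen S) : IsSumSq (φ t) := by
  refine Subsemiring.closure_induction (p := fun t _ => IsSumSq (φ t)) ?_ ?_ ?_ ?_ ?_ ht
  · rintro s (hs | ⟨b, rfl⟩)
    · exact hS s hs
    · rw [sq, map_mul]; exact IsSumSq.mul_self _
  · simp
  · simp
  · intro a b _ _ ha hb; rw [map_add]; exact ha.add hb
  · intro a b _ _ ha hb; rw [map_mul]; exact ha.mul hb

theorem PP_map_eval_zero {R K : Type*} [CommRing R] [CommRing K] [Algebra R K] (z : R)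
    (q : Polynomial R) (hq : q.Monic) :
    ((PP z q).map (algebraMap R K)).eval 0 = (algebraMap R K z ^ q.natDegree) ^ 2 := by
  rw [← Polynomial.coeff_zero_eq_eval_zero, Polynomial.coeff_map,
    Polynomial.coeff_zero_eq_eval_zero, PP_eval_zero z q hq, map_pow, map_pow]

theorem core_neg_one {R K : Type*} [CommRing R] [IsLocalRing R]
    [IsAdicComplete (IsLocalRing.maximalIdeal R) R] [Field K] [CharZero K] [Algebra R K]
    (z xl : R) (hz : algebraMap R K z ≠ 0) (hxl : algebraMap R K xl ≠ 0)
    (p d : Polynomial R) (hp : p.IsDistinguishedAt (IsLocalRing.maximalIdeal R)) (hd : d.Monic)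
    (u : PowerSeries R) (hu : IsUnit u)
    (ht : (PowerSeries.C xl * (d : PowerSeries R) * u) ^ 2 * (p : PowerSeries R) ∈
      preorderingGen {PowerSeries.X, PowerSeries.X - PowerSeries.C z})
    (π : Polynomial K) (hπ : Irreducible π) (k : ℕ)
    (h1 : π ^ (2 * k + 1) ∣ (PP z p).map (algebraMap R K))
    (h2 : ¬ π ^ (2 * k + 2) ∣ (PP z p).map (algebraMap R K)) :
    IsSumSq (-1 : AdjoinRoot π) := by
  by_contra hE
  have : Fact (Irreducible π) := ⟨hπ⟩
  set P := (PP z p).map (algebraMap R K) with hPdef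
  set G := (PP z d).map (algebraMap R K) with hGdef
  have hP0 : P.eval 0 ≠ 0 := by
    rw [hPdef, PP_map_eval_zero z p hp.monic]
    exact pow_ne_zero _ (pow_ne_zero _ hz)
  have hG0 : G ≠ 0 := by
    intro h0
    have : G.eval 0 ≠ 0 := by
      rw [hGdef, PP_map_eval_zero z d hd]
      exact pow_ne_zero _ (pow_ne_zero _ hz)
    rw [h0] at this; simp at this
  have hπP : π ∣ P := (dvd_pow_self π (by omega)).trans h1
  have hX : ¬ (Polynomial.X : Polynomial K) ∣ π := by
    intro h
    have := h.trans hπP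
    rw [Polynomial.X_dvd_iff, Polynomial.coeff_zero_eq_eval_zero] at this
    exact hP0 this
  obtain ⟨j, G', hG', hGG⟩ : ∃ (j : ℕ) (G' : Polynomial K), ¬ π ∣ G' ∧ G = π ^ j * G' := by
    obtain ⟨G', h, h'⟩ := (FiniteMultiplicity.of_not_isUnit hπ.not_isUnit hG0).exists_eq_pow_mul_and_not_dvd
    exact ⟨_, G', h', h⟩
  set M := 2 * (j + k) + 2 with hM
  -- the quotient ring
  let B := AdjoinRoot (π ^ M)
  let mk : Polynomial K →+* B := AdjoinRoot.mk (π ^ M)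
  have hmk : ∀ q : Polynomial R, Polynomial.aeval (mk Polynomial.X) q = mk (q.map (algebraMap R K)) := by
    intro q
    have := AdjoinRoot.aeval_eq (f := π ^ M) (q.map (algebraMap R K))
    rw [Polynomial.aeval_map_algebraMap] at this
    exact this
  have hcop : IsCoprime (Polynomial.X : Polynomial K) (π ^ M) := by
    refine IsCoprime.pow_right ?_
    exact (Polynomial.irreducible_X.coprime_iff_not_dvd).2 hX
  obtain ⟨a, b, hab⟩ := hcop
  set θ : B := mk Polynomial.X with hθ
  have hθ1 : mk a * θ = 1 := by
    have := congrArg mk hab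
    have h0 : mk (π ^ M) = 0 := AdjoinRoot.mk_self
    rw [map_add, map_mul, map_mul, h0, mul_zero, add_zero, map_one] at this
    exact this
  set θ' : B := mk a with hθ'
  set hf : B := algebraMap K B (1 / 2) with hhf
  have hf2 : 2 * hf = 1 := by
    have : algebraMap K B (2 * (1 / 2)) = 1 := by rw [mul_one_div_cancel two_ne_zero, map_one]
    rw [map_mul, map_ofNat] at this
    exact this
  set zz : B := algebraMap R B z with hzz
  set uu := hf * (θ + zz * θ') with huu
  set vv := hf * (θ - zz * θ') with hvv
  have huv : uu * uu - zz = vv * vv := by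
    rw [huu, hvv]
    linear_combination zz * (2 * hf + 1) * hf2 + 4 * hf ^ 2 * zz * hθ1
  have hy : 4 * θ ^ 2 * (uu * uu) = (θ ^ 2 + zz) ^ 2 := by
    have h3 : 2 * θ * uu = θ ^ 2 + zz := by
      rw [huu]
      linear_combination (θ ^ 2 + θ' * θ * zz) * hf2 + zz * hθ1
    rw [← h3]; ring
  have hpa := PP_aeval z p θ (uu * uu) hy
  have hda := PP_aeval z d θ (uu * uu) hy
  rw [hmk] at hpa hda
  rw [← hPdef] at hpa
  rw [← hGdef] at hda
  have hinv : (hf * θ') ^ 2 * (4 * θ ^ 2) = 1 := by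
    have : (hf * θ') ^ 2 * (4 * θ ^ 2) = ((2 * hf) * (θ' * θ)) ^ 2 := by ring
    rw [this, hf2, hθ1]; simp
  have hnil : (Polynomial.aeval (uu * uu) p) ^ M = 0 := by
    have h3 : Polynomial.aeval (uu * uu) p = ((hf * θ') ^ 2) ^ p.natDegree * mk P := by
      rw [hpa, ← mul_assoc (_ ^ _), ← mul_pow (_ ^ 2), hinv, one_pow, one_mul]
    obtain ⟨P', hP'⟩ := hπP
    have h0 : mk (π ^ M) = 0 := AdjoinRoot.mk_self
    rw [h3, mul_pow (_ ^ _), ← map_pow, hP', mul_pow π, map_mul, h0]; simp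
  obtain ⟨Φ, hΦ⟩ := exists_hom (uu * uu) p hp M hnil
  have hsum := isSumSq_of_closure Φ _ (by
    rintro s (rfl | rfl)
    · have := hΦ Polynomial.X
      rw [Polynomial.coe_X, Polynomial.aeval_X] at this
      rw [this]; exact IsSumSq.mul_self _
    · have h3 := hΦ Polynomial.X
      rw [Polynomial.coe_X, Polynomial.aeval_X] at h3
      have h4 := hΦ (Polynomial.C z)
      rw [Polynomial.coe_C, Polynomial.aeval_C] at h4
      rw [map_sub, h3, h4, huv]; exact IsSumSq.mul_self _) _ ht
  have hxl' : Φ (PowerSeries.C xl) = algebraMap R B xl := by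
    have h4 := hΦ (Polynomial.C xl)
    rwa [Polynomial.coe_C, Polynomial.aeval_C] at h4
  rw [map_mul, map_pow, map_mul, map_mul, hΦ, hΦ, hxl'] at hsum
  obtain ⟨u', hu'⟩ := hu.exists_left_inv
  have hu1 : Φ u' * Φ u = 1 := by rw [← map_mul, hu', map_one]
  set xi : B := algebraMap K B (algebraMap R K xl)⁻¹ with hxi
  have hx1 : xi * algebraMap R B xl = 1 := by
    rw [hxi, IsScalarTower.algebraMap_apply R K B, ← map_mul, inv_mul_cancel₀ hxl, map_one]
  have hW : mk (G ^ 2 * P) = ((xi * Φ u' * (4 * θ ^ 2) ^ d.natDegree * (2 * θ) ^ p.natDegree) *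
      (xi * Φ u' * (4 * θ ^ 2) ^ d.natDegree * (2 * θ) ^ p.natDegree)) *
      ((algebraMap R B xl * Polynomial.aeval (uu * uu) d * Φ u) ^ 2 *
        Polynomial.aeval (uu * uu) p) := by
    rw [map_mul, map_pow, hpa, hda]
    have h4 : (4 * θ ^ 2) ^ p.natDegree = ((2 * θ) ^ p.natDegree) ^ 2 := by
      rw [← pow_mul, mul_comm p.natDegree, pow_mul]; congr 1; ring
    rw [h4]
    have h5 : xi * Φ u' * (algebraMap R B xl * Φ u) = 1 := by
      linear_combination (Φ u' * Φ u) * hx1 + hu1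
    set c1 := (4 * θ ^ 2) ^ d.natDegree
    set c2 := (2 * θ) ^ p.natDegree
    set c3 := Polynomial.aeval (uu * uu) d
    set c4 := Polynomial.aeval (uu * uu) p
    have h6 : (xi * Φ u' * c1 * c2 * (xi * Φ u' * c1 * c2) *
      ((algebraMap R B xl * c3 * Φ u) ^ 2 * c4)) =
      (xi * Φ u' * (algebraMap R B xl * Φ u)) ^ 2 * ((c1 * c3) ^ 2 * (c2 ^ 2 * c4)) := by ring
    rw [h6, h5]; ring
  have hWs : IsSumSq (mk (G ^ 2 * P)) := by
    rw [hW]; exact (IsSumSq.mul_self _).mul hsum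
  obtain ⟨s, hs, hsW⟩ := isSumSq_lift mk AdjoinRoot.mk_surjective hWs
  have hdvd : π ^ M ∣ s - G ^ 2 * P := by
    rw [← AdjoinRoot.mk_eq_mk]; exact hsW
  have e1 : G ^ 2 * P = π ^ (2 * j) * (G' ^ 2 * P) := by rw [hGG]; ring
  have hW1 : π ^ (2 * (j + k) + 1) ∣ G ^ 2 * P := by
    rw [e1, show 2 * (j + k) + 1 = 2 * j + (2 * k + 1) by ring, pow_add]
    exact mul_dvd_mul_left _ (h1.mul_left _)
  have hs1 : π ^ (2 * (j + k) + 1) ∣ s := by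
    have h3 : π ^ (2 * (j + k) + 1) ∣ s - G ^ 2 * P := (pow_dvd_pow π (by omega)).trans hdvd
    have := dvd_add h3 hW1
    rwa [sub_add_cancel] at this
  have hs2 := sumSq_dvd_pow π hE (j + k) s hs hs1
  have hW2 : π ^ M ∣ G ^ 2 * P := (dvd_sub_right hs2).1 hdvd
  rw [e1, hM, show 2 * (j + k) + 2 = 2 * j + (2 * k + 2) by ring, pow_add,
    mul_dvd_mul_iff_left (pow_ne_zero _ hπ.ne_zero)] at hW2
  exact h2 (hπ.prime.pow_dvd_of_dvd_mul_left _ (fun h => hG' (hπ.prime.dvd_of_dvd_pow h)) hW2)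

theorem K_two_sq {K : Type*} [Field K] [Algebra (PowerSeries ℝ) K]
    [IsFractionRing (PowerSeries ℝ) K] (a b : K) (h : a ^ 2 + b ^ 2 = 0) : a = 0 := by
  by_contra ha
  have h1 : (b / a) ^ 2 = -1 := by field_simp; linear_combination h
  obtain ⟨w, hw⟩ := IsIntegrallyClosed.exists_algebraMap_eq_of_isIntegral_pow (R := PowerSeries ℝ)
    (K := K) (x := b / a) (n := 2) (by norm_num) (by
      rw [h1]; exact isIntegral_one.neg)
  have h2 : w ^ 2 = -1 := by
    apply IsFractionRing.injective (PowerSeries ℝ) K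
    rw [map_pow, hw, h1]; simp
  have h3 := congrArg PowerSeries.constantCoeff h2
  simp only [map_pow, map_neg, map_one] at h3
  nlinarith [sq_nonneg (PowerSeries.constantCoeff w)]

theorem P_two_sq {K : Type*} [Field K] [Algebra (PowerSeries ℝ) K]
    [IsFractionRing (PowerSeries ℝ) K] (z xl : PowerSeries ℝ) (hz : z ≠ 0) (hxl : xl ≠ 0)
    (p d : Polynomial (PowerSeries ℝ))
    (hp : p.IsDistinguishedAt (IsLocalRing.maximalIdeal (PowerSeries ℝ))) (hd : d.Monic)
    (u : PowerSeries (PowerSeries ℝ)) (hu : IsUnit u)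
    (ht : (PowerSeries.C xl * (d : PowerSeries (PowerSeries ℝ)) * u) ^ 2 *
      (p : PowerSeries (PowerSeries ℝ)) ∈
      preorderingGen {PowerSeries.X, PowerSeries.X - PowerSeries.C z}) :
    ∃ H1 H2 : Polynomial K, (PP z p).map (algebraMap (PowerSeries ℝ) K) = H1 ^ 2 + H2 ^ 2 := by
  have hR : CharZero (PowerSeries ℝ) :=
    charZero_of_injective_ringHom (f := PowerSeries.C (R := ℝ)) PowerSeries.C_injective
  have hK0 : CharZero K := charZero_of_injective_algebraMap (IsFractionRing.injective (PowerSeries ℝ) K)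
  have hinj := IsFractionRing.injective (PowerSeries ℝ) K
  have hz' : algebraMap (PowerSeries ℝ) K z ≠ 0 := by rwa [Ne, map_eq_zero_iff _ hinj]
  have hxl' : algebraMap (PowerSeries ℝ) K xl ≠ 0 := by rwa [Ne, map_eq_zero_iff _ hinj]
  have h0 : ((PP z p).map (algebraMap (PowerSeries ℝ) K)).eval 0 =
      (algebraMap (PowerSeries ℝ) K z ^ p.natDegree) ^ 2 := PP_map_eval_zero z p hp.monic
  refine two_sq_of_mem_NN _ ?_ _ (pow_ne_zero _ hz') h0
  refine mem_NN K_two_sq _ ?_ ?_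
  · intro h
    rw [h, Polynomial.eval_zero] at h0
    exact pow_ne_zero _ (pow_ne_zero _ hz') h0.symm
  · intro π hπ k h1 h2
    have hs := core_neg_one z xl hz' hxl' p d hp hd u hu ht π hπ k h1 h2
    have : Fact (Irreducible π) := ⟨hπ⟩
    have hfin : FiniteDimensional K (AdjoinRoot π) := (AdjoinRoot.powerBasis hπ.ne_zero).finite
    obtain ⟨g, hg⟩ := factF (K := K) hs
    obtain ⟨g, rfl⟩ := AdjoinRoot.mk_surjective g
    refine ⟨g, ?_⟩
    rw [← AdjoinRoot.mk_eq_zero, map_add, map_pow, hg]; simp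


theorem X_dvd_of_two_sq (G1 G2 : Polynomial (PowerSeries ℝ))
    (h : Polynomial.C PowerSeries.X ∣ G1 ^ 2 + G2 ^ 2) : Polynomial.C PowerSeries.X ∣ G1 := by
  have h1 : (G1.map PowerSeries.constantCoeff) ^ 2 + (G2.map PowerSeries.constantCoeff) ^ 2 = 0 := by
    obtain ⟨q, hq⟩ := h
    rw [← Polynomial.map_pow, ← Polynomial.map_pow, ← Polynomial.map_add, hq, Polynomial.map_mul,
      Polynomial.map_C]
    simp
  have h2 := poly_two_sq_ne (K := ℝ) (by intro a b hab; nlinarith [sq_nonneg a, sq_nonneg b]) _ _ h1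
  rw [Polynomial.C_dvd_iff_dvd_coeff]
  intro i
  rw [PowerSeries.X_dvd_iff]
  have := congrArg (fun q => Polynomial.coeff q i) h2
  simpa using this

theorem X_pow_dvd_of_two_sq (c : ℕ) : ∀ (G1 G2 : Polynomial (PowerSeries ℝ)),
    Polynomial.C (PowerSeries.X ^ c) ^ 2 ∣ G1 ^ 2 + G2 ^ 2 →
    Polynomial.C (PowerSeries.X ^ c) ∣ G1 ∧ Polynomial.C (PowerSeries.X ^ c) ∣ G2 := by
  induction c with
  | zero => intro G1 G2 _; simp
  | succ c ih =>
    intro G1 G2 h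
    have e : Polynomial.C ((PowerSeries.X : PowerSeries ℝ) ^ (c + 1)) =
      Polynomial.C PowerSeries.X * Polynomial.C (PowerSeries.X ^ c) := by
      rw [← Polynomial.C_mul, pow_succ']
    rw [e] at h ⊢
    have h0 : Polynomial.C (PowerSeries.X : PowerSeries ℝ) ∣ G1 ^ 2 + G2 ^ 2 :=
      ((dvd_mul_right _ _).trans (dvd_pow_self _ two_ne_zero)).trans h
    obtain ⟨G1, rfl⟩ := X_dvd_of_two_sq G1 G2 h0
    obtain ⟨G2, rfl⟩ := X_dvd_of_two_sq G2 _ (by rw [add_comm]; exact h0)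
    have hX : Polynomial.C (PowerSeries.X : PowerSeries ℝ) ≠ 0 := by simp [PowerSeries.X_ne_zero]
    have h1 : Polynomial.C ((PowerSeries.X : PowerSeries ℝ) ^ c) ^ 2 ∣ G1 ^ 2 + G2 ^ 2 := by
      rw [mul_pow, mul_pow, mul_pow, ← mul_add] at h
      exact (mul_dvd_mul_iff_left (pow_ne_zero _ hX)).1 h
    obtain ⟨h2, h3⟩ := ih _ _ h1
    exact ⟨mul_dvd_mul_left _ h2, mul_dvd_mul_left _ h3⟩

theorem C_dvd_of_two_sq (b : PowerSeries ℝ) (hb : b ≠ 0) (G1 G2 : Polynomial (PowerSeries ℝ))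
    (h : Polynomial.C b ^ 2 ∣ G1 ^ 2 + G2 ^ 2) : Polynomial.C b ∣ G1 ∧ Polynomial.C b ∣ G2 := by
  obtain ⟨c, u, rfl⟩ := IsDiscreteValuationRing.eq_unit_mul_pow_irreducible hb
    (PowerSeries.X_prime (R := ℝ)).irreducible
  have hu : IsUnit (Polynomial.C (u : PowerSeries ℝ)) := u.isUnit.map Polynomial.C
  have hu2 : IsUnit (Polynomial.C (u : PowerSeries ℝ) ^ 2) := hu.pow 2
  rw [Polynomial.C_mul] at h ⊢
  rw [mul_pow, hu2.mul_left_dvd] at h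
  rw [hu.mul_left_dvd, hu.mul_left_dvd]
  exact X_pow_dvd_of_two_sq c _ _ h

theorem integral_two_sq {K : Type*} [Field K] [Algebra (PowerSeries ℝ) K]
    [IsFractionRing (PowerSeries ℝ) K] (P : Polynomial (PowerSeries ℝ)) (H1 H2 : Polynomial K)
    (h : P.map (algebraMap (PowerSeries ℝ) K) = H1 ^ 2 + H2 ^ 2) :
    ∃ G1 G2 : Polynomial (PowerSeries ℝ), P = G1 ^ 2 + G2 ^ 2 := by
  have hinj : Function.Injective (Polynomial.map (algebraMap (PowerSeries ℝ) K)) :=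
    Polynomial.map_injective _ (IsFractionRing.injective (PowerSeries ℝ) K)
  have hden : ∀ H : Polynomial K, ∃ (b : PowerSeries ℝ) (G : Polynomial (PowerSeries ℝ)), b ≠ 0 ∧
      G.map (algebraMap (PowerSeries ℝ) K) =
        (Polynomial.C b).map (algebraMap (PowerSeries ℝ) K) * H := by
    intro H
    obtain ⟨b, hb, hbb⟩ := IsLocalization.integerNormalization_spec
      (nonZeroDivisors (PowerSeries ℝ)) H
    refine ⟨b, IsLocalization.integerNormalization (nonZeroDivisors (PowerSeries ℝ)) H,
      nonZeroDivisors.ne_zero hb, ?_⟩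
    rw [hbb, Polynomial.map_C, Algebra.smul_def]; rfl
  obtain ⟨b1, G1, hb1, h1⟩ := hden H1
  obtain ⟨b2, G2, hb2, h2⟩ := hden H2
  have hd : Polynomial.C (b1 * b2) ^ 2 * P = (Polynomial.C b2 * G1) ^ 2 + (Polynomial.C b1 * G2) ^ 2 := by
    apply hinj
    simp only [Polynomial.map_mul, Polynomial.map_pow, Polynomial.map_add, h, h1, h2,
      Polynomial.C_mul]
    ring
  have hb : b1 * b2 ≠ 0 := mul_ne_zero hb1 hb2
  obtain ⟨⟨k1, e1⟩, ⟨k2, e2⟩⟩ := C_dvd_of_two_sq (b1 * b2) hb _ _ (Dvd.intro _ hd)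
  refine ⟨k1, k2, ?_⟩
  rw [e1, e2] at hd
  have h0 : Polynomial.C (b1 * b2) ^ 2 ≠ 0 := pow_ne_zero _ (by simpa using hb)
  apply mul_left_cancel₀ h0
  rw [hd]; ring

theorem coeff_dvd (z : PowerSeries ℝ) (hz : z ≠ 0) (p G1 G2 : Polynomial (PowerSeries ℝ))
    (h : PP z p = G1 ^ 2 + G2 ^ 2) :
    (∀ j ≤ p.natDegree, z ^ (p.natDegree - j) ∣ G1.coeff j) ∧
    (∀ j ≤ p.natDegree, z ^ (p.natDegree - j) ∣ G2.coeff j) := by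
  set m := p.natDegree with hm
  have h1 : Polynomial.C (z ^ m) ^ 2 ∣ (PP z p).comp (Polynomial.C z * Polynomial.X) := by
    rw [PP, ← Polynomial.coe_compRingHom_apply, map_sum]
    refine Finset.dvd_sum fun j hj => ?_
    have hj' : j ≤ m := by simpa [Nat.lt_succ_iff] using hj
    obtain ⟨k, hk⟩ := Nat.exists_eq_add_of_le hj'
    rw [← hm, hk, Nat.add_sub_cancel_left]
    simp only [Polynomial.coe_compRingHom_apply, Polynomial.mul_comp, Polynomial.pow_comp,
      Polynomial.add_comp, Polynomial.X_comp, Polynomial.C_comp, Polynomial.ofNat_comp]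
    refine ⟨Polynomial.C (p.coeff j) * (Polynomial.C z * Polynomial.X ^ 2 + 1) ^ (2 * j) *
      (4 * Polynomial.X ^ 2) ^ k, ?_⟩
    have e1 : (Polynomial.C z * Polynomial.X) ^ 2 + Polynomial.C z =
      Polynomial.C z * (Polynomial.C z * Polynomial.X ^ 2 + 1) := by ring
    rw [e1, mul_pow, mul_pow, Polynomial.C_pow]
    ring
  rw [h, Polynomial.add_comp, Polynomial.pow_comp, Polynomial.pow_comp] at h1
  obtain ⟨h2, h3⟩ := C_dvd_of_two_sq _ (pow_ne_zero m hz) _ _ h1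
  have key : ∀ G : Polynomial (PowerSeries ℝ),
      Polynomial.C (z ^ m) ∣ G.comp (Polynomial.C z * Polynomial.X) →
      ∀ j ≤ m, z ^ (m - j) ∣ G.coeff j := by
    intro G hG j hj
    rw [Polynomial.C_dvd_iff_dvd_coeff] at hG
    have := hG j
    rw [Polynomial.comp_C_mul_X_coeff] at this
    obtain ⟨k, hk⟩ := Nat.exists_eq_add_of_le hj
    rw [hk, Nat.add_sub_cancel_left]
    rw [hk, pow_add, mul_comm (z ^ j)] at this
    exact (mul_dvd_mul_iff_right (pow_ne_zero j hz)).1 this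
  exact ⟨key _ h2, key _ h3⟩


/-- Functions of the two square roots `u = √y`, `v = √(y - z)` given by a universal formula. -/
def IsForm {R B : Type*} [CommRing R] [CommRing B] [Algebra R B] (y : B) (z : R) (F : B → B → B) :
    Prop :=
  ∃ α0 α1 α2 α3 : Polynomial R, ∀ u v : B, u ^ 2 = y → v ^ 2 = y - algebraMap R B z →
    F u v = Polynomial.aeval y α0 + Polynomial.aeval y α1 * u + Polynomial.aeval y α2 * v +
      Polynomial.aeval y α3 * (u * v)

section
variable {R B : Type*} [CommRing R] [CommRing B] [Algebra R B] {y : B} {z : R}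

theorem isForm_const (r : R) : IsForm y z (fun _ _ => algebraMap R B r) :=
  ⟨Polynomial.C r, 0, 0, 0, by intros; simp⟩

theorem isForm_u : IsForm y z (fun u _ => u) := ⟨0, 1, 0, 0, by intros; simp⟩

theorem isForm_v : IsForm y z (fun _ v => v) := ⟨0, 0, 1, 0, by intros; simp⟩

theorem IsForm.add {F G : B → B → B} (hF : IsForm y z F) (hG : IsForm y z G) :
    IsForm y z (fun u v => F u v + G u v) := by
  obtain ⟨a0, a1, a2, a3, ha⟩ := hF
  obtain ⟨b0, b1, b2, b3, hb⟩ := hG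
  refine ⟨a0 + b0, a1 + b1, a2 + b2, a3 + b3, fun u v hu hv => ?_⟩
  show F u v + G u v = _
  rw [ha u v hu hv, hb u v hu hv]
  simp only [map_add]; ring

theorem IsForm.mul {F G : B → B → B} (hF : IsForm y z F) (hG : IsForm y z G) :
    IsForm y z (fun u v => F u v * G u v) := by
  obtain ⟨a0, a1, a2, a3, ha⟩ := hF
  obtain ⟨b0, b1, b2, b3, hb⟩ := hG
  refine ⟨a0 * b0 + a1 * b1 * Polynomial.X + a2 * b2 * (Polynomial.X - Polynomial.C z) +
      a3 * b3 * Polynomial.X * (Polynomial.X - Polynomial.C z),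
    a0 * b1 + a1 * b0 + (a2 * b3 + a3 * b2) * (Polynomial.X - Polynomial.C z),
    a0 * b2 + a2 * b0 + (a1 * b3 + a3 * b1) * Polynomial.X,
    a0 * b3 + a3 * b0 + a1 * b2 + a2 * b1, fun u v hu hv => ?_⟩
  show F u v * G u v = _
  rw [ha u v hu hv, hb u v hu hv]
  simp only [map_add, map_mul, map_sub, Polynomial.aeval_X, Polynomial.aeval_C]
  rw [← hv, ← hu]; ring

theorem IsForm.pow {F : B → B → B} (hF : IsForm y z F) (k : ℕ) :
    IsForm y z (fun u v => F u v ^ k) := by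
  induction k with
  | zero => simpa using isForm_const (y := y) (z := z) 1
  | succ k ih => simpa only [pow_succ] using ih.mul hF

theorem IsForm.sum {ι : Type*} (s : Finset ι) (F : ι → B → B → B)
    (hF : ∀ i ∈ s, IsForm y z (F i)) : IsForm y z (fun u v => ∑ i ∈ s, F i u v) := by
  classical
  induction s using Finset.induction_on with
  | empty => simpa using isForm_const (y := y) (z := z) 0
  | insert a s ha ih =>
    simp only [Finset.sum_insert ha]
    exact (hF a (by simp)).add (ih fun i hi => hF i (by simp [hi]))

theorem exists_form (y : B) (m : ℕ) (H : Polynomial R)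
    (hH : ∀ j ≤ m, z ^ (m - j) ∣ H.coeff j) :
    ∃ F : B → B → B, IsForm y z F ∧ ∀ u v : B, u ^ 2 = y → v ^ 2 = y - algebraMap R B z →
      Polynomial.aeval (u + v) H = (u + v) ^ m * F u v := by
  choose! k hk using hH
  have hplus : IsForm y z (fun u v => u + v) := isForm_u.add isForm_v
  have hminus : IsForm y z (fun u v => u + algebraMap R B (-1) * v) :=
    isForm_u.add ((isForm_const (-1)).mul isForm_v)
  refine ⟨fun u v => ∑ j ∈ Finset.range (H.natDegree + 1),
    (if m ≤ j then algebraMap R B (H.coeff j) * (u + v) ^ (j - m)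
      else algebraMap R B (k j) * (u + algebraMap R B (-1) * v) ^ (m - j)), ?_, ?_⟩
  · refine IsForm.sum _ _ fun j _ => ?_
    by_cases hj : m ≤ j
    · simp only [hj, if_true]
      exact (isForm_const _).mul (hplus.pow _)
    · simp only [hj, if_false]
      exact (isForm_const _).mul (hminus.pow _)
  · intro u v hu hv
    rw [Polynomial.aeval_eq_sum_range, Finset.mul_sum]
    refine Finset.sum_congr rfl fun j _ => ?_
    rw [Algebra.smul_def]
    by_cases hj : m ≤ j
    · simp only [hj, if_true]
      obtain ⟨i, rfl⟩ := Nat.exists_eq_add_of_le hj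
      rw [Nat.add_sub_cancel_left]; ring
    · simp only [hj, if_false]
      obtain ⟨i, rfl⟩ := Nat.exists_eq_add_of_le (le_of_not_ge hj)
      rw [hk j (by omega), Nat.add_sub_cancel_left, map_mul, map_pow]
      have hz : algebraMap R B z = (u + v) * (u + algebraMap R B (-1) * v) := by
        rw [map_neg, map_one]; linear_combination hv - hu
      rw [hz, mul_pow]; ring

end

theorem projection {R C : Type*} [CommRing R] [Field C] [CharZero C] [Algebra R C] (y u v : C)
    (z : R) (hz : algebraMap R C z ≠ 0) (hu : u ^ 2 = y) (hv : v ^ 2 = y - algebraMap R C z)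
    (hinj : Function.Injective (Polynomial.aeval y : Polynomial R →ₐ[R] C))
    (p G1 G2 : Polynomial R) (h : PP z p = G1 ^ 2 + G2 ^ 2)
    (h1 : ∀ j ≤ p.natDegree, z ^ (p.natDegree - j) ∣ G1.coeff j)
    (h2 : ∀ j ≤ p.natDegree, z ^ (p.natDegree - j) ∣ G2.coeff j) :
    ∃ a0 a1 a2 a3 b0 b1 b2 b3 : Polynomial R, 4 ^ p.natDegree * p =
      (a0 ^ 2 + Polynomial.X * a1 ^ 2 + (Polynomial.X - Polynomial.C z) * a2 ^ 2 +
        Polynomial.X * (Polynomial.X - Polynomial.C z) * a3 ^ 2) +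
      (b0 ^ 2 + Polynomial.X * b1 ^ 2 + (Polynomial.X - Polynomial.C z) * b2 ^ 2 +
        Polynomial.X * (Polynomial.X - Polynomial.C z) * b3 ^ 2) := by
  obtain ⟨F1, ⟨a0, a1, a2, a3, ha⟩, hF1⟩ := exists_form y p.natDegree G1 h1
  obtain ⟨F2, ⟨b0, b1, b2, b3, hb⟩, hF2⟩ := exists_form y p.natDegree G2 h2
  refine ⟨a0, a1, a2, a3, b0, b1, b2, b3, hinj ?_⟩
  have key : ∀ u v : C, u ^ 2 = y → v ^ 2 = y - algebraMap R C z →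
      4 ^ p.natDegree * Polynomial.aeval y p = F1 u v ^ 2 + F2 u v ^ 2 := by
    intro u v hu hv
    have hθ : u + v ≠ 0 := by
      intro h0
      apply hz
      linear_combination hv - hu + (u - v) * h0
    have h3 := PP_aeval z p (u + v) y (by
      have : (u + v) ^ 2 + algebraMap R C z = 2 * u * (u + v) := by linear_combination hv - hu
      rw [this, ← hu]; ring)
    rw [h, map_add, map_pow, map_pow, hF1 u v hu hv, hF2 u v hu hv] at h3
    have h4 : ((u + v) ^ p.natDegree) ^ 2 ≠ 0 := pow_ne_zero _ (pow_ne_zero _ hθ)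
    apply mul_left_cancel₀ h4
    rw [mul_pow 4 ((u + v) ^ 2), pow_right_comm] at h3
    linear_combination -h3
  have hu' : (-u) ^ 2 = y := by rw [neg_sq, hu]
  have hv' : (-v) ^ 2 = y - algebraMap R C z := by rw [neg_sq, hv]
  have k1 := key u v hu hv
  have k2 := key (-u) v hu' hv
  have k3 := key u (-v) hu hv'
  have k4 := key (-u) (-v) hu' hv'
  rw [ha _ _ hu hv, hb _ _ hu hv] at k1
  rw [ha _ _ hu' hv, hb _ _ hu' hv] at k2
  rw [ha _ _ hu hv', hb _ _ hu hv'] at k3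
  rw [ha _ _ hu' hv', hb _ _ hu' hv'] at k4
  have h4 : (4 : C) ≠ 0 := by norm_num
  apply mul_left_cancel₀ h4
  simp only [map_add, map_mul, map_sub, map_pow, map_ofNat, Polynomial.aeval_X, Polynomial.aeval_C]
  rw [← hv, ← hu] at *
  linear_combination k1 + k2 + k3 + k4

theorem p_mem (z : PowerSeries ℝ) (hz : z ≠ 0) (p G1 G2 : Polynomial (PowerSeries ℝ))
    (h : PP z p = G1 ^ 2 + G2 ^ 2) :
    (p : PowerSeries (PowerSeries ℝ)) ∈
      preorderingGen {PowerSeries.X, PowerSeries.X - PowerSeries.C z} := by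
  have hR : CharZero (PowerSeries ℝ) :=
    charZero_of_injective_ringHom (f := PowerSeries.C (R := ℝ)) PowerSeries.C_injective
  let F := FractionRing (Polynomial (PowerSeries ℝ))
  let C := AlgebraicClosure F
  have hPC : Function.Injective (algebraMap (Polynomial (PowerSeries ℝ)) C) := by
    rw [IsScalarTower.algebraMap_eq (Polynomial (PowerSeries ℝ)) F C]
    exact (algebraMap F C).injective.comp (IsFractionRing.injective _ _)
  have hC0 : CharZero C := charZero_of_injective_algebraMap hPC
  let y : C := algebraMap (Polynomial (PowerSeries ℝ)) C Polynomial.X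
  have hae : ∀ q : Polynomial (PowerSeries ℝ), Polynomial.aeval y q =
      algebraMap (Polynomial (PowerSeries ℝ)) C q := by
    intro q
    rw [Polynomial.aeval_algebraMap_apply, Polynomial.aeval_X_left_apply]
  have hinj : Function.Injective (Polynomial.aeval y : Polynomial (PowerSeries ℝ) →ₐ[PowerSeries ℝ] C) := by
    intro a b hab
    rw [hae, hae] at hab
    exact hPC hab
  have hz' : algebraMap (PowerSeries ℝ) C z ≠ 0 := by
    rw [← Polynomial.aeval_C y, hae]
    rw [Ne, map_eq_zero_iff _ hPC]; simpa using hz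
  obtain ⟨u, hu⟩ := IsAlgClosed.exists_pow_nat_eq y (n := 2) (by norm_num)
  obtain ⟨v, hv⟩ := IsAlgClosed.exists_pow_nat_eq (y - algebraMap (PowerSeries ℝ) C z) (n := 2)
    (by norm_num)
  obtain ⟨h1, h2⟩ := coeff_dvd z hz p G1 G2 h
  obtain ⟨a0, a1, a2, a3, b0, b1, b2, b3, hp⟩ := projection y u v z hz' hu hv hinj p G1 G2 h h1 h2
  have hp' := congrArg (Polynomial.coeToPowerSeries.ringHom (R := PowerSeries ℝ)) hp
  simp only [map_add, map_mul, map_sub, map_pow, map_ofNat] at hp'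
  simp only [Polynomial.coeToPowerSeries.ringHom_apply, Polynomial.coe_X, Polynomial.coe_C] at hp'
  set w : PowerSeries (PowerSeries ℝ) := PowerSeries.C (PowerSeries.C (1 / 2 : ℝ)) with hw
  have hw2 : w * 2 = 1 := by
    have : (2 : PowerSeries (PowerSeries ℝ)) = PowerSeries.C (PowerSeries.C (2 : ℝ)) := by
      rw [map_ofNat, map_ofNat]
    rw [hw, this, ← map_mul, ← map_mul]; norm_num
  have e1 : (p : PowerSeries (PowerSeries ℝ)) = (w ^ p.natDegree) ^ 2 * (4 ^ p.natDegree * p) := by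
    have : (w ^ p.natDegree) ^ 2 * (4 ^ p.natDegree * (p : PowerSeries (PowerSeries ℝ))) =
      ((w * 2) ^ p.natDegree) ^ 2 * p := by
      have h4 : (4 : PowerSeries (PowerSeries ℝ)) ^ p.natDegree = (2 ^ p.natDegree) ^ 2 := by
        rw [← pow_mul, mul_comm, pow_mul]; norm_num
      rw [h4]; ring
    rw [this, hw2]; simp
  rw [e1, hp']
  let T := Subsemiring.closure ({PowerSeries.X, PowerSeries.X - PowerSeries.C z} ∪
    {a : PowerSeries (PowerSeries ℝ) | ∃ b, a = b ^ 2})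
  have hsq : ∀ a : PowerSeries (PowerSeries ℝ), a ^ 2 ∈ T := fun a =>
    Subsemiring.subset_closure (Or.inr ⟨a, rfl⟩)
  have hY : PowerSeries.X ∈ T := Subsemiring.subset_closure (Or.inl (by simp))
  have hYz : PowerSeries.X - PowerSeries.C z ∈ T := Subsemiring.subset_closure (Or.inl (by simp))
  have hform : ∀ c0 c1 c2 c3 : PowerSeries (PowerSeries ℝ), (c0 ^ 2 + PowerSeries.X * c1 ^ 2 +
      (PowerSeries.X - PowerSeries.C z) * c2 ^ 2 +
        PowerSeries.X * (PowerSeries.X - PowerSeries.C z) * c3 ^ 2) ∈ T := fun c0 c1 c2 c3 =>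
    T.add_mem (T.add_mem (T.add_mem (hsq _) (T.mul_mem hY (hsq _))) (T.mul_mem hYz (hsq _)))
      (T.mul_mem (T.mul_mem hY hYz) (hsq _))
  exact T.mul_mem (hsq _) (T.add_mem (hform _ _ _ _) (hform _ _ _ _))


/-- The subsemiring `T + aT`. -/
def adjoinSS {F : Type*} [Field F] (T : Subsemiring F) (hT : ∀ b : F, b ^ 2 ∈ T) (a : F) :
    Subsemiring F where
  carrier := {x | ∃ s ∈ T, ∃ t ∈ T, x = s + a * t}
  zero_mem' := ⟨0, T.zero_mem, 0, T.zero_mem, by simp⟩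
  one_mem' := ⟨1, T.one_mem, 0, T.zero_mem, by simp⟩
  add_mem' := by
    rintro _ _ ⟨s, hs, t, ht, rfl⟩ ⟨s', hs', t', ht', rfl⟩
    exact ⟨s + s', T.add_mem hs hs', t + t', T.add_mem ht ht', by ring⟩
  mul_mem' := by
    rintro _ _ ⟨s, hs, t, ht, rfl⟩ ⟨s', hs', t', ht', rfl⟩
    exact ⟨s * s' + a ^ 2 * (t * t'), T.add_mem (T.mul_mem hs hs')
      (T.mul_mem (hT a) (T.mul_mem ht ht')), s * t' + t * s',
      T.add_mem (T.mul_mem hs ht') (T.mul_mem ht hs'), by ring⟩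

theorem le_adjoinSS {F : Type*} [Field F] (T : Subsemiring F) (hT : ∀ b : F, b ^ 2 ∈ T) (a : F) :
    T ≤ adjoinSS T hT a := fun x hx => ⟨x, hx, 0, T.zero_mem, by simp⟩

theorem mem_adjoinSS {F : Type*} [Field F] (T : Subsemiring F) (hT : ∀ b : F, b ^ 2 ∈ T) (a : F) :
    a ∈ adjoinSS T hT a := ⟨0, T.zero_mem, 1, T.one_mem, by simp⟩

/-- If `-1 ∈ T + aT` then `-a ∈ T`, provided `-1 ∉ T`. -/
theorem neg_mem_of_adjoin {F : Type*} [Field F] (T : Subsemiring F) (hT : ∀ b : F, b ^ 2 ∈ T)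
    (a : F) (h1 : -1 ∉ T) (h : -1 ∈ adjoinSS T hT a) : -a ∈ T := by
  obtain ⟨s, hs, t, ht, h⟩ := h
  have ht0 : t ≠ 0 := by
    rintro rfl
    apply h1
    rw [h]; simpa using hs
  have : -a = (1 + s) * t * (t⁻¹) ^ 2 := by
    field_simp
    linear_combination h
  rw [this]
  exact T.mul_mem (T.mul_mem (T.add_mem T.one_mem hs) ht) (hT _)

theorem exists_ordering {F : Type*} [Field F] (h2 : (2 : F) ≠ 0) (T : Subsemiring F) (hT : ∀ b : F, b ^ 2 ∈ T)
    (f : F) (hf : f ∉ T) : ∃ P : Set F, IsOrderingF P ∧ (T : Set F) ⊆ P ∧ f ∉ P := by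
  have h1 : -1 ∉ T := by
    intro h1
    apply hf
    have : f = ((f + 1) * 2⁻¹) ^ 2 + (-1) * ((f - 1) * 2⁻¹) ^ 2 := by
      field_simp; ring
    rw [this]
    exact T.add_mem (hT _) (T.mul_mem h1 (hT _))
  have h1' : -1 ∉ adjoinSS T hT (-f) := by
    intro h
    have := neg_mem_of_adjoin T hT (-f) h1 h
    rw [neg_neg] at this
    exact hf this
  obtain ⟨P, hle, hP⟩ := zorn_le_nonempty₀ {P : Subsemiring F | -1 ∉ P} (by
    intro c hc hchain y hy
    refine ⟨sSup c, ?_, fun z hz => le_sSup hz⟩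
    intro hmem
    rw [Subsemiring.mem_sSup_of_directedOn ⟨y, hy⟩ hchain.directedOn] at hmem
    obtain ⟨s, hs, hs'⟩ := hmem
    exact hc hs hs') (adjoinSS T hT (-f)) h1'
  have hTP : T ≤ P := (le_adjoinSS T hT _).trans hle
  have hsq : ∀ b : F, b ^ 2 ∈ P := fun b => hTP (hT b)
  have hfP : -f ∈ P := hle (mem_adjoinSS T hT _)
  have hP1 : -1 ∉ P := hP.prop
  have anti : ∀ a : F, a ∈ P → -a ∈ P → a = 0 := by
    intro a ha ha'
    by_contra h0
    apply hP1
    have : (-1 : F) = a * -a * (a⁻¹) ^ 2 := by field_simp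
    rw [this]
    exact P.mul_mem (P.mul_mem ha ha') (hsq _)
  refine ⟨P, ⟨fun a ha b hb => P.add_mem ha hb, fun a ha b hb => P.mul_mem ha hb, ?_, anti⟩,
    hTP, ?_⟩
  · intro a
    by_cases ha : a ∈ P
    · exact Or.inl ha
    · right
      apply neg_mem_of_adjoin P hsq a hP1
      by_contra h
      exact ha (hP.le_of_ge h (le_adjoinSS P hsq a) (mem_adjoinSS P hsq a))
  · intro h
    have := anti f h hfP
    apply hf; rw [this]; exact T.zero_mem

theorem exists_denominator {A F : Type*} [CommRing A] [IsDomain A] [Field F] [Algebra A F]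
    [IsFractionRing A F] (S : Set A) (w : F)
    (hw : w ∈ Subsemiring.closure (algebraMap A F '' S ∪ {a | ∃ b, a = b ^ 2})) :
    ∃ D : A, D ≠ 0 ∧ ∃ t ∈ preorderingGen S, (algebraMap A F D) ^ 2 * w = algebraMap A F t := by
  let T := Subsemiring.closure (S ∪ {a : A | ∃ b, a = b ^ 2})
  have hsq : ∀ b : A, b ^ 2 ∈ T := fun b => Subsemiring.subset_closure (Or.inr ⟨b, rfl⟩)
  change ∃ D : A, D ≠ 0 ∧ ∃ t ∈ T, (algebraMap A F D) ^ 2 * w = algebraMap A F t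
  induction hw using Subsemiring.closure_induction with
  | mem x hx =>
    rcases hx with ⟨a, ha, rfl⟩ | ⟨b, rfl⟩
    · exact ⟨1, one_ne_zero, a, Subsemiring.subset_closure (Or.inl ha), by simp⟩
    · obtain ⟨n, d, hd, rfl⟩ := IsFractionRing.div_surjective (A := A) b
      have hd0 := nonZeroDivisors.ne_zero hd
      refine ⟨d, hd0, n ^ 2, hsq n, ?_⟩
      have : algebraMap A F d ≠ 0 := by
        rwa [Ne, map_eq_zero_iff _ (IsFractionRing.injective A F)]
      rw [map_pow]; field_simp
  | zero => exact ⟨1, one_ne_zero, 0, T.zero_mem, by simp⟩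
  | one => exact ⟨1, one_ne_zero, 1, T.one_mem, by simp⟩
  | add x y _ _ hx hy =>
    obtain ⟨D, hD, t, ht, h⟩ := hx
    obtain ⟨D', hD', t', ht', h'⟩ := hy
    refine ⟨D * D', mul_ne_zero hD hD', D' ^ 2 * t + D ^ 2 * t',
      T.add_mem (T.mul_mem (hsq _) ht) (T.mul_mem (hsq _) ht'), ?_⟩
    simp only [map_add, map_mul, map_pow, ← h, ← h']; ring
  | mul x y _ _ hx hy =>
    obtain ⟨D, hD, t, ht, h⟩ := hx
    obtain ⟨D', hD', t', ht', h'⟩ := hy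
    refine ⟨D * D', mul_ne_zero hD hD', t * t', T.mul_mem ht ht', ?_⟩
    simp only [map_mul, ← h, ← h']; ring

theorem step_one (n : ℕ) (f : PS)
    (hf : ∀ P : Set FF, IsOrderingF P → ι psY ∈ P → ι (psY - psX ^ n) ∈ P → ι f ∈ P) :
    ∃ D : PS, D ≠ 0 ∧ D ^ 2 * f ∈ preorderingGen {psY, psY - psX ^ n} := by
  have hmem : ι f ∈ Subsemiring.closure (ι '' {psY, psY - psX ^ n} ∪ {a | ∃ b, a = b ^ 2}) := by
    by_contra hcon
    have h2 : (2 : FF) ≠ 0 := by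
      have h := (IsFractionRing.injective PS FF)
      have h3 : (2 : PS) ≠ 0 := by
        intro h0
        have := congrArg (MvPowerSeries.constantCoeff (σ := Fin 2) (R := ℝ)) h0
        rw [map_zero, show (2 : PS) = MvPowerSeries.C (2 : ℝ) by rw [map_ofNat], MvPowerSeries.constantCoeff_C] at this
        norm_num at this
      intro h0
      apply h3
      apply h
      rw [map_ofNat, map_zero]; exact h0
    obtain ⟨P, hP, hTP, hfP⟩ := exists_ordering h2 _
      (fun b => Subsemiring.subset_closure (Or.inr ⟨b, rfl⟩)) _ hcon
    exact hfP (hf P hP (hTP (Subsemiring.subset_closure (Or.inl ⟨psY, by simp, rfl⟩)))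
      (hTP (Subsemiring.subset_closure (Or.inl ⟨psY - psX ^ n, by simp, rfl⟩))))
  obtain ⟨D, hD, t, ht, h⟩ := exists_denominator _ _ hmem
  refine ⟨D, hD, ?_⟩
  have : D ^ 2 * f = t := by
    apply IsFractionRing.injective PS FF
    rw [map_mul, map_pow]; exact h
  rw [this]; exact ht

theorem preorderingGen_map {A B : Type*} [CommRing A] [CommRing B] (e : A →+* B) (S : Set A) (a : A)
    (ha : a ∈ preorderingGen S) : e a ∈ preorderingGen (e '' S) := by
  have : Subsemiring.closure (S ∪ {a | ∃ b, a = b ^ 2}) ≤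
      (Subsemiring.closure (e '' S ∪ {a | ∃ b, a = b ^ 2})).comap e := by
    rw [Subsemiring.closure_le]
    rintro x (hx | ⟨b, rfl⟩)
    · exact Subsemiring.subset_closure (Or.inl ⟨x, hx, rfl⟩)
    · exact Subsemiring.subset_closure (Or.inr ⟨e b, by simp⟩)
  exact this ha

theorem exists_equiv : ∃ e : PS ≃+* PowerSeries (PowerSeries ℝ),
    e psX = PowerSeries.C PowerSeries.X ∧ e psY = PowerSeries.X := by
  let e0 : Fin 2 ≃ Option Unit := (Equiv.swap 0 1).trans ((_root_.finSuccEquiv 1).trans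
    (Equiv.optionCongr (Equiv.ofUnique (Fin 1) Unit)))
  have h0 : e0 0 = some () := by simp [e0]
  have h1 : e0 1 = none := by simp [e0]
  refine ⟨((MvPowerSeries.renameEquiv ℝ e0).trans
    (MvPowerSeries.optionEquivLeft Unit ℝ)).toRingEquiv, ?_, ?_⟩
  · change MvPowerSeries.optionEquivLeft Unit ℝ (MvPowerSeries.renameEquiv ℝ e0 (MvPowerSeries.X 0)) = _
    have : MvPowerSeries.renameEquiv ℝ e0 (MvPowerSeries.X 0) = MvPowerSeries.X (some ()) := by
      rw [← h0]; simp
    rw [this, MvPowerSeries.optionEquivLeft_X_some]; rfl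
  · change MvPowerSeries.optionEquivLeft Unit ℝ (MvPowerSeries.renameEquiv ℝ e0 (MvPowerSeries.X 1)) = _
    have : MvPowerSeries.renameEquiv ℝ e0 (MvPowerSeries.X 1) = MvPowerSeries.X none := by
      rw [← h1]; simp
    rw [this, MvPowerSeries.optionEquivLeft_X_none]


theorem sqrt_powerSeries {R : Type*} [CommRing R] (h2 : IsUnit (2 : R)) (s : PowerSeries R) (c : R)
    (hc : IsUnit c) (h : PowerSeries.constantCoeff s = c ^ 2) :
    ∃ t : PowerSeries R, s = t ^ 2 := by
  obtain ⟨a, ha, -⟩ := HenselianRing.is_henselian (I := Ideal.span {(PowerSeries.X : PowerSeries R)})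
    (Polynomial.X ^ 2 - Polynomial.C s) (Polynomial.monic_X_pow_sub_C s (by norm_num))
    (PowerSeries.C c) (by
      rw [Ideal.mem_span_singleton, PowerSeries.X_dvd_iff]
      simp [h])
    (by
      apply IsUnit.map
      have : Polynomial.eval (PowerSeries.C c)
          (Polynomial.derivative (Polynomial.X ^ 2 - Polynomial.C s)) = PowerSeries.C (2 * c) := by
        simp only [map_sub, Polynomial.derivative_X_sq, Polynomial.derivative_C, sub_zero,
          Polynomial.eval_mul, Polynomial.eval_ofNat, Polynomial.eval_X, map_mul, map_ofNat]
      rw [this]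
      exact (h2.mul hc).map _)
  refine ⟨a, ?_⟩
  have : a ^ 2 - s = 0 := by simpa [Polynomial.IsRoot] using ha
  linear_combination -this

theorem unit_sqrt (u : PowerSeries (PowerSeries ℝ))
    (h : 0 < PowerSeries.constantCoeff (PowerSeries.constantCoeff u)) :
    ∃ t : PowerSeries (PowerSeries ℝ), u = t ^ 2 := by
  obtain ⟨c, hc⟩ := sqrt_powerSeries (R := ℝ) (IsUnit.mk0 _ (by norm_num))
    (PowerSeries.constantCoeff u) (Real.sqrt (PowerSeries.constantCoeff (PowerSeries.constantCoeff u)))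
    (IsUnit.mk0 _ (Real.sqrt_pos.2 h).ne') (Real.sq_sqrt h.le).symm
  have h2 : IsUnit (2 : PowerSeries ℝ) := by
    have : (2 : PowerSeries ℝ) = PowerSeries.C 2 := by rw [map_ofNat]
    rw [this]
    exact (IsUnit.mk0 (2 : ℝ) (by norm_num)).map _
  refine sqrt_powerSeries h2 u c ?_ hc
  rw [PowerSeries.isUnit_iff_constantCoeff]
  apply IsUnit.mk0
  intro h0
  rw [hc, map_pow, h0] at h
  norm_num at h

/-- Reduction modulo `x`. -/
def redX : PowerSeries (PowerSeries ℝ) →+* PowerSeries ℝ :=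
  PowerSeries.map (PowerSeries.constantCoeff (R := ℝ))

theorem redX_CX : redX (PowerSeries.C PowerSeries.X) = 0 := by
  simp [redX]

theorem dvd_of_redX (h : PowerSeries (PowerSeries ℝ)) (h0 : redX h = 0) :
    ∃ r, h = PowerSeries.C PowerSeries.X * r := by
  have : ∀ i, ∃ r, PowerSeries.coeff i h = PowerSeries.X * r := by
    intro i
    have := congrArg (PowerSeries.coeff i) h0
    rw [redX, PowerSeries.coeff_map, map_zero] at this
    exact PowerSeries.X_dvd_iff.2 this
  choose r hr using this
  refine ⟨PowerSeries.mk r, ?_⟩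
  ext1 i
  rw [PowerSeries.coeff_C_mul, PowerSeries.coeff_mk, hr]

theorem content (b : PowerSeries (PowerSeries ℝ)) (hb : b ≠ 0) :
    ∃ k h, b = PowerSeries.C PowerSeries.X ^ k * h ∧ redX h ≠ 0 := by
  by_contra! hcon
  have key : ∀ k, ∃ h, b = PowerSeries.C PowerSeries.X ^ k * h := by
    intro k
    induction k with
    | zero => exact ⟨b, by simp⟩
    | succ k ih =>
      obtain ⟨h, hh⟩ := ih
      obtain ⟨r, hr⟩ := dvd_of_redX h (hcon k h hh)
      exact ⟨r, by rw [hh, hr]; ring⟩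
  apply hb
  ext i m
  obtain ⟨h, hh⟩ := key (m + 1)
  have : PowerSeries.X ^ (m + 1) ∣ PowerSeries.coeff i b := by
    rw [hh, ← map_pow, PowerSeries.coeff_C_mul]; exact Dvd.intro _ rfl
  rw [PowerSeries.X_pow_dvd_iff.1 this m (by omega)]; simp

/-- Series over `ℝ` with positive leading coefficient. -/
def LP (s : PowerSeries ℝ) : Prop :=
  ∃ j w, s = PowerSeries.X ^ j * w ∧ 0 < PowerSeries.constantCoeff w

theorem LP.mul {s t : PowerSeries ℝ} (hs : LP s) (ht : LP t) : LP (s * t) := by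
  obtain ⟨j, w, rfl, hw⟩ := hs
  obtain ⟨i, v, rfl, hv⟩ := ht
  exact ⟨j + i, w * v, by ring, by rw [map_mul]; exact mul_pos hw hv⟩

theorem LP.add {s t : PowerSeries ℝ} (hs : LP s) (ht : LP t) : LP (s + t) := by
  obtain ⟨j, w, rfl, hw⟩ := hs
  obtain ⟨i, v, rfl, hv⟩ := ht
  wlog hij : j ≤ i generalizing i j w v
  · rw [add_comm]; exact this i v hv j w hw (by omega)
  obtain ⟨a, rfl⟩ := Nat.exists_eq_add_of_le hij
  refine ⟨j, w + PowerSeries.X ^ a * v, by ring, ?_⟩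
  rcases Nat.eq_zero_or_pos a with rfl | ha
  · simpa using add_pos hw hv
  · simpa [ha.ne'] using hw

theorem LP.ne_zero {s : PowerSeries ℝ} (hs : LP s) : s ≠ 0 := by
  obtain ⟨j, w, rfl, hw⟩ := hs
  apply mul_ne_zero (pow_ne_zero _ PowerSeries.X_ne_zero)
  rintro rfl
  simp at hw

theorem LP_sq (s : PowerSeries ℝ) (hs : s ≠ 0) : LP (s ^ 2) := by
  obtain ⟨w, hw⟩ := PowerSeries.X_pow_order_dvd (φ := s)
  refine ⟨s.order.toNat * 2, w ^ 2, by nth_rewrite 1 [hw]; ring, ?_⟩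
  rw [map_pow]
  apply sq_pos_of_ne_zero
  intro h0
  obtain ⟨v, hv⟩ := PowerSeries.X_dvd_iff.2 h0
  have hd : PowerSeries.X ^ (s.order.toNat + 1) ∣ s := ⟨v, by nth_rewrite 1 [hw]; rw [hv]; ring⟩
  have h1 := PowerSeries.X_pow_dvd_iff.1 hd s.order.toNat (by omega)
  exact PowerSeries.coeff_order hs h1

/-- The positivity predicate on `ℝ[[x]][[y]]`. -/
def PosS : Subsemiring (PowerSeries (PowerSeries ℝ)) where
  carrier := {g | g = 0 ∨ ∃ k h, g = PowerSeries.C PowerSeries.X ^ (2 * k) * h ∧ LP (redX h)}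
  zero_mem' := Or.inl rfl
  one_mem' := Or.inr ⟨0, 1, by simp, 0, 1, by simp, by simp⟩
  add_mem' := by
    rintro _ _ (rfl | ⟨k, h, rfl, hh⟩) (rfl | ⟨k', h', rfl, hh'⟩)
    · left; simp
    · right; exact ⟨k', h', by simp, hh'⟩
    · right; exact ⟨k, h, by simp, hh⟩
    · right
      wlog hij : k ≤ k' generalizing k h k' h'
      · rw [add_comm]; exact this k' h' hh' k h hh (by omega)
      obtain ⟨a, rfl⟩ := Nat.exists_eq_add_of_le hij
      refine ⟨k, h + PowerSeries.C PowerSeries.X ^ (2 * a) * h', by ring, ?_⟩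
      rcases Nat.eq_zero_or_pos a with rfl | ha
      · simpa using hh.add hh'
      · rw [map_add, map_mul, map_pow, redX_CX, zero_pow (by omega)]
        simpa using hh
  mul_mem' := by
    rintro _ _ (rfl | ⟨k, h, rfl, hh⟩) (rfl | ⟨k', h', rfl, hh'⟩)
    · left; simp
    · left; simp
    · left; simp
    · right
      exact ⟨k + k', h * h', by ring, by rw [map_mul]; exact hh.mul hh'⟩

theorem gen_le_PosS (n : ℕ) (hn : n ≠ 0) (g : PowerSeries (PowerSeries ℝ))
    (hg : g ∈ preorderingGen {PowerSeries.X, PowerSeries.X - PowerSeries.C (PowerSeries.X ^ n)}) :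
    g ∈ PosS := by
  have : Subsemiring.closure ({PowerSeries.X, PowerSeries.X - PowerSeries.C (PowerSeries.X ^ n)} ∪
      {a | ∃ b, a = b ^ 2}) ≤ PosS := by
    rw [Subsemiring.closure_le]
    rintro x ((rfl | rfl) | ⟨b, rfl⟩)
    · exact Or.inr ⟨0, PowerSeries.X, by simp, 1, 1, by simp [redX], by simp⟩
    · refine Or.inr ⟨0, PowerSeries.X - PowerSeries.C (PowerSeries.X ^ n), by simp, 1, 1, ?_, by simp⟩
      rw [map_pow, map_sub, map_pow, redX_CX, zero_pow hn]
      simp [redX]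
    · by_cases hb : b = 0
      · left; simp [hb]
      · obtain ⟨k, h, rfl, hh⟩ := content b hb
        exact Or.inr ⟨k, h ^ 2, by ring, by rw [map_pow]; exact LP_sq _ hh⟩
  exact this hg

theorem wFactorization (b : PowerSeries (PowerSeries ℝ)) (hb : b ≠ 0) :
    ∃ (k : ℕ) (p : Polynomial (PowerSeries ℝ)) (u : PowerSeries (PowerSeries ℝ)),
      p.IsDistinguishedAt (IsLocalRing.maximalIdeal (PowerSeries ℝ)) ∧ IsUnit u ∧
      b = PowerSeries.C PowerSeries.X ^ k * ((p : PowerSeries (PowerSeries ℝ)) * u) := by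
  obtain ⟨k, h, rfl, hh⟩ := content b hb
  obtain ⟨p, u, H⟩ := PowerSeries.exists_isWeierstrassFactorization (g := h) (by
    intro h0
    apply hh
    ext i
    have := congrArg (PowerSeries.coeff i) h0
    rw [PowerSeries.coeff_map, map_zero, IsLocalRing.residue_eq_zero_iff,
      PowerSeries.maximalIdeal_eq_span_X, Ideal.mem_span_singleton, PowerSeries.X_dvd_iff] at this
    rw [redX, PowerSeries.coeff_map, this, map_zero])
  exact ⟨k, p, u, H.isDistinguishedAt, H.isUnit, by rw [← H.eq_mul]⟩

theorem redX_distinguished (p : Polynomial (PowerSeries ℝ))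
    (hp : p.IsDistinguishedAt (IsLocalRing.maximalIdeal (PowerSeries ℝ))) :
    redX (p : PowerSeries (PowerSeries ℝ)) = PowerSeries.X ^ p.natDegree := by
  ext i
  rw [redX, PowerSeries.coeff_map, Polynomial.coeff_coe, PowerSeries.coeff_X_pow]
  rcases lt_trichotomy i p.natDegree with h | h | h
  · rw [if_neg h.ne]
    have := hp.mem h
    rwa [PowerSeries.maximalIdeal_eq_span_X, Ideal.mem_span_singleton, PowerSeries.X_dvd_iff] at this
  · rw [if_pos h, h, hp.monic.coeff_natDegree, map_one]
  · rw [if_neg h.ne', Polynomial.coeff_eq_zero_of_natDegree_lt h, map_zero]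

theorem cancel_CX (i j : ℕ) (a b : PowerSeries (PowerSeries ℝ)) (ha : redX a ≠ 0) (hb : redX b ≠ 0)
    (h : PowerSeries.C PowerSeries.X ^ i * a = PowerSeries.C PowerSeries.X ^ j * b) :
    i = j ∧ a = b := by
  have hX : (PowerSeries.C PowerSeries.X : PowerSeries (PowerSeries ℝ)) ≠ 0 := by
    rw [Ne, map_eq_zero_iff _ PowerSeries.C_injective]; exact PowerSeries.X_ne_zero
  wlog hij : i ≤ j generalizing i j a b
  · obtain ⟨h1, h2⟩ := this j i b a hb ha h.symm (by omega)
    exact ⟨h1.symm, h2.symm⟩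
  obtain ⟨c, rfl⟩ := Nat.exists_eq_add_of_le hij
  rw [pow_add, mul_assoc] at h
  have h' := mul_left_cancel₀ (pow_ne_zero _ hX) h
  rcases Nat.eq_zero_or_pos c with rfl | hc
  · simpa using h'
  · exfalso
    apply ha
    rw [h', map_mul, map_pow, redX_CX, zero_pow hc.ne', zero_mul]

theorem main_A (n : ℕ) (hn : n ≠ 0) (f D : PowerSeries (PowerSeries ℝ)) (hD : D ≠ 0)
    (h : D ^ 2 * f ∈
      preorderingGen {PowerSeries.X, PowerSeries.X - PowerSeries.C (PowerSeries.X ^ n)}) :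
    f ∈ preorderingGen {PowerSeries.X, PowerSeries.X - PowerSeries.C (PowerSeries.X ^ n)} := by
  by_cases hf : f = 0
  · rw [hf]; exact Subsemiring.zero_mem _
  obtain ⟨k, p, u, hp, hu, hfe⟩ := wFactorization f hf
  obtain ⟨l, d, v, hd, hv, hDe⟩ := wFactorization D hD
  have hunit : ∀ u : PowerSeries (PowerSeries ℝ), IsUnit u →
      PowerSeries.constantCoeff (PowerSeries.constantCoeff u) ≠ 0 := by
    intro u hu
    exact ((hu.map PowerSeries.constantCoeff).map PowerSeries.constantCoeff).ne_zero
  have hru : ∀ u : PowerSeries (PowerSeries ℝ), PowerSeries.constantCoeff (redX u) =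
      PowerSeries.constantCoeff (PowerSeries.constantCoeff u) := by
    intro u
    rw [redX, ← PowerSeries.coeff_zero_eq_constantCoeff_apply, PowerSeries.coeff_map,
      PowerSeries.coeff_zero_eq_constantCoeff_apply]
  have hr0 : ∀ u : PowerSeries (PowerSeries ℝ), IsUnit u → redX u ≠ 0 := fun u hu =>
    (hu.map redX).ne_zero
  have hp0 := redX_distinguished p hp
  have hd0 := redX_distinguished d hd
  -- parity and positivity
  have hpar : (∃ j, k = 2 * j) ∧ 0 < PowerSeries.constantCoeff (PowerSeries.constantCoeff u) := by
    have e : D ^ 2 * f = PowerSeries.C PowerSeries.X ^ (2 * l + k) *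
        (((d : PowerSeries (PowerSeries ℝ)) * v) ^ 2 * ((p : PowerSeries (PowerSeries ℝ)) * u)) := by
      rw [hfe, hDe]; ring
    have hdv : redX ((d : PowerSeries (PowerSeries ℝ)) * v) ≠ 0 := by
      rw [map_mul, hd0]
      exact mul_ne_zero (pow_ne_zero _ PowerSeries.X_ne_zero) (hr0 v hv)
    have hne : redX (((d : PowerSeries (PowerSeries ℝ)) * v) ^ 2 *
        ((p : PowerSeries (PowerSeries ℝ)) * u)) ≠ 0 := by
      rw [map_mul, map_pow, map_mul redX _ u, hp0]
      exact mul_ne_zero (pow_ne_zero _ hdv)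
        (mul_ne_zero (pow_ne_zero _ PowerSeries.X_ne_zero) (hr0 u hu))
    rcases gen_le_PosS n hn _ h with h0 | ⟨j, g, hg, hLP⟩
    · exact absurd h0 (mul_ne_zero (pow_ne_zero _ hD) hf)
    · rw [e] at hg
      obtain ⟨h1, h2⟩ := cancel_CX _ _ _ _ hne hLP.ne_zero hg
      refine ⟨⟨j - l, by omega⟩, ?_⟩
      by_contra hneg
      have hlt : PowerSeries.constantCoeff (PowerSeries.constantCoeff u) < 0 :=
        lt_of_le_of_ne (not_lt.1 hneg) (hunit u hu)
      rw [← h2, map_mul, map_pow, map_mul redX _ u, hp0] at hLP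
      have hm : LP (redX ((d : PowerSeries (PowerSeries ℝ)) * v) ^ 2 *
          (PowerSeries.X ^ p.natDegree * -redX u)) :=
        (LP_sq _ hdv).mul ⟨p.natDegree, -redX u, rfl, by rw [map_neg, hru]; linarith⟩
      apply (hLP.add hm).ne_zero
      ring
  obtain ⟨⟨j, rfl⟩, hpos⟩ := hpar
  obtain ⟨t, rfl⟩ := unit_sqrt u hpos
  have ht : IsUnit t := (isUnit_pow_iff (by norm_num)).1 hu
  have hfe' : f = (PowerSeries.C PowerSeries.X ^ j * t) ^ 2 * (p : PowerSeries (PowerSeries ℝ)) := by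
    rw [hfe]; ring
  have hT : (PowerSeries.C (PowerSeries.X ^ (l + j)) * (d : PowerSeries (PowerSeries ℝ)) *
      (v * t)) ^ 2 * (p : PowerSeries (PowerSeries ℝ)) ∈
      preorderingGen {PowerSeries.X, PowerSeries.X - PowerSeries.C (PowerSeries.X ^ n)} := by
    convert h using 1
    rw [hfe', hDe, map_pow]; ring
  have hXn : (PowerSeries.X ^ n : PowerSeries ℝ) ≠ 0 := pow_ne_zero _ PowerSeries.X_ne_zero
  obtain ⟨H1, H2, hH⟩ := P_two_sq (K := FractionRing (PowerSeries ℝ)) (PowerSeries.X ^ n)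
    (PowerSeries.X ^ (l + j)) hXn (pow_ne_zero _ PowerSeries.X_ne_zero) p d hp hd.monic (v * t)
    (hv.mul ht) hT
  obtain ⟨G1, G2, hG⟩ := integral_two_sq _ H1 H2 hH
  have hpm := p_mem _ hXn p G1 G2 hG
  rw [hfe']
  exact Subsemiring.mul_mem _ (Subsemiring.subset_closure (Or.inr ⟨_, rfl⟩)) hpm

/-- Let `n` be odd, `n ≥ 3`. The preordering of `ℝ[[x,y]]` generated
by `y` and `y − x^n` is saturated: every `f ∈ ℝ[[x,y]]` nonnegative at every ordering of
`ℝ((x,y))` at which `y ≥ 0` and `y − x^n ≥ 0` belongs to this preordering. -/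
theorem preordering_y_sub_xn_saturated (n : ℕ) (hodd : Odd n) (hn : 3 ≤ n) (f : PS)
    (hf : ∀ P : Set FF, IsOrderingF P → ι psY ∈ P → ι (psY - psX ^ n) ∈ P → ι f ∈ P) :
    f ∈ preorderingGen {psY, psY - psX ^ n} := by
  obtain ⟨D, hD, hDf⟩ := step_one n f hf
  obtain ⟨e, hx, hy⟩ := exists_equiv
  have himg : e '' {psY, psY - psX ^ n} =
      {PowerSeries.X, PowerSeries.X - PowerSeries.C (PowerSeries.X ^ n)} := by
    rw [Set.image_pair, map_sub, map_pow, hx, hy, map_pow]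
  have h1 := preorderingGen_map (e : PS →+* PowerSeries (PowerSeries ℝ)) _ _ hDf
  rw [RingEquiv.coe_toRingHom, himg, map_mul, map_pow e] at h1
  have h2 := main_A n (by omega) (e f) (e D) (by simpa using hD) h1
  have h3 := preorderingGen_map (e.symm : PowerSeries (PowerSeries ℝ) →+* PS) _ _ h2
  rw [← himg, RingEquiv.coe_toRingHom, e.symm_apply_apply] at h3
  convert h3 using 2
  rw [Set.image_image]
  simp
end
end

section
/- Let n be an odd integer with n ≥ 3. Then the preordering of ℝ[[x,y]] generated by y² − x^n is saturated: every f ∈ ℝ[[x,y]] that is nonnegative at every ordering of the field ℝ((x,y)) at which y² − x^n ≥ 0 belongs to the preordering of ℝ[[x,y]] generated by y² − x^n. -/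
noncomputable section

open MvPowerSeries MvPolynomial

/-- A commutative ring is real if a vanishing sum of squares has vanishing entries. -/
def RealQ (S : Type*) [CommRing S] : Prop := ∀ a s : S, IsSumSq s → a * a + s = 0 → a = 0

theorem RealQ.left {S : Type*} [CommRing S] (h : RealQ S) {s : S} (hs : IsSumSq s) :
    ∀ t : S, IsSumSq t → s + t = 0 → s = 0 := by
  induction hs using IsSumSq.rec' with
  | zero => intro t _ _; rfl
  | sq_add hx hs ih =>
    intro t ht h0
    obtain ⟨a, rfl⟩ := hx
    rw [add_assoc] at h0
    have ha := h a _ (hs.add ht) h0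
    subst ha
    simp only [mul_zero, zero_add] at h0 ⊢
    exact ih t ht h0

theorem RealQ.family {S : Type*} [CommRing S] (h : RealQ S) {J : Type*} [Fintype J] (a : J → S)
    (h0 : ∑ i, a i ^ 2 = 0) (i : J) : a i = 0 := by
  classical
  rw [← Finset.add_sum_erase _ _ (Finset.mem_univ i)] at h0
  exact h (a i) _ (IsSumSq.sum_sq _ _) (by rw [← h0, sq])

theorem IsSumSq.exists_fin {S : Type*} [CommRing S] {s : S} (hs : IsSumSq s) :
    ∃ (m : ℕ) (a : Fin m → S), s = ∑ i, a i ^ 2 := by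
  induction hs using IsSumSq.rec' with
  | zero => exact ⟨0, fun _ => 0, by simp⟩
  | sq_add hx hs ih =>
    obtain ⟨a, rfl⟩ := hx
    obtain ⟨m, b, rfl⟩ := ih
    exact ⟨m + 1, Fin.cons a b, by simp [Fin.sum_univ_succ, sq]⟩

theorem RealQ.of_family {S : Type*} [CommRing S]
    (h : ∀ (m : ℕ) (a : Fin m → S), ∑ i, a i ^ 2 = 0 → ∀ i, a i = 0) : RealQ S := by
  intro a s hs h0
  obtain ⟨m, b, rfl⟩ := hs.exists_fin
  have := h (m + 1) (Fin.cons a b) (by simpa [Fin.sum_univ_succ, sq] using h0) 0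
  simpa using this

theorem IsSumSq.mapHom {S S' : Type*} [CommRing S] [CommRing S'] (φ : S →+* S') {s : S}
    (hs : IsSumSq s) : IsSumSq (φ s) := by
  obtain ⟨m, b, rfl⟩ := hs.exists_fin
  rw [map_sum]
  simp only [map_pow]
  exact IsSumSq.sum_sq _ _

theorem IsSumSq.sq_mul {S : Type*} [CommRing S] (a : S) {s : S}
    (hs : IsSumSq s) : IsSumSq (a ^ 2 * s) := by
  rw [sq]; exact (IsSumSq.mul_self a).mul hs

theorem realQ_real : RealQ ℝ := by
  intro a s hs h0
  have := hs.nonneg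
  nlinarith [mul_self_nonneg a]

theorem RealQ.of_injective {S S' : Type*} [CommRing S] [CommRing S'] (φ : S →+* S')
    (hφ : Function.Injective φ) (h : RealQ S') : RealQ S := by
  intro a s hs h0
  apply hφ
  rw [map_zero]
  exact h (φ a) (φ s) (hs.mapHom φ) (by rw [← map_mul, ← map_add, h0, map_zero])

theorem natDegree_le_of_sumsq {S : Type*} [CommRing S] (h : RealQ S) {J : Type*} [Fintype J]
    (a : J → Polynomial S) (d : ℕ) (hd : (∑ i, a i ^ 2).natDegree ≤ 2 * d) (i : J) :
    (a i).natDegree ≤ d := by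
  have key : ∀ N, (∀ i, (a i).natDegree ≤ d + N) → ∀ i, (a i).natDegree ≤ d := by
    intro N
    induction N with
    | zero => intro h; simpa using h
    | succ N ih =>
      intro hN
      apply ih
      have hc : ∑ i, (a i).coeff (d + (N + 1)) ^ 2 = 0 := by
        have : (∑ i, a i ^ 2).coeff (2 * (d + (N + 1))) = 0 :=
          Polynomial.coeff_eq_zero_of_natDegree_lt (by omega)
        rw [Polynomial.finsetSum_coeff] at this
        rw [← this]
        refine Finset.sum_congr rfl fun i _ => ?_
        rw [Polynomial.coeff_pow_of_natDegree_le (hN i)]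
      intro i
      have := h.family _ hc i
      by_contra hlt
      have he : (a i).natDegree = d + (N + 1) := by have := hN i; omega
      rw [← he, Polynomial.coeff_natDegree, Polynomial.leadingCoeff_eq_zero] at this
      rw [this] at he
      simp at he
  apply key (∑ i, (a i).natDegree)
  intro i
  have := Finset.single_le_sum (f := fun i => (a i).natDegree) (fun _ _ => Nat.zero_le _) (Finset.mem_univ i)
  omega

theorem RealQ.polynomial {S : Type*} [CommRing S] (h : RealQ S) : RealQ (Polynomial S) := by
  apply RealQ.of_family
  intro m a h0 i
  have hd : ∀ i, (a i).natDegree ≤ 0 := fun i =>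
    natDegree_le_of_sumsq h a 0 (by rw [h0]; simp) i
  have hc : ∑ i, (a i).coeff 0 ^ 2 = 0 := by
    have := congrArg (fun p => Polynomial.coeff p 0) h0
    simpa [Polynomial.finsetSum_coeff, sq, Polynomial.mul_coeff_zero] using this
  rw [Polynomial.eq_C_of_natDegree_le_zero (hd i), h.family _ hc i, Polynomial.C_0]

theorem dvd_of_sumsq {R S : Type*} [CommRing R] [IsDomain R] [CommRing S] (φ : R →+* S)
    (h : RealQ S) (p : R) (hp : p ≠ 0) (hker : ∀ r, φ r = 0 ↔ p ∣ r) (k : ℕ) :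
    ∀ {J : Type*} [Fintype J] (a : J → R) (G : R) (_ : ∑ i, a i ^ 2 = p ^ (2 * k) * G) (i : J),
    p ^ k ∣ a i := by
  induction k with
  | zero => intro J _ a G _ i; simp
  | succ k ih =>
    intro J _ a G h0 i
    have h1 : ∀ i, p ∣ a i := by
      intro i
      rw [← hker]
      have : ∑ i, (φ (a i)) ^ 2 = 0 := by
        have := congrArg φ h0
        rw [map_sum] at this
        simp only [map_pow, map_mul] at this
        rw [this, (hker p).2 dvd_rfl]
        simp
      exact h.family _ this i
    choose b hb using h1
    have h2 : ∑ i, b i ^ 2 = p ^ (2 * k) * G := by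
      have hp2 : p ^ 2 ≠ 0 := pow_ne_zero _ hp
      apply mul_left_cancel₀ hp2
      rw [Finset.mul_sum]
      calc _ = ∑ i, a i ^ 2 := Finset.sum_congr rfl fun i _ => by rw [hb i]; ring
        _ = _ := by rw [h0]; ring
    rw [hb i, pow_succ']
    exact mul_dvd_mul_left _ (ih b G h2 i)

theorem isSumSq_div {R S : Type*} [CommRing R] [CommRing S] (φ : R →+* S)
    (h : RealQ S) (p : R) (hker : ∀ r, φ r = 0 → p ∣ r) {s : R} (hs : IsSumSq s) :
    φ s = 0 → ∃ s', IsSumSq s' ∧ s = p ^ 2 * s' := by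
  induction hs using IsSumSq.rec' with
  | zero => intro _; exact ⟨0, IsSumSq.zero, by simp⟩
  | sq_add hx hs ih =>
    intro h0
    obtain ⟨a, rfl⟩ := hx
    rw [map_add, map_mul] at h0
    have ha := h _ _ (hs.mapHom φ) h0
    rw [ha] at h0
    obtain ⟨s', hs', rfl⟩ := ih (by simpa using h0)
    obtain ⟨b, rfl⟩ := hker a ha
    exact ⟨b * b + s', (IsSumSq.mul_self b).add hs', by ring⟩

theorem RealQ.powerSeries : RealQ (PowerSeries ℝ) := by
  apply RealQ.of_family
  intro m a h0 i
  have hd : ∀ k, PowerSeries.X ^ k ∣ a i := fun k =>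
    dvd_of_sumsq (PowerSeries.constantCoeff (R := ℝ)) realQ_real PowerSeries.X
      PowerSeries.X_ne_zero (fun r => PowerSeries.X_dvd_iff.symm) k a 0 (by rw [h0]; simp) i
  ext k
  have := PowerSeries.X_pow_dvd_iff.1 (hd (k + 1)) k (by omega)
  simpa using this

theorem RealQ.fraction {R K : Type*} [CommRing R] [IsDomain R] [Field K] [Algebra R K]
    [IsFractionRing R K] (h : RealQ R) : RealQ K := by
  apply RealQ.of_family
  intro m a h0 i
  obtain ⟨b, hb⟩ := IsLocalization.exist_integer_multiples_of_finite (nonZeroDivisors R) a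
  choose c hc using hb
  have hb0 : algebraMap R K b ≠ 0 :=
    IsFractionRing.to_map_ne_zero_of_mem_nonZeroDivisors b.2
  have hc' : ∀ i, algebraMap R K (c i) = algebraMap R K b * a i := fun i => by
    rw [hc i, Algebra.smul_def]
  have : ∑ i, c i ^ 2 = 0 := by
    apply IsFractionRing.injective R K
    rw [map_sum, map_zero]
    simp only [map_pow, hc', mul_pow]
    rw [← Finset.mul_sum, h0, mul_zero]
  have := h.family _ this i
  have h1 := hc' i
  rw [this, map_zero] at h1
  exact (mul_eq_zero.1 h1.symm).resolve_left hb0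


/-- Cassels' theorem for sums of squares. -/
theorem cassels {K : Type*} [Field K] (hK : RealQ K) {m : ℕ} (G : Polynomial K) :
    ∀ (N : ℕ) (h : Polynomial K) (_ : h.natDegree ≤ N) (_ : h ≠ 0) (a : Fin m → Polynomial K)
      (_ : h ^ 2 * G = ∑ i, a i ^ 2), IsSumSq G := by
  intro N
  induction N using Nat.strong_induction_on with
  | _ N ih =>
    intro h hN h0 a hG
    set b : Fin m → Polynomial K := fun i => a i / h with hb
    set r : Fin m → Polynomial K := fun i => a i % h with hr
    have hab : ∀ i, a i = h * b i + r i := fun i => (EuclideanDomain.div_add_mod (a i) h).symm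
    by_cases hr0 : ∑ i, r i ^ 2 = 0
    · have hri := hK.polynomial.family r hr0
      have : G = ∑ i, b i ^ 2 := by
        apply mul_left_cancel₀ (pow_ne_zero 2 h0)
        rw [hG, Finset.mul_sum]
        exact Finset.sum_congr rfl fun i _ => by rw [hab i, hri i]; ring
      rw [this]; exact IsSumSq.sum_sq _ _
    · set B := ∑ i, b i ^ 2 with hB
      set Cc := ∑ i, a i * b i with hC
      have hrr : ∑ i, r i ^ 2 = h * (h * G - 2 * Cc + h * B) := by
        have e1 : ∑ i, r i ^ 2 = ∑ i, a i ^ 2 - 2 * h * Cc + h ^ 2 * B := by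
          rw [hC, hB, Finset.mul_sum, Finset.mul_sum, ← Finset.sum_sub_distrib,
            ← Finset.sum_add_distrib]
          refine Finset.sum_congr rfl fun i _ => ?_
          have : r i = a i - h * b i := by rw [hab i]; ring
          rw [this]; ring
        rw [e1, ← hG]; ring
      set M := B - G with hM
      set Nn := 2 * (h * G - Cc) with hNn
      have hh' : h * G - 2 * Cc + h * B = M * h + Nn := by rw [hM, hNn]; ring
      rw [hh'] at hrr
      have hne : M * h + Nn ≠ 0 := by
        intro e; rw [e, mul_zero] at hrr; exact hr0 hrr
      have hpos : 0 < h.natDegree := by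
        by_contra hz
        apply hr0
        have hu : IsUnit h := by
          rw [Polynomial.isUnit_iff_degree_eq_zero, Polynomial.degree_eq_natDegree h0]
          have : h.natDegree = 0 := by omega
          rw [this]; rfl
        refine Finset.sum_eq_zero fun i _ => ?_
        have : r i = 0 := by
          simp only [hr]
          exact EuclideanDomain.mod_eq_zero.2 hu.dvd
        rw [this]; simp
      have hlt : (M * h + Nn).natDegree < h.natDegree := by
        have d1 : (∑ i, r i ^ 2).natDegree ≤ 2 * (h.natDegree - 1) := by
          refine Polynomial.natDegree_sum_le_of_forall_le _ _ fun i _ => ?_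
          refine (Polynomial.natDegree_pow_le).trans ?_
          have : (r i).natDegree < h.natDegree := by
            simp only [hr]
            exact Polynomial.natDegree_mod_lt _ (by omega)
          have : (r i).natDegree ≤ h.natDegree - 1 := by omega
          exact Nat.mul_le_mul_left 2 this
        rw [hrr, Polynomial.natDegree_mul h0 hne] at d1
        omega
      refine ih (M * h + Nn).natDegree (by omega) (M * h + Nn) le_rfl hne
        (fun i => M * a i + Nn * b i) ?_
      have e2 : ∑ i, (M * a i + Nn * b i) ^ 2 = M ^ 2 * ∑ i, a i ^ 2 + 2 * M * Nn * Cc + Nn ^ 2 * B := by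
        rw [hC, hB, Finset.mul_sum, Finset.mul_sum, Finset.mul_sum, ← Finset.sum_add_distrib,
            ← Finset.sum_add_distrib]
        exact Finset.sum_congr rfl fun i _ => by ring
      rw [e2, ← hG, hM, hNn]; ring

theorem cassels' {K : Type*} [Field K] (hK : RealQ K) (G h : Polynomial K) (h0 : h ≠ 0)
    (hs : IsSumSq (h ^ 2 * G)) : IsSumSq G := by
  obtain ⟨m, a, ha⟩ := hs.exists_fin
  exact cassels hK G _ h le_rfl h0 a ha

/-- A monic divisor of `j ^ 2 + 1` is a sum of squares. -/
theorem isSumSq_of_dvd_sq_add_one {K : Type*} [Field K] (hK : RealQ K) :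
    ∀ (N : ℕ) (p : Polynomial K) (_ : p.natDegree ≤ N) (_ : p.Monic) (j : Polynomial K)
      (_ : p ∣ j ^ 2 + 1), IsSumSq p := by
  intro N
  induction N using Nat.strong_induction_on with
  | _ N ih =>
    intro p hN hp j hj
    by_cases hd : p.natDegree = 0
    · rw [hp.natDegree_eq_zero.1 hd]; exact IsSumSq.one
    set j' := j %ₘ p with hj'
    have hp1 : p ≠ 1 := by rintro rfl; simp at hd
    have hlt : j'.natDegree < p.natDegree := Polynomial.natDegree_modByMonic_lt _ hp hp1
    have hdvd : p ∣ j' ^ 2 + 1 := by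
      have e : j' = j - p * (j /ₘ p) := by
        rw [eq_sub_iff_add_eq]; exact Polynomial.modByMonic_add_div j p
      rw [e]
      have : (j - p * (j /ₘ p)) ^ 2 + 1 = (j ^ 2 + 1) + p * ((j /ₘ p) * (p * (j /ₘ p) - 2 * j)) := by
        ring
      rw [this]
      exact dvd_add hj (dvd_mul_right _ _)
    obtain ⟨p', hp'⟩ := hdvd
    have hpr := hK.polynomial
    have hne : j' ^ 2 + 1 ≠ 0 := by
      intro e
      have := hpr 1 (j' ^ 2) (by rw [sq]; exact IsSumSq.mul_self _) (by rw [← e]; ring)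
      exact one_ne_zero this
    have hp'0 : p' ≠ 0 := by rintro rfl; rw [mul_zero] at hp'; exact hne hp'
    have hp0 : p ≠ 0 := hp.ne_zero
    have hdeg : (j' ^ 2 + 1).natDegree = p.natDegree + p'.natDegree := by
      rw [hp', Polynomial.natDegree_mul hp0 hp'0]
    have hjd : 0 < j'.natDegree := by
      by_contra hz
      have : (j' ^ 2 + 1).natDegree ≤ 0 := by
        refine Polynomial.natDegree_add_le_of_degree_le ?_ (by simp)
        refine Polynomial.natDegree_pow_le.trans ?_
        have : j'.natDegree = 0 := by omega
        rw [this]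
      omega
    have hjd2 : (j' ^ 2 + 1).natDegree = 2 * j'.natDegree := by
      rw [Polynomial.natDegree_add_eq_left_of_natDegree_lt] <;>
      simp [Polynomial.natDegree_pow, hjd]
    have hlc : (j' ^ 2 + 1).leadingCoeff = j'.leadingCoeff ^ 2 := by
      rw [Polynomial.leadingCoeff_add_of_degree_lt', Polynomial.leadingCoeff_pow]
      rw [Polynomial.degree_one]
      apply Polynomial.natDegree_pos_iff_degree_pos.1
      simp [Polynomial.natDegree_pow, hjd]
    have hj0 : j'.leadingCoeff ≠ 0 := by
      rw [Ne, Polynomial.leadingCoeff_eq_zero]; rintro e; rw [e] at hjd; simp at hjd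
    have hlc' : p'.leadingCoeff = j'.leadingCoeff ^ 2 := by
      rw [← hlc, hp', Polynomial.leadingCoeff_mul, hp.leadingCoeff, one_mul]
    set c := j'.leadingCoeff with hc
    set p2 := Polynomial.C (c⁻¹ ^ 2) * p' with hp2
    have hm2 : p2.Monic := by
      rw [Polynomial.Monic, hp2, Polynomial.leadingCoeff_mul, hlc', Polynomial.leadingCoeff_C]
      field_simp
    have hp2' : p' = (Polynomial.C c) ^ 2 * p2 := by
      rw [hp2, ← mul_assoc, ← Polynomial.C_pow, ← Polynomial.C_mul]
      have : c ^ 2 * c⁻¹ ^ 2 = 1 := by field_simp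
      rw [this]; simp
    have hd2 : p2.natDegree = p'.natDegree := by
      rw [hp2, Polynomial.natDegree_C_mul (by positivity)]
    have hs2 : IsSumSq p2 := by
      refine ih p2.natDegree (by omega) p2 le_rfl hm2 j' ?_
      rw [hp', hp2']
      exact dvd_mul_of_dvd_right (dvd_mul_left _ _) _
    have hs' : IsSumSq p' := by rw [hp2']; exact hs2.sq_mul _
    refine cassels' hK p p' hp'0 ?_
    have : p' ^ 2 * p = (j' ^ 2 + 1) * p' := by rw [hp']; ring
    rw [this]
    refine IsSumSq.mul (IsSumSq.add ?_ IsSumSq.one) hs'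
    rw [sq]; exact IsSumSq.mul_self _

/-- The dichotomy for a finite extension of `ℝ((x))`. -/
def LevelDich (L : Type*) [CommRing L] : Prop :=
  (∃ j : L, j * j = -1) ∨ RealQ L

theorem remove_unit {K : Type*} [Field K] (hK : RealQ K)
    (hlev : ∀ q : Polynomial K, Irreducible q → LevelDich (AdjoinRoot q)) :
    ∀ (N : ℕ) (Φ h Y : Polynomial K) (_ : Φ.natDegree + h.natDegree ≤ N) (_ : Φ.Monic) (_ : h ≠ 0)
      (_ : IsCoprime Y Φ) (_ : IsSumSq (h ^ 2 * Φ * Y)), IsSumSq Φ := by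
  intro N
  induction N using Nat.strong_induction_on with
  | _ N ih =>
    intro Φ h Y hN hΦ h0 hY hs
    by_cases hd : Φ.natDegree = 0
    · rw [hΦ.natDegree_eq_zero.1 hd]; exact IsSumSq.one
    obtain ⟨q, hqm, hqi, hqd⟩ := Polynomial.exists_monic_irreducible_factor Φ (by
      intro hu; exact hd (Polynomial.natDegree_eq_zero_of_isUnit hu))
    obtain ⟨Φ', rfl⟩ := hqd
    have hq0 : q ≠ 0 := hqm.ne_zero
    have hqpos : 0 < q.natDegree := hqi.natDegree_pos
    have hΦ' : Φ'.Monic := hqm.of_mul_monic_left hΦ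
    have hdeg : (q * Φ').natDegree = q.natDegree + Φ'.natDegree := hqm.natDegree_mul hΦ'
    rcases hlev q hqi with ⟨j, hj⟩ | hreal
    · obtain ⟨J, rfl⟩ := AdjoinRoot.mk_surjective j
      have hqs : IsSumSq q := by
        refine isSumSq_of_dvd_sq_add_one hK _ q le_rfl hqm J ?_
        rw [← AdjoinRoot.mk_eq_zero, map_add, map_pow, sq, hj, map_one]; ring
      refine hqs.mul ?_
      -- cancel the square of q
      have hs2 : IsSumSq (h ^ 2 * Φ' * Y) := by
        refine cassels' hK _ q hq0 ?_
        have : q ^ 2 * (h ^ 2 * Φ' * Y) = q * (h ^ 2 * (q * Φ') * Y) := by ring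
        rw [this]; exact hqs.mul hs
      exact ih (Φ'.natDegree + h.natDegree) (by omega) Φ' h Y le_rfl hΦ' h0
        (hY.of_isCoprime_of_dvd_right (dvd_mul_left _ _)) hs2
    · obtain ⟨G, hG, hGe⟩ := isSumSq_div (AdjoinRoot.mk q) hreal q
        (fun r hr => AdjoinRoot.mk_eq_zero.1 hr) hs (by
          rw [AdjoinRoot.mk_eq_zero]
          exact dvd_mul_of_dvd_left (dvd_mul_of_dvd_right (dvd_mul_right _ _) _) _)
      by_cases hqh : q ∣ h
      · obtain ⟨h1, rfl⟩ := hqh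
        have h10 : h1 ≠ 0 := right_ne_zero_of_mul h0
        refine ih ((q * Φ').natDegree + h1.natDegree) ?_ (q * Φ') h1 Y le_rfl hΦ h10 hY ?_
        · rw [Polynomial.natDegree_mul hq0 h10] at hN; omega
        · have : h1 ^ 2 * (q * Φ') * Y = G := by
            apply mul_left_cancel₀ (pow_ne_zero 2 hq0)
            rw [← hGe]; ring
          rw [this]; exact hG
      · have hp : Prime q := hqi.prime
        have hqY : ¬ q ∣ Y := by
          intro hd
          have : IsCoprime q q := (hY.of_isCoprime_of_dvd_left hd).of_isCoprime_of_dvd_right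
            (dvd_mul_right _ _)
          exact hqi.not_isUnit (isCoprime_self.1 this)
        have e : h ^ 2 * Φ' * Y = q * G := by
          apply mul_left_cancel₀ hq0
          rw [← mul_assoc q q, ← sq, ← hGe]; ring
        have : q ∣ Φ' := by
          have h1 : q ∣ h ^ 2 * Φ' * Y := ⟨G, e⟩
          rcases hp.dvd_or_dvd h1 with h2 | h2
          · rcases hp.dvd_or_dvd h2 with h3 | h3
            · exact absurd (hp.dvd_of_dvd_pow h3) hqh
            · exact h3
          · exact absurd h2 hqY
        obtain ⟨Φ2, rfl⟩ := this
        have hΦ2 : Φ2.Monic := hqm.of_mul_monic_left hΦ'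
        have hdeg2 : (q * Φ2).natDegree = q.natDegree + Φ2.natDegree := hqm.natDegree_mul hΦ2
        have : IsSumSq Φ2 := by
          refine ih (Φ2.natDegree + h.natDegree) (by omega) Φ2 h Y le_rfl hΦ2 h0
            (hY.of_isCoprime_of_dvd_right ((dvd_mul_left _ _).trans (dvd_mul_left _ _))) ?_
          have : h ^ 2 * Φ2 * Y = G := by
            apply mul_left_cancel₀ hq0
            rw [← e]; ring
          rw [this]; exact hG
        rw [← mul_assoc, ← sq]; exact this.sq_mul _


/-- The ring of power series in one variable. -/
abbrev R0 : Type := PowerSeries ℝ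

abbrev I0 : Ideal R0 := Ideal.span {PowerSeries.X}

theorem distinguished_div {A : Type*} [CommRing A] {I : Ideal A} [IsAdicComplete I A] {P : Polynomial A} (hP : P.IsDistinguishedAt I) (s : PowerSeries A) :
    ∃ (r : Polynomial A) (q : PowerSeries A), s = (P : PowerSeries A) * q + r := by
  obtain ⟨r', hr'⟩ := hP.algEquivQuotient.surjective (Ideal.Quotient.mk _ s)
  obtain ⟨r, rfl⟩ := Ideal.Quotient.mk_surjective r'
  have h2 : hP.algEquivQuotient (Ideal.Quotient.mk _ r)
      = Ideal.Quotient.mk _ (r : PowerSeries A) := by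
    simp
  rw [h2, eq_comm, Ideal.Quotient.mk_eq_mk_iff_sub_mem, Ideal.mem_span_singleton'] at hr'
  obtain ⟨q, hq⟩ := hr'
  exact ⟨r, q, by rw [mul_comm, hq]; ring⟩

theorem distinguished_dvd {A : Type*} [CommRing A] {I : Ideal A} [IsAdicComplete I A] {P : Polynomial A} (hP : P.IsDistinguishedAt I) (p : Polynomial A)
    (h : (P : PowerSeries A) ∣ (p : PowerSeries A)) : P ∣ p := by
  have h2 : hP.algEquivQuotient (Ideal.Quotient.mk _ p)
      = Ideal.Quotient.mk _ (p : PowerSeries A) := by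
    simp
  have h3 : (Ideal.Quotient.mk (Ideal.span {(P : PowerSeries A)}) (p : PowerSeries A)) = 0 := by
    rw [Ideal.Quotient.eq_zero_iff_mem, Ideal.mem_span_singleton]; exact h
  rw [h3] at h2
  have h4 := (map_eq_zero_iff _ hP.algEquivQuotient.injective).1 h2
  rwa [Ideal.Quotient.eq_zero_iff_mem, Ideal.mem_span_singleton] at h4

theorem powerSeries_sqrt {R : Type*} [CommRing R] (h2 : IsUnit (2 : R)) (w : PowerSeries R) (a : R)
    (ha : IsUnit a) (hw : PowerSeries.constantCoeff w = a ^ 2) :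
    ∃ s : PowerSeries R, s ^ 2 = w := by
  have key := (inferInstance : HenselianRing (PowerSeries R)
    (Ideal.span {PowerSeries.X})).is_henselian
    (Polynomial.X ^ 2 - Polynomial.C w) (Polynomial.monic_X_pow_sub_C _ (by norm_num))
    (PowerSeries.C a) ?_ ?_
  · obtain ⟨s, hs, -⟩ := key
    refine ⟨s, ?_⟩
    simpa [Polynomial.IsRoot, sub_eq_zero] using hs
  · rw [Ideal.mem_span_singleton, PowerSeries.X_dvd_iff]
    simp [hw]
  · apply IsUnit.map
    have : IsUnit (PowerSeries.C (2 * a) : PowerSeries R) := (h2.mul ha).map _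
    rw [map_mul, map_ofNat] at this
    simpa [one_add_one_eq_two] using this

theorem isUnit_two_of_algebra {R : Type*} [CommRing R] [Algebra ℝ R] : IsUnit (2 : R) := by
  have := (isUnit_iff_ne_zero.2 (two_ne_zero : (2:ℝ) ≠ 0)).map (algebraMap ℝ R)
  rwa [map_ofNat] at this

theorem sqrt_one_sub {O : Type*} [CommRing O] [Algebra R0 O] (ε c : O) (k : ℕ) (hk : k ≠ 0)
    (hc : IsIntegral R0 c) (h : ε ^ k = algebraMap R0 O PowerSeries.X * c) :
    ∃ r : O, r ^ 2 = 1 - ε := by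
  obtain ⟨χ, hχ, hχc⟩ := hc
  set P0 := χ.scaleRoots (PowerSeries.X : R0) with hP0
  have hP0m : P0.Monic := (Polynomial.monic_scaleRoots_iff _).2 hχ
  set P := Polynomial.expand R0 k P0 with hP
  have hPm : P.Monic := hP0m.expand (Nat.pos_of_ne_zero hk)
  have hdist : P.IsDistinguishedAt I0 := by
    refine ⟨⟨?_⟩, hPm⟩
    intro i hi
    rw [hP, Polynomial.natDegree_expand, hP0, Polynomial.natDegree_scaleRoots] at hi
    rw [hP, Polynomial.coeff_expand (Nat.pos_of_ne_zero hk)]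
    split_ifs with hd
    · rw [hP0, Polynomial.coeff_scaleRoots, Ideal.mem_span_singleton]
      apply Dvd.dvd.mul_left
      apply dvd_pow_self
      have : i / k < χ.natDegree := Nat.div_lt_of_lt_mul (by rwa [mul_comm])
      omega
    · exact Ideal.zero_mem _
  have hroot : Polynomial.aeval ε P = 0 := by
    rw [hP, Polynomial.expand_aeval, h]
    exact Polynomial.scaleRoots_aeval_eq_zero hχc
  obtain ⟨s, hs⟩ := powerSeries_sqrt (isUnit_two_of_algebra (R := R0))
    (1 - PowerSeries.X : PowerSeries R0) 1 isUnit_one (by simp)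
  obtain ⟨r, q, hr⟩ := distinguished_div hdist s
  have hd : P ∣ r ^ 2 - (1 - Polynomial.X) := by
    apply distinguished_dvd hdist
    refine ⟨-(2 * s * q) + P * q ^ 2, ?_⟩
    push_cast
    rw [← hs]
    have : (r : PowerSeries R0) = s - P * q := by rw [hr]; ring
    rw [this]; ring
  obtain ⟨q', hq'⟩ := hd
  refine ⟨Polynomial.aeval ε r, ?_⟩
  have := congrArg (Polynomial.aeval ε) hq'
  rw [map_mul, hroot, zero_mul] at this
  simpa [sub_eq_zero] using this


instance I0_maximal : I0.IsMaximal := by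
  have h : I0 = IsLocalRing.maximalIdeal R0 := PowerSeries.maximalIdeal_eq_span_X.symm
  rw [h]; infer_instance

theorem realQ_dvr {D : Type*} [CommRing D] [IsDomain D] [IsDiscreteValuationRing D]
    (ρ : D →+* ℝ) (hρ : ∀ a, ρ a = 0 ↔ a ∈ IsLocalRing.maximalIdeal D) : RealQ D := by
  obtain ⟨ϖ, hϖ⟩ := IsDiscreteValuationRing.exists_irreducible D
  apply RealQ.of_family
  intro m a h0 i
  by_contra hne
  have hf : FiniteMultiplicity ϖ (a i) := FiniteMultiplicity.of_not_isUnit hϖ.not_isUnit hne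
  obtain ⟨k, hk⟩ := hf
  apply hk
  refine dvd_of_sumsq ρ realQ_real ϖ hϖ.ne_zero (fun r => ?_) (k + 1) a 0 (by simpa using h0) i
  rw [hρ, hϖ.maximalIdeal_eq, Ideal.mem_span_singleton]

theorem exists_residue {O : Type*} [CommRing O] [Algebra R0 O]
    [Algebra.IsIntegral R0 O] (m : Ideal O) [m.IsMaximal]
    (hx : algebraMap R0 O PowerSeries.X ∈ m) (hj : ¬ ∃ j : O, j ^ 2 + 1 ∈ m) :
    ∃ ρ : O →+* ℝ, ∀ a, ρ a = 0 ↔ a ∈ m := by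
  let : Field (O ⧸ m) := Ideal.Quotient.field m
  let α : R0 →+* O ⧸ m := (Ideal.Quotient.mk m).comp (algebraMap R0 O)
  let : Algebra ℝ (O ⧸ m) := (α.comp (PowerSeries.C : ℝ →+* R0)).toAlgebra
  have hα : ∀ a : R0, α a = algebraMap ℝ (O ⧸ m) (PowerSeries.constantCoeff a) := by
    intro a
    have h1 : (PowerSeries.X : R0) ∣ a - PowerSeries.C (PowerSeries.constantCoeff a) := by
      rw [PowerSeries.X_dvd_iff]; simp
    obtain ⟨b, hb⟩ := h1
    have h2 : α PowerSeries.X = 0 := Ideal.Quotient.eq_zero_iff_mem.2 hx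
    have h3 := congrArg α hb
    rw [map_sub, map_mul, h2, zero_mul, sub_eq_zero] at h3
    exact h3
  have : Algebra.IsAlgebraic ℝ (O ⧸ m) := by
    constructor
    intro z
    obtain ⟨a, rfl⟩ := Ideal.Quotient.mk_surjective z
    obtain ⟨χ, hχ, hχa⟩ := Algebra.IsIntegral.isIntegral (R := R0) a
    apply IsIntegral.isAlgebraic
    refine ⟨χ.map PowerSeries.constantCoeff, hχ.map _, ?_⟩
    rw [Polynomial.eval₂_map]
    have h4 : (algebraMap ℝ (O ⧸ m)).comp (PowerSeries.constantCoeff : R0 →+* ℝ) = α := by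
      ext a; exact (hα a).symm
    rw [h4]
    have := congrArg (Ideal.Quotient.mk m) hχa
    rw [Polynomial.hom_eval₂, map_zero] at this
    exact this
  rcases Real.nonempty_algEquiv_or (O ⧸ m) with ⟨⟨e⟩⟩ | ⟨⟨e⟩⟩
  · refine ⟨(e : (O ⧸ m) →+* ℝ).comp (Ideal.Quotient.mk m), fun a => ?_⟩
    rw [← Ideal.Quotient.eq_zero_iff_mem]
    simp
  · exfalso; apply hj
    obtain ⟨j, hj⟩ := Ideal.Quotient.mk_surjective (e.symm Complex.I)
    refine ⟨j, ?_⟩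
    rw [← Ideal.Quotient.eq_zero_iff_mem, map_add, map_pow, hj, ← map_pow]
    simp

theorem realQ_of_prime {O : Type*} [CommRing O] [IsDedekindDomain O] [Algebra R0 O]
    [FaithfulSMul R0 O] [Algebra.IsIntegral R0 O] (m : Ideal O) [hm : m.IsMaximal]
    (hx : algebraMap R0 O PowerSeries.X ∈ m) (hj : ¬ ∃ j : O, j ^ 2 + 1 ∈ m) : RealQ O := by
  obtain ⟨ρ, hρ⟩ := exists_residue m hx hj
  have hm0 : m ≠ ⊥ := by
    rintro rfl
    rw [Ideal.mem_bot] at hx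
    exact PowerSeries.X_ne_zero ((FaithfulSMul.algebraMap_injective R0 O) (by rw [hx, map_zero]))
  have := IsLocalization.AtPrime.isDiscreteValuationRing_of_dedekind_domain O hm0
    (Localization.AtPrime m)
  have hu : ∀ y : m.primeCompl, IsUnit (ρ y) := by
    intro y
    rw [isUnit_iff_ne_zero, Ne, hρ]
    exact y.2
  let ρ' : Localization.AtPrime m →+* ℝ := IsLocalization.lift hu
  refine RealQ.of_injective (algebraMap O (Localization.AtPrime m))
    (IsLocalization.injective _ m.primeCompl_le_nonZeroDivisors) (realQ_dvr ρ' ?_)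
  intro a
  obtain ⟨b, s, rfl⟩ := IsLocalization.exists_mk'_eq m.primeCompl a
  rw [IsLocalization.AtPrime.mk'_mem_maximal_iff _ m, ← hρ]
  rw [IsLocalization.lift_mk', Units.mul_left_eq_zero]

theorem sqrt_neg {O : Type*} [CommRing O] [IsDedekindDomain O] [Algebra R0 O]
    [FaithfulSMul R0 O] [Algebra.IsIntegral R0 O]
    (hj : ∀ m : Ideal O, m.IsMaximal → algebraMap R0 O PowerSeries.X ∈ m → ∃ j : O, j ^ 2 + 1 ∈ m) :
    ∃ y r : O, y ≠ 0 ∧ r ^ 2 = - y ^ 2 := by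
  have hmax : ∀ m ∈ I0.primesOver O, m.IsMaximal ∧ algebraMap R0 O PowerSeries.X ∈ m := by
    rintro m ⟨hm, ho⟩
    refine ⟨Ideal.isMaximal_of_isIntegral_of_isMaximal_comap (R := R0) m
      (by have h := ho.over; rw [Ideal.under_def] at h; rw [← h]; exact I0_maximal), ?_⟩
    have : (PowerSeries.X : R0) ∈ m.under R0 := by
      rw [← ho.over]; exact Ideal.mem_span_singleton_self _
    exact this
  choose j hj' using fun m : I0.primesOver O => hj m.1 (hmax m.1 m.2).1 (hmax m.1 m.2).2
  have hfin := IsDedekindDomain.primesOver_finite I0 O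
  have hxO : algebraMap R0 O PowerSeries.X ≠ 0 := by
    intro hx
    exact PowerSeries.X_ne_zero ((FaithfulSMul.algebraMap_injective R0 O) (by rw [hx, map_zero]))
  obtain ⟨y, hy⟩ := IsDedekindDomain.exists_forall_sub_mem_ideal (R := O)
    (s := hfin.toFinset) (fun m : Ideal O => m) (fun _ => 1)
    (fun m hm => by
      have hm := hmax m (hfin.mem_toFinset.1 hm)
      have := hm.1
      refine Ideal.prime_of_isPrime ?_ hm.1.isPrime
      rintro rfl
      exact hxO (by simpa using hm.2))
    (fun a _ b _ h => h) (fun m => j ⟨m.1, hfin.mem_toFinset.1 m.2⟩)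
  have hε : ∀ m ∈ I0.primesOver O, y ^ 2 + 1 ∈ m := by
    intro m hm
    have h1 := hy m (hfin.mem_toFinset.2 hm)
    have h2 := hj' ⟨m, hm⟩
    rw [pow_one] at h1
    have h3 := m.add_mem h2 (m.mul_mem_left (y + j ⟨m, hm⟩) h1)
    convert h3 using 1
    ring
  have hrad : y ^ 2 + 1 ∈ (Ideal.span {algebraMap R0 O PowerSeries.X}).radical := by
    rw [Ideal.radical_eq_sInf, Submodule.mem_sInf]
    rintro P ⟨hP, hPp⟩
    apply hε
    refine ⟨hPp, ⟨?_⟩⟩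
    refine I0_maximal.eq_of_le (Ideal.IsPrime.under R0 P).ne_top ?_
    rw [Ideal.span_singleton_le_iff_mem]
    exact hP (Ideal.mem_span_singleton_self _)
  obtain ⟨k, hk⟩ := hrad
  have hk' : (y ^ 2 + 1) ^ (k + 1) ∈ Ideal.span {algebraMap R0 O PowerSeries.X} := by
    rw [pow_succ]; exact Ideal.mul_mem_right _ _ hk
  obtain ⟨c, hc⟩ := Ideal.mem_span_singleton.1 hk'
  obtain ⟨r, hr⟩ := sqrt_one_sub (y ^ 2 + 1) c (k + 1) (by omega)
    (Algebra.IsIntegral.isIntegral c) hc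
  refine ⟨y, r, ?_, by rw [hr]; ring⟩
  rintro rfl
  obtain ⟨Q, hQm, hQo⟩ := Ideal.exists_maximal_ideal_liesOver_of_isIntegral (S := O) I0
  have hQ : Q ∈ I0.primesOver O := ⟨hQm.isPrime, hQo⟩
  have := hε Q hQ
  exact hQ.1.ne_top ((Ideal.eq_top_iff_one _).2 (by simpa using this))

theorem levelDich {K L : Type*} [Field K] [Algebra R0 K] [IsFractionRing R0 K] [Field L]
    [Algebra K L] [Algebra R0 L] [IsScalarTower R0 K L] [FiniteDimensional K L] : LevelDich L := by
  have : CharZero K := by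
    exact charZero_of_injective_ringHom
      ((algebraMap R0 K).comp (PowerSeries.C : ℝ →+* R0)).injective
  have := integralClosure.isDedekindDomain R0 K L
  have : IsFractionRing (integralClosure R0 L) L :=
    integralClosure.isFractionRing_of_finite_extension K L
  have : FaithfulSMul R0 L := (faithfulSMul_iff_algebraMap_injective _ _).2 (by
    rw [IsScalarTower.algebraMap_eq R0 K L]
    exact (algebraMap K L).injective.comp (FaithfulSMul.algebraMap_injective R0 K))
  have : FaithfulSMul R0 (integralClosure R0 L) := inferInstance
  by_cases hj : ∀ m : Ideal (integralClosure R0 L), m.IsMaximal →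
      algebraMap R0 (integralClosure R0 L) PowerSeries.X ∈ m → ∃ j, j ^ 2 + 1 ∈ m
  · left
    obtain ⟨y, r, hy, hr⟩ := sqrt_neg hj
    have hy' : (y : L) ≠ 0 := fun h => hy (Subtype.ext h)
    refine ⟨(r : L) / y, ?_⟩
    have := congrArg (Subtype.val) hr
    push_cast at this
    field_simp
    exact this
  · right
    push Not at hj
    obtain ⟨m, hm, hx, hj⟩ := hj
    have := realQ_of_prime m hx (by push Not; exact hj)
    exact this.fraction


/-- Homogenisation of `F (u + c / u)`. -/
def homog {R : Type*} [CommRing R] (F : Polynomial R) (c : R) (d : ℕ) : Polynomial R :=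
  ∑ j ∈ Finset.range (d + 1), Polynomial.C (F.coeff j) * Polynomial.X ^ (d - j) *
    (Polynomial.X ^ 2 + Polynomial.C c) ^ j

theorem homog_eval {R B : Type*} [CommRing R] [CommRing B] (φ : R →+* B) (F : Polynomial R) (c : R)
    (d : ℕ) (hd : F.natDegree ≤ d) (u v : B) (huv : u * v = φ c) :
    (homog F c d).eval₂ φ u = u ^ d * F.eval₂ φ (u + v) := by
  rw [homog, Polynomial.eval₂_finsetSum,
    Polynomial.eval₂_eq_sum_range' φ (Nat.lt_succ_of_le hd), Finset.mul_sum]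
  refine Finset.sum_congr rfl fun j hj => ?_
  have hj' : j ≤ d := Nat.lt_succ_iff.1 (Finset.mem_range.1 hj)
  simp only [Polynomial.eval₂_mul, Polynomial.eval₂_pow, Polynomial.eval₂_add, Polynomial.eval₂_C,
    Polynomial.eval₂_X, ← huv]
  have h1 : u ^ d = u ^ (d - j) * u ^ j := by rw [← pow_add]; congr 1; omega
  have h2 : u ^ 2 + u * v = u * (u + v) := by ring
  rw [h1, h2, mul_pow]; ring

theorem homog_coeff_zero {R : Type*} [CommRing R] (F : Polynomial R) (c : R) (d : ℕ) :
    (homog F c d).coeff 0 = F.coeff d * c ^ d := by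
  rw [Polynomial.coeff_zero_eq_eval_zero, homog, Polynomial.eval_finsetSum,
    Finset.sum_eq_single d]
  · simp
  · intro j hj hjd
    have hj' : d - j ≠ 0 := by have := Finset.mem_range.1 hj; omega
    simp [hj']
  · simp

theorem homog_monic {R : Type*} [CommRing R] [Nontrivial R] (F : Polynomial R) (c : R) (d : ℕ)
    (hF : F.Monic) (hd : F.natDegree = d) :
    (homog F c d).Monic ∧ (homog F c d).natDegree = 2 * d := by
  have h1 : (Polynomial.X ^ 2 + Polynomial.C c : Polynomial R).Monic :=
    Polynomial.monic_X_pow_add_C c (by norm_num)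
  have h1d : (Polynomial.X ^ 2 + Polynomial.C c : Polynomial R).natDegree = 2 :=
    Polynomial.natDegree_X_pow_add_C
  have h2 := h1.pow d
  have h2d : ((Polynomial.X ^ 2 + Polynomial.C c : Polynomial R) ^ d).natDegree = 2 * d := by
    rw [h1.natDegree_pow, h1d, mul_comm]
  have hcoef : F.coeff d = 1 := by rw [← hd]; exact hF
  rw [homog, Finset.sum_range_succ, hcoef]
  simp only [Nat.sub_self, pow_zero, mul_one, Polynomial.C_1, one_mul]
  have hlt : (∑ j ∈ Finset.range d, Polynomial.C (F.coeff j) * Polynomial.X ^ (d - j) *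
    (Polynomial.X ^ 2 + Polynomial.C c) ^ j).degree <
      ((Polynomial.X ^ 2 + Polynomial.C c : Polynomial R) ^ d).degree := by
    rw [Polynomial.degree_eq_natDegree h2.ne_zero, h2d]
    rw [Polynomial.degree_lt_iff_coeff_zero]
    intro m hm
    rw [Polynomial.finsetSum_coeff]
    refine Finset.sum_eq_zero fun j hj => ?_
    apply Polynomial.coeff_eq_zero_of_natDegree_lt
    have hj' := Finset.mem_range.1 hj
    calc _ ≤ _ := Polynomial.natDegree_mul_le
      _ ≤ (d - j) + j * 2 := by
        gcongr
        · exact Polynomial.natDegree_C_mul_X_pow_le _ _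
        · rw [h1.natDegree_pow, h1d]
      _ < m := by omega
  refine ⟨h2.add_of_right hlt, ?_⟩
  rw [Polynomial.natDegree_add_eq_right_of_degree_lt hlt, h2d]

section field
variable {K : Type*} [Field K]

/-- The substitution `y = u + c / u`. -/
def psiL (c : K) : Polynomial K →+* LaurentPolynomial K :=
  Polynomial.eval₂RingHom LaurentPolynomial.C
    (LaurentPolynomial.T 1 + LaurentPolynomial.C c * LaurentPolynomial.T (-1))

theorem toLaurent_eq_eval₂ (p : Polynomial K) :
    Polynomial.toLaurent p = p.eval₂ LaurentPolynomial.C (LaurentPolynomial.T 1) := by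
  have : (Polynomial.toLaurent : Polynomial K →+* LaurentPolynomial K) =
      Polynomial.eval₂RingHom LaurentPolynomial.C (LaurentPolynomial.T 1) := by
    apply Polynomial.ringHom_ext
    · intro a; simp
    · simp
  exact congrArg (fun f => f p) this

theorem T_mul_T_neg (c : K) : (LaurentPolynomial.T 1 : LaurentPolynomial K) *
    (LaurentPolynomial.C c * LaurentPolynomial.T (-1)) = LaurentPolynomial.C c := by
  rw [mul_left_comm, ← LaurentPolynomial.T_add]; simp

theorem toLaurent_homog (c : K) (p : Polynomial K) (d : ℕ) (hd : p.natDegree ≤ d) :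
    Polynomial.toLaurent (homog p c d) = LaurentPolynomial.T 1 ^ d * psiL c p := by
  rw [toLaurent_eq_eval₂, homog_eval _ _ _ _ hd _ _ (T_mul_T_neg c)]; rfl

theorem sumsq_homog (c : K) (s : Polynomial K) (hs : IsSumSq s) :
    ∃ N0 : ℕ, ∀ N ≥ N0, ∃ s' : Polynomial K, IsSumSq s' ∧
      Polynomial.toLaurent s' = LaurentPolynomial.T 1 ^ (2 * N) * psiL c s := by
  induction hs using IsSumSq.rec' with
  | zero => exact ⟨0, fun N _ => ⟨0, IsSumSq.zero, by simp⟩⟩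
  | sq_add hx hs ih =>
    obtain ⟨a, rfl⟩ := hx
    obtain ⟨N0, ih⟩ := ih
    refine ⟨N0 + a.natDegree, fun N hN => ?_⟩
    obtain ⟨s', h1, h2⟩ := ih N (by omega)
    refine ⟨homog a c N * homog a c N + s', IsSumSq.sq_add _ h1, ?_⟩
    rw [map_add, map_mul, toLaurent_homog c a N (by omega), h2, map_add, map_mul, pow_mul', sq]
    ring

theorem homog_isSumSq (hK : RealQ K)
    (hlev : ∀ q : Polynomial K, Irreducible q → LevelDich (AdjoinRoot q))
    (c : K) (hc : c ≠ 0) (δ : ℕ) (F H E s0 s1 : Polynomial K) (hF : F.Monic)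
    (hd : F.natDegree = 2 * δ) (hH : H ≠ 0) (hs0 : IsSumSq s0) (hs1 : IsSumSq s1)
    (h : H ^ 2 * F * (1 + F * E) = s0 + (Polynomial.X ^ 2 - Polynomial.C (4 * c)) * s1) :
    IsSumSq (homog F c (2 * δ)) := by
  obtain ⟨N0, hN0⟩ := sumsq_homog c s0 hs0
  obtain ⟨N1, hN1⟩ := sumsq_homog c s1 hs1
  set N := N0 + N1 with hN
  obtain ⟨s0', hs0', e0⟩ := hN0 (N + 1) (by omega)
  obtain ⟨s1', hs1', e1⟩ := hN1 N (by omega)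
  set H' := homog H c H.natDegree with hH'
  set E' := homog E c E.natDegree with hE'
  set Φ := homog F c (2 * δ) with hΦ
  have eH := toLaurent_homog c H _ le_rfl
  have eE := toLaurent_homog c E _ le_rfl
  have eF := toLaurent_homog c F _ hd.le
  rw [← hH'] at eH
  rw [← hE'] at eE
  rw [← hΦ] at eF
  set e := E.natDegree
  set k := H.natDegree
  have hΦm := homog_monic F c _ hF hd
  have hΦ0 : Φ.coeff 0 ≠ 0 := by
    rw [hΦ, homog_coeff_zero, ← hd]
    rw [show F.coeff F.natDegree = 1 from hF, one_mul]
    exact pow_ne_zero _ hc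
  have hH0 : H' ≠ 0 := by
    intro h0
    have := homog_coeff_zero H c k
    rw [← hH', h0, Polynomial.coeff_zero] at this
    rcases mul_eq_zero.1 this.symm with h2 | h2
    · exact hH (Polynomial.leadingCoeff_eq_zero.1 h2)
    · exact pow_ne_zero _ hc h2
  set Y : Polynomial K := Polynomial.X ^ (2 * (2 * δ + e)) + Φ * (E' * Polynomial.X ^ (2 * δ + e))
  have hY : IsCoprime Y Φ := by
    have hX : IsCoprime Polynomial.X Φ := by
      rw [Polynomial.irreducible_X.coprime_iff_not_dvd, Polynomial.X_dvd_iff]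
      exact hΦ0
    have := (hX.pow_left (m := 2 * (2 * δ + e))).add_mul_left_left
      (E' * Polynomial.X ^ (2 * δ + e))
    exact this
  refine remove_unit hK hlev _ Φ (H' * Polynomial.X ^ (N + 1)) Y le_rfl hΦm.1
    (mul_ne_zero hH0 (pow_ne_zero _ Polynomial.X_ne_zero)) hY ?_
  have key : (H' * Polynomial.X ^ (N + 1)) ^ 2 * Φ * Y =
      (Polynomial.X ^ (k + δ + (2 * δ + e))) ^ 2 *
        (s0' + (Polynomial.X ^ 2 - Polynomial.C c) ^ 2 * s1') := by
    apply Polynomial.toLaurent_injective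
    have hz : (psiL c) (Polynomial.X ^ 2 - Polynomial.C (4 * c)) * LaurentPolynomial.T 1 ^ 2 =
        (LaurentPolynomial.T 1 ^ 2 - LaurentPolynomial.C c) ^ 2 := by
      have hT := T_mul_T_neg c
      have h4 : (LaurentPolynomial.C (4 * c) : LaurentPolynomial K) =
          4 * LaurentPolynomial.C c := by rw [map_mul, map_ofNat]
      simp only [psiL, Polynomial.coe_eval₂RingHom, Polynomial.eval₂_sub, Polynomial.eval₂_pow,
        Polynomial.eval₂_X, Polynomial.eval₂_C, h4]
      generalize (LaurentPolynomial.C c * LaurentPolynomial.T (-1) : LaurentPolynomial K) = v at *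
      rw [← hT]
      ring
    generalize hg : (Polynomial.X ^ 2 - Polynomial.C (4 * c) : Polynomial K) = g at *
    have h' := congrArg (psiL c) h
    simp only [map_mul, map_add, map_pow, map_one] at h'
    simp only [map_mul, map_add, map_pow, map_sub, Y, Polynomial.toLaurent_X,
      Polynomial.toLaurent_C]
    rw [eH, eE, eF, e0, e1, ← hz]
    generalize (psiL c) g = G at *
    generalize (LaurentPolynomial.T 1 : LaurentPolynomial K) = t at *
    calc _ = t ^ (2 * (N + 1) + 2 * k + 2 * δ + 2 * (2 * δ + e)) *
          ((psiL c) H ^ 2 * (psiL c) F * (1 + (psiL c) F * (psiL c) E)) := by ring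
      _ = _ := by rw [h']; ring
  rw [key]
  apply IsSumSq.sq_mul
  exact hs0'.add (hs1'.sq_mul _)

end field


theorem hlev_frac (q : Polynomial (FractionRing R0)) (hq : Irreducible q) :
    LevelDich (AdjoinRoot q) := by
  have : Fact (Irreducible q) := ⟨hq⟩
  have : FiniteDimensional (FractionRing R0) (AdjoinRoot q) :=
    (AdjoinRoot.powerBasis hq.ne_zero).finite
  exact levelDich (K := FractionRing R0)

theorem map_homog {R S : Type*} [CommRing R] [CommRing S] (φ : R →+* S) (F : Polynomial R) (c : R)
    (d : ℕ) : (homog F c d).map φ = homog (F.map φ) (φ c) d := by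
  simp [homog, Polynomial.map_sum]

theorem ker_mod_x (p : Polynomial R0) :
    Polynomial.mapRingHom (PowerSeries.constantCoeff : R0 →+* ℝ) p = 0 ↔
      Polynomial.C (PowerSeries.X : R0) ∣ p := by
  rw [Polynomial.C_dvd_iff_dvd_coeff, Polynomial.ext_iff]
  refine forall_congr' fun i => ?_
  rw [PowerSeries.X_dvd_iff]
  simp

theorem C_X_ne_zero : (Polynomial.C (PowerSeries.X : R0)) ≠ 0 := by
  rw [Ne, Polynomial.C_eq_zero]; exact PowerSeries.X_ne_zero

theorem dvd_of_sumsq_poly (k : ℕ) {J : Type*} [Fintype J] (a : J → Polynomial R0)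
    (G : Polynomial R0) (h : ∑ i, a i ^ 2 = Polynomial.C (PowerSeries.X : R0) ^ (2 * k) * G)
    (i : J) : Polynomial.C (PowerSeries.X : R0) ^ k ∣ a i :=
  dvd_of_sumsq (Polynomial.mapRingHom (PowerSeries.constantCoeff : R0 →+* ℝ))
    realQ_real.polynomial _ C_X_ne_zero ker_mod_x k a G h i

theorem R0_eq (b : R0) (hb : b ≠ 0) : ∃ (k : ℕ) (u : R0), IsUnit u ∧ b = PowerSeries.X ^ k * u := by
  obtain ⟨k, u, hu⟩ := IsDiscreteValuationRing.eq_unit_mul_pow_irreducible hb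
    (PowerSeries.X_irreducible (R := ℝ))
  exact ⟨k, u, u.isUnit, by rw [hu, mul_comm]⟩

theorem descend (Φ : Polynomial R0)
    (h : IsSumSq (Φ.map (algebraMap R0 (FractionRing R0)))) :
    ∃ (m : ℕ) (a : Fin m → Polynomial R0), Φ = ∑ i, a i ^ 2 := by
  obtain ⟨m, a, ha⟩ := h.exists_fin
  let _ : Algebra (Polynomial R0) (Polynomial (FractionRing R0)) := Polynomial.algebra _ _
  have : IsLocalization ((nonZeroDivisors R0).map (Polynomial.C : R0 →+* Polynomial R0))
    (Polynomial (FractionRing R0)) := Polynomial.isLocalization _ _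
  obtain ⟨b, hb⟩ := IsLocalization.exist_integer_multiples_of_finite
    ((nonZeroDivisors R0).map (Polynomial.C : R0 →+* Polynomial R0)) a
  obtain ⟨b, b0, hb0, rfl⟩ := b
  choose A hA using hb
  have hb0' : b0 ≠ 0 := nonZeroDivisors.ne_zero hb0
  have hinj : Function.Injective (Polynomial.map (algebraMap R0 (FractionRing R0))) :=
    Polynomial.map_injective _ (IsFractionRing.injective _ _)
  have key : ∑ i, A i ^ 2 = Polynomial.C b0 ^ 2 * Φ := by
    apply hinj
    rw [Polynomial.map_mul, ha, Finset.mul_sum, Polynomial.map_sum]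
    refine Finset.sum_congr rfl fun i _ => ?_
    have := hA i
    rw [Algebra.smul_def] at this
    rw [Polynomial.map_pow, Polynomial.map_pow, ← mul_pow]
    exact congrArg (· ^ 2) this
  obtain ⟨k, u, hu, rfl⟩ := R0_eq b0 hb0'
  obtain ⟨v, hv⟩ := hu.exists_left_inv
  have key2 : ∑ i, A i ^ 2 = Polynomial.C (PowerSeries.X : R0) ^ (2 * k) *
      (Polynomial.C u ^ 2 * Φ) := by
    rw [key]; simp only [map_mul, map_pow]; ring
  choose B hB using fun i => dvd_of_sumsq_poly k A _ key2 i
  refine ⟨m, fun i => Polynomial.C v * B i, ?_⟩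
  apply mul_left_cancel₀ (pow_ne_zero (2 * k) C_X_ne_zero)
  have hv' : (Polynomial.C v * Polynomial.C u : Polynomial R0) = 1 := by
    rw [← map_mul, hv, map_one]
  calc _ = (Polynomial.C v * Polynomial.C u) ^ 2 *
      (Polynomial.C (PowerSeries.X : R0) ^ (2 * k) * Φ) := by rw [hv']; ring
    _ = Polynomial.C v ^ 2 * ∑ i, A i ^ 2 := by rw [key2]; ring
    _ = _ := by
      rw [Finset.mul_sum, Finset.mul_sum]
      refine Finset.sum_congr rfl fun i _ => ?_
      rw [hB i]; ring

/-- The reversed polynomial. -/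
def revc {R : Type*} [CommRing R] (a : Polynomial R) (c : R) (d : ℕ) : Polynomial R :=
  ∑ k ∈ Finset.range (d + 1), Polynomial.C (a.coeff k * c ^ k) * Polynomial.X ^ (d - k)

theorem revc_eval {R B : Type*} [CommRing R] [CommRing B] (φ : R →+* B) (a : Polynomial R) (c : R)
    (d : ℕ) (hd : a.natDegree ≤ d) (u v : B) (huv : u * v = φ c) :
    (revc a c d).eval₂ φ u = u ^ d * a.eval₂ φ v := by
  rw [revc, Polynomial.eval₂_finsetSum,
    Polynomial.eval₂_eq_sum_range' φ (Nat.lt_succ_of_le hd), Finset.mul_sum]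
  refine Finset.sum_congr rfl fun j hj => ?_
  have hj' : j ≤ d := Nat.lt_succ_iff.1 (Finset.mem_range.1 hj)
  simp only [Polynomial.eval₂_mul, Polynomial.eval₂_pow, Polynomial.eval₂_C,
    Polynomial.eval₂_X, map_mul, map_pow, ← huv]
  have h1 : u ^ d = u ^ (d - j) * u ^ j := by rw [← pow_add]; congr 1; omega
  rw [h1, mul_pow]; ring

theorem revc_coeff {R : Type*} [CommRing R] (a : Polynomial R) (c : R) (d k : ℕ) (hk : k ≤ d) :
    (revc a c d).coeff (d - k) = a.coeff k * c ^ k := by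
  rw [revc, Polynomial.finsetSum_coeff, Finset.sum_eq_single k]
  · rw [Polynomial.coeff_C_mul_X_pow, if_pos rfl]
  · intro j hj hjk
    have := Finset.mem_range.1 hj
    rw [Polynomial.coeff_C_mul_X_pow, if_neg]
    omega
  · intro h; exact absurd (Finset.mem_range.2 (by omega)) h

theorem sum_revc {R : Type*} [CommRing R] (F : Polynomial R) (c : R) (d : ℕ)
    (hd : F.natDegree ≤ d) {m : ℕ} (a : Fin m → Polynomial R)
    (ha : ∀ i, (a i).natDegree ≤ d) (h : homog F c d = ∑ i, a i ^ 2) :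
    ∑ i, revc (a i) c d ^ 2 = Polynomial.C c ^ d * homog F c d := by
  apply Polynomial.toLaurent_injective
  have hL : ∀ p : Polynomial R, Polynomial.toLaurent p =
      p.eval₂ LaurentPolynomial.C (LaurentPolynomial.T 1) := by
    intro p
    have : (Polynomial.toLaurent : Polynomial R →+* LaurentPolynomial R) =
        Polynomial.eval₂RingHom LaurentPolynomial.C (LaurentPolynomial.T 1) := by
      apply Polynomial.ringHom_ext
      · intro a; simp
      · simp
    exact congrArg (fun f => f p) this
  have hT : (LaurentPolynomial.T 1 : LaurentPolynomial R) *
    (LaurentPolynomial.C c * LaurentPolynomial.T (-1)) = LaurentPolynomial.C c := by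
    rw [mul_left_comm, ← LaurentPolynomial.T_add]; simp
  rw [hL, hL]
  generalize (LaurentPolynomial.C c * LaurentPolynomial.T (-1) : LaurentPolynomial R) = v at *
  generalize (LaurentPolynomial.T 1 : LaurentPolynomial R) = u at *
  rw [Polynomial.eval₂_mul, homog_eval _ _ _ _ hd u v hT, Polynomial.eval₂_finsetSum]
  simp only [Polynomial.eval₂_pow, Polynomial.eval₂_C]
  have h1 := congrArg (Polynomial.eval₂ LaurentPolynomial.C v) h
  rw [homog_eval _ _ _ _ hd v u (by rw [mul_comm, hT]), Polynomial.eval₂_finsetSum] at h1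
  calc _ = ∑ i, (u ^ d) ^ 2 * Polynomial.eval₂ LaurentPolynomial.C v (a i ^ 2) := by
        refine Finset.sum_congr rfl fun i _ => ?_
        rw [revc_eval _ _ _ _ (ha i) u v hT, Polynomial.eval₂_pow]; ring
    _ = _ := by
      rw [← Finset.mul_sum, ← h1, ← hT, add_comm v u, mul_pow]; ring


theorem map_rel {R K : Type*} [CommRing R] [CommRing K] (φ : R →+* K) (c : R)
    (F H E s0 s1 : Polynomial R)
    (h : H ^ 2 * F * (1 + F * E) = s0 + (Polynomial.X ^ 2 - Polynomial.C (4 * c)) * s1) :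
    (H.map φ) ^ 2 * (F.map φ) * (1 + (F.map φ) * (E.map φ)) =
      s0.map φ + (Polynomial.X ^ 2 - Polynomial.C (4 * φ c)) * s1.map φ := by
  have := congrArg (Polynomial.map φ) h
  simp only [Polynomial.map_mul, Polynomial.map_add, Polynomial.map_pow, Polynomial.map_sub,
    Polynomial.map_X, Polynomial.map_C, Polynomial.map_one, map_mul φ, map_ofNat φ] at this
  exact this

theorem qa_sq {S : Type*} [CommRing S] (g : S) :
    (⟨0, 1⟩ : QuadraticAlgebra S g 0) * ⟨0, 1⟩ = algebraMap S (QuadraticAlgebra S g 0) g := by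
  ext <;> simp [QuadraticAlgebra.algebraMap_eq]

theorem qa_re {S : Type*} [CommRing S] (g p : S) (z : QuadraticAlgebra S g 0) :
    (algebraMap S (QuadraticAlgebra S g 0) p * z).re = p * z.re := by
  simp [QuadraticAlgebra.algebraMap_eq]

theorem qa_sq_re {S : Type*} [CommRing S] (g : S) (z : QuadraticAlgebra S g 0) :
    (z ^ 2).re = z.re ^ 2 + g * z.im ^ 2 := by
  rw [sq]; simp; ring

theorem quadPart {R : Type*} [CommRing R] [IsDomain R] (q c : R) (hq : 4 * q = 1) (hc0 : c ≠ 0)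
    (δ m : ℕ) (F : Polynomial R) (hd : F.natDegree = 2 * δ) (a : Fin m → Polynomial R)
    (ha : homog F c (2 * δ) = ∑ i, a i ^ 2) (hdeg : ∀ i, (a i).natDegree ≤ 2 * δ)
    (b : (i : Fin m) → (k : ℕ) → k < δ → R)
    (hb : ∀ i k (hk : k < δ), (a i).coeff k = c ^ (δ - k) * b i k hk) :
    ∃ t0 t1 : Polynomial R, IsSumSq t0 ∧ IsSumSq t1 ∧
      F = t0 + (Polynomial.X ^ 2 - Polynomial.C (4 * c)) * t1 := by
  generalize hg : (Polynomial.X ^ 2 - Polynomial.C (4 * c) : Polynomial R) = g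
  let B := QuadraticAlgebra (Polynomial R) g 0
  let θ : Polynomial R →+* B := algebraMap _ _
  let τ : R →+* B := θ.comp Polynomial.C
  obtain ⟨w, hw⟩ : ∃ w : B, w = ⟨0, 1⟩ := ⟨_, rfl⟩
  have hww : w * w = θ g := by
    rw [hw]; exact qa_sq g
  have h2 : (2 : B) * τ (2 * q) = 1 := by
    have : τ (4 * q) = 1 := by rw [hq, map_one]
    rw [← this, map_mul, map_mul, map_ofNat, map_ofNat]; ring
  have hτq : τ (2 * q) * τ (2 * q) = τ q := by
    have : (2 * q) * (2 * q) = q := by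
      calc _ = (4 * q) * q := by ring
        _ = q := by rw [hq, one_mul]
    rw [← map_mul, this]
  obtain ⟨u, hu⟩ : ∃ u : B, u = τ (2 * q) * (θ Polynomial.X + w) := ⟨_, rfl⟩
  obtain ⟨v, hv⟩ : ∃ v : B, v = τ (2 * q) * (θ Polynomial.X - w) := ⟨_, rfl⟩
  have huv : u * v = τ c := by
    have h5 : θ g = θ Polynomial.X ^ 2 - τ (4 * c) := by
      have h6 := congrArg θ hg.symm
      rw [map_sub, map_pow] at h6; exact h6
    calc u * v = (τ (2 * q) * τ (2 * q)) * (θ Polynomial.X ^ 2 - w * w) := by rw [hu, hv]; ring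
      _ = τ q * τ (4 * c) := by rw [hτq, hww, h5]; ring
      _ = τ c := by
        rw [← map_mul]; congr 1
        calc _ = 4 * q * c := by ring
          _ = c := by rw [hq, one_mul]
  have huvs : u + v = θ Polynomial.X := by
    calc u + v = 2 * τ (2 * q) * θ Polynomial.X := by rw [hu, hv]; ring
      _ = _ := by rw [h2, one_mul]
  have hFe : F.eval₂ τ (u + v) = θ F := by
    rw [huvs]
    have : (Polynomial.eval₂RingHom τ (θ Polynomial.X)) = θ := by
      apply Polynomial.ringHom_ext
      · intro a; simp [τ]
      · simp
    exact congrArg (fun f => f F) this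
  let α : Fin m → B := fun i => ∑ k ∈ Finset.range (2 * δ + 1),
    if hk : k < δ then τ (b i k hk) * v ^ (δ - k) else τ ((a i).coeff k) * u ^ (k - δ)
  have hα : ∀ i, u ^ δ * α i = (a i).eval₂ τ u := by
    intro i
    rw [Polynomial.eval₂_eq_sum_range' τ (Nat.lt_succ_of_le (hdeg i)), Finset.mul_sum]
    refine Finset.sum_congr rfl fun k _ => ?_
    split_ifs with hk
    · rw [hb i k hk, map_mul, map_pow, ← huv]
      have h5 : u ^ δ = u ^ (δ - k) * u ^ k := by rw [← pow_add]; congr 1; omega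
      rw [h5, mul_pow]; ring
    · have h5 : u ^ k = u ^ (k - δ) * u ^ δ := by rw [← pow_add]; congr 1; omega
      rw [h5]; ring
  have e1 : u ^ (2 * δ) * θ F = u ^ (2 * δ) * ∑ i, α i ^ 2 := by
    rw [← hFe, ← homog_eval τ F c (2 * δ) hd.le u v huv, ha, Polynomial.eval₂_finsetSum,
      Finset.mul_sum]
    refine Finset.sum_congr rfl fun i _ => ?_
    rw [Polynomial.eval₂_pow, ← hα]; ring
  have e2 : θ (Polynomial.C c ^ (2 * δ)) * θ F = θ (Polynomial.C c ^ (2 * δ)) * ∑ i, α i ^ 2 := by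
    have : θ (Polynomial.C c ^ (2 * δ)) = v ^ (2 * δ) * u ^ (2 * δ) := by
      rw [← mul_pow, mul_comm v u, huv, map_pow]; rfl
    rw [this, mul_assoc, mul_assoc, e1]
  have e3 := congrArg QuadraticAlgebra.re e2
  have hre : ∀ (p : Polynomial R) (z : B), (θ p * z).re = p * z.re := by
    intro p z; exact qa_re g p z
  rw [hre, hre] at e3
  have e4 := mul_left_cancel₀ (pow_ne_zero _ (by rwa [Ne, Polynomial.C_eq_zero])) e3
  refine ⟨∑ i, (α i).re ^ 2, ∑ i, (α i).im ^ 2, ?_, ?_, ?_⟩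
  · exact IsSumSq.sum fun i _ => (IsSquare.sq _).isSumSq
  · exact IsSumSq.sum fun i _ => (IsSquare.sq _).isSumSq
  · have h6 : ∀ (z : B), z.re = QuadraticAlgebra.reₗ _ _ z := fun z => rfl
    have h7 : (θ F).re = F := rfl
    rw [h7, h6, map_sum] at e4
    rw [e4, Finset.mul_sum, ← Finset.sum_add_distrib]
    refine Finset.sum_congr rfl fun i _ => ?_
    rw [← h6]; exact qa_sq_re g (α i)

theorem polyPart (n δ : ℕ) (F H E s0 s1 : Polynomial R0) (hF : F.Monic)
    (hd : F.natDegree = 2 * δ) (hH : H ≠ 0) (hs0 : IsSumSq s0) (hs1 : IsSumSq s1)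
    (h : H ^ 2 * F * (1 + F * E) =
      s0 + (Polynomial.X ^ 2 - Polynomial.C (PowerSeries.X ^ n)) * s1) :
    ∃ t0 t1 : Polynomial R0, IsSumSq t0 ∧ IsSumSq t1 ∧
      F = t0 + (Polynomial.X ^ 2 - Polynomial.C (PowerSeries.X ^ n)) * t1 := by
  set φ := algebraMap R0 (FractionRing R0) with hφ
  have hφi : Function.Injective φ := IsFractionRing.injective _ _
  obtain ⟨q, hq⟩ : ∃ q : R0, 4 * q = 1 := ⟨PowerSeries.C (1 / 4), by
    rw [show (4 : R0) = PowerSeries.C 4 from (map_ofNat _ 4).symm, ← map_mul]; norm_num⟩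
  obtain ⟨c, hc⟩ : ∃ c : R0, c = q * PowerSeries.X ^ n := ⟨_, rfl⟩
  have h4c : 4 * c = PowerSeries.X ^ n := by rw [hc, ← mul_assoc, hq, one_mul]
  have hq0 : q ≠ 0 := by rintro rfl; simp at hq
  have hc0 : c ≠ 0 := by rw [hc]; exact mul_ne_zero hq0 (pow_ne_zero _ PowerSeries.X_ne_zero)
  rw [← h4c] at h ⊢
  have step1 : IsSumSq ((homog F c (2 * δ)).map φ) := by
    rw [map_homog]
    refine homog_isSumSq RealQ.powerSeries.fraction hlev_frac (φ c)
      (by rwa [Ne, map_eq_zero_iff φ hφi]) δ (F.map φ) (H.map φ) (E.map φ) (s0.map φ) (s1.map φ)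
      (hF.map φ) (by rw [hF.natDegree_map, hd]) (by
        rwa [Ne, Polynomial.map_eq_zero_iff hφi])
      (hs0.mapHom (Polynomial.mapRingHom φ)) (hs1.mapHom (Polynomial.mapRingHom φ)) ?_
    exact map_rel φ c F H E s0 s1 h
  obtain ⟨m, a, ha⟩ := descend _ step1
  have hdeg : ∀ i, (a i).natDegree ≤ 2 * δ := by
    apply natDegree_le_of_sumsq RealQ.powerSeries
    rw [← ha, (homog_monic F c _ hF hd).2]
  have hrev := sum_revc F c _ hd.le a hdeg ha
  have hdvd : ∀ i k, k < δ → ∃ b, (a i).coeff k = c ^ (δ - k) * b := by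
    intro i k hk
    have h1 : ∑ i, revc (a i) c (2 * δ) ^ 2 = Polynomial.C (PowerSeries.X : R0) ^ (2 * (n * δ)) *
        (Polynomial.C q ^ (2 * δ) * homog F c (2 * δ)) := by
      rw [hrev]
      nth_rewrite 1 [hc]
      rw [map_mul, map_pow]; ring
    have h2 := dvd_of_sumsq_poly _ _ _ h1 i
    rw [← map_pow, Polynomial.C_dvd_iff_dvd_coeff] at h2
    have h3 := h2 (2 * δ - k)
    rw [revc_coeff _ _ _ _ (by omega)] at h3
    obtain ⟨b, hb⟩ := h3
    refine ⟨4 ^ δ * b, ?_⟩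
    apply mul_right_cancel₀ (pow_ne_zero k hc0)
    rw [hb]
    have h5 : c ^ δ = c ^ (δ - k) * c ^ k := by rw [← pow_add]; congr 1; omega
    calc _ = (PowerSeries.X ^ n) ^ δ * b := by rw [pow_mul]
      _ = 4 ^ δ * c ^ δ * b := by rw [← h4c, mul_pow]
      _ = _ := by rw [h5]; ring
  choose b hb using hdvd
  exact quadPart q c hq hc0 δ m F hd a ha hdeg b hb


/-- Membership in the quadratic module generated by a single element. -/
def InT {S : Type*} [CommRing S] (g t : S) : Prop :=
  ∃ s0 s1, IsSumSq s0 ∧ IsSumSq s1 ∧ t = s0 + g * s1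

theorem InT.sq_mul {S : Type*} [CommRing S] {g t : S} (a : S) (h : InT g t) :
    InT g (a ^ 2 * t) := by
  obtain ⟨s0, s1, h0, h1, rfl⟩ := h
  exact ⟨a ^ 2 * s0, a ^ 2 * s1, h0.sq_mul a, h1.sq_mul a, by ring⟩

theorem pow_parity {S : Type*} [CommRing S] [IsDomain S] (Q : S → Prop) (p : S) (hp : p ≠ 0)
    (hQ : ∀ t, Q t → p ∣ t → ∃ t', Q t' ∧ t = p ^ 2 * t') (t : S) (ht : ¬ p ∣ t) :
    ∀ j, Q (p ^ j * t) → Even j ∧ Q t := by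
  intro j
  induction j using Nat.strong_induction_on with
  | _ j ih =>
    intro h
    match j, ih, h with
    | 0, _, h => exact ⟨Even.zero, by simpa using h⟩
    | 1, _, h =>
      obtain ⟨t', -, h'⟩ := hQ _ h ⟨t, by ring⟩
      refine absurd ⟨t', ?_⟩ ht
      apply mul_left_cancel₀ hp
      rw [pow_one] at h'
      rw [h']; ring
    | j + 2, ih, h =>
      obtain ⟨t', h1, h'⟩ := hQ _ h ⟨p ^ (j + 1) * t, by ring⟩
      have : t' = p ^ j * t := by
        apply mul_left_cancel₀ (pow_ne_zero 2 hp)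
        rw [← h']; ring
      rw [this] at h1
      obtain ⟨h2, h3⟩ := ih j (by omega) h1
      exact ⟨h2.add even_two, h3⟩

abbrev A0 := PowerSeries R0

/-- the variable `x` in the iterated power series ring -/
abbrev xx : A0 := PowerSeries.C (PowerSeries.X : R0)

/-- reduction mod `x` -/
abbrev redx : A0 →+* R0 := PowerSeries.map (PowerSeries.constantCoeff : R0 →+* ℝ)

theorem redx_ker (r : A0) : redx r = 0 ↔ xx ∣ r := by
  constructor
  · intro h
    have h1 : ∀ k, ∃ c : R0, PowerSeries.coeff k r = PowerSeries.X * c := by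
      intro k
      have h2 := congrArg (PowerSeries.coeff k) h
      rw [PowerSeries.coeff_map, map_zero] at h2
      exact PowerSeries.X_dvd_iff.2 h2
    choose c hc using h1
    refine ⟨PowerSeries.mk c, ?_⟩
    ext1 k
    rw [PowerSeries.coeff_C_mul, PowerSeries.coeff_mk, hc]
  · rintro ⟨c, rfl⟩
    rw [map_mul, PowerSeries.map_C, PowerSeries.constantCoeff_X, map_zero, zero_mul]

theorem xx_ne_zero : xx ≠ 0 := by
  intro h
  have := congrArg PowerSeries.constantCoeff h
  rw [PowerSeries.constantCoeff_C, map_zero] at this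
  exact PowerSeries.X_ne_zero this

theorem xx_pow_factor (f : A0) (hf : f ≠ 0) : ∃ m f1, f = xx ^ m * f1 ∧ ¬ xx ∣ f1 := by
  obtain ⟨k, hk⟩ : ∃ k, PowerSeries.coeff k f ≠ 0 := by
    by_contra! h
    exact hf (by ext1 k; rw [h, map_zero])
  obtain ⟨j, u, hu, hju⟩ := R0_eq _ hk
  have hfin : FiniteMultiplicity xx f := by
    refine ⟨j, ?_⟩
    rintro ⟨c, hc⟩
    have h1 := congrArg (PowerSeries.coeff k) hc
    rw [← map_pow, PowerSeries.coeff_C_mul, hju, pow_succ, mul_assoc] at h1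
    have h2 := mul_left_cancel₀ (pow_ne_zero j PowerSeries.X_ne_zero) h1
    rw [h2] at hu
    exact PowerSeries.X_prime.not_isUnit (isUnit_of_mul_isUnit_left hu)
  obtain ⟨c, hc, hn⟩ := hfin.exists_eq_pow_mul_and_not_dvd
  exact ⟨_, c, hc, hn⟩

/-- the polynomial `y ^ 2 - x ^ n` -/
abbrev gP (n : ℕ) : Polynomial R0 := Polynomial.X ^ 2 - Polynomial.C (PowerSeries.X ^ n)

/-- the power series `y ^ 2 - x ^ n` -/
abbrev gA (n : ℕ) : A0 := PowerSeries.X ^ 2 - xx ^ n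

theorem gP_coe (n : ℕ) : ((gP n : Polynomial R0) : A0) = gA n := by
  rw [Polynomial.coe_sub, Polynomial.coe_pow, Polynomial.coe_X, Polynomial.coe_C, map_pow]

theorem redx_gA (n : ℕ) (hn : n ≠ 0) : redx (gA n) = PowerSeries.X ^ 2 := by
  rw [map_sub, map_pow, map_pow, (redx_ker xx).2 dvd_rfl, zero_pow hn, sub_zero, PowerSeries.map_X]

theorem inT_div (n : ℕ) (hn : n ≠ 0) (t : A0) (h : InT (gA n) t) (hd : xx ∣ t) :
    ∃ t', InT (gA n) t' ∧ t = xx ^ 2 * t' := by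
  obtain ⟨s0, s1, h0, h1, rfl⟩ := h
  have e := (redx_ker _).2 hd
  rw [map_add, map_mul, redx_gA n hn] at e
  have e0 : redx s0 = 0 := RealQ.powerSeries.left (h0.mapHom redx) _
    ((h1.mapHom redx).sq_mul _) e
  have e1 : redx s1 = 0 := by
    rw [e0, zero_add] at e
    exact (mul_eq_zero.1 e).resolve_left (pow_ne_zero _ PowerSeries.X_ne_zero)
  obtain ⟨a, ha, rfl⟩ := isSumSq_div redx RealQ.powerSeries xx (fun r => (redx_ker r).1) h0 e0
  obtain ⟨b, hb, rfl⟩ := isSumSq_div redx RealQ.powerSeries xx (fun r => (redx_ker r).1) h1 e1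
  exact ⟨a + gA n * b, ⟨a, b, ha, hb, rfl⟩, by ring⟩

theorem weier (f : A0) (hf : ¬ xx ∣ f) : ∃ (F : Polynomial R0) (w : A0),
    F.IsDistinguishedAt I0 ∧ IsUnit w ∧ f = F * w := by
  have hI : IsLocalRing.maximalIdeal R0 = I0 := PowerSeries.maximalIdeal_eq_span_X
  have : IsAdicComplete (IsLocalRing.maximalIdeal R0) R0 := by
    rw [hI]; infer_instance
  obtain ⟨F, w, h⟩ := PowerSeries.exists_isWeierstrassFactorization (g := f) (by
    intro h0
    apply hf
    rw [← redx_ker]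
    ext1 k
    have h1 := congrArg (PowerSeries.coeff k) h0
    rw [PowerSeries.coeff_map, map_zero, IsLocalRing.residue_eq_zero_iff, hI,
      Ideal.mem_span_singleton, PowerSeries.X_dvd_iff] at h1
    rw [PowerSeries.coeff_map, map_zero, h1])
  refine ⟨F, w, ?_, h.isUnit, h.eq_mul⟩
  rw [← hI]; exact h.isDistinguishedAt

theorem redx_dist (F : Polynomial R0) (h : F.IsDistinguishedAt I0) :
    redx (F : A0) = PowerSeries.X ^ F.natDegree := by
  ext1 k
  rw [PowerSeries.coeff_map, Polynomial.coeff_coe, PowerSeries.coeff_X_pow]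
  split_ifs with hk
  · rw [hk, h.monic.coeff_natDegree, map_one]
  · rcases lt_or_gt_of_ne hk with h1 | h1
    · have := h.mem h1
      rwa [Ideal.mem_span_singleton, PowerSeries.X_dvd_iff] at this
    · rw [Polynomial.coeff_eq_zero_of_natDegree_lt h1, map_zero]

theorem unit_sqrt_s18 (w : A0) (h : 0 < PowerSeries.constantCoeff (PowerSeries.constantCoeff w)) :
    ∃ s, IsUnit s ∧ s ^ 2 = w := by
  obtain ⟨a, ha⟩ := powerSeries_sqrt (isUnit_iff_ne_zero.2 two_ne_zero)
    (PowerSeries.constantCoeff w) (Real.sqrt _)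
    (isUnit_iff_ne_zero.2 (Real.sqrt_pos.2 h).ne') (Real.sq_sqrt h.le).symm
  have hu : IsUnit (PowerSeries.constantCoeff w) := by
    rw [PowerSeries.isUnit_iff_constantCoeff]; exact isUnit_iff_ne_zero.2 h.ne'
  have hau : IsUnit a := by
    rw [← ha] at hu; exact (isUnit_pow_iff two_ne_zero).1 hu
  have h2 : IsUnit (2 : R0) := by
    rw [show (2 : R0) = PowerSeries.C 2 from (map_ofNat _ 2).symm]
    exact (isUnit_iff_ne_zero.2 two_ne_zero).map _
  obtain ⟨s, hs⟩ := powerSeries_sqrt h2 w a hau ha.symm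
  refine ⟨s, ?_, hs⟩
  have hw : IsUnit w := by rwa [PowerSeries.isUnit_iff_constantCoeff]
  rw [← hs] at hw; exact (isUnit_pow_iff two_ne_zero).1 hw

theorem sum_red {S : Type*} [CommRing S] (N : S) {m : ℕ} (a r q : Fin m → S)
    (h : ∀ i, a i = N * q i + r i) : ∃ Q, ∑ i, a i ^ 2 = ∑ i, r i ^ 2 + N * Q := by
  refine ⟨∑ i, (N * q i ^ 2 + 2 * q i * r i), ?_⟩
  rw [Finset.mul_sum, ← Finset.sum_add_distrib]
  exact Finset.sum_congr rfl fun i _ => by rw [h]; ring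

theorem coe_sum_sq {R : Type*} [CommRing R] {m : ℕ} (r : Fin m → Polynomial R) :
    ((∑ i, r i ^ 2 : Polynomial R) : PowerSeries R) = ∑ i, (r i : PowerSeries R) ^ 2 := by
  have := map_sum (Polynomial.coeToPowerSeries.ringHom (R := R)) (fun i => r i ^ 2) Finset.univ
  exact this.trans (Finset.sum_congr rfl fun i _ => map_pow (Polynomial.coeToPowerSeries.ringHom (R := R)) (r i) 2)

theorem dist_inT (n : ℕ) (F H : Polynomial R0) (hF : F.IsDistinguishedAt I0)
    (hH : H.IsDistinguishedAt I0) (hd : Even F.natDegree)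
    (h : InT (gA n) ((H : A0) ^ 2 * F)) : InT (gA n) (F : A0) := by
  obtain ⟨s0, s1, h0, h1, e⟩ := h
  obtain ⟨m0, a, rfl⟩ := h0.exists_fin
  obtain ⟨m1, b, rfl⟩ := h1.exists_fin
  have hN : (H * H * (F * F)).IsDistinguishedAt I0 := (hH.mul hH).mul (hF.mul hF)
  choose r q hr using fun i => distinguished_div hN (a i)
  choose r' q' hr' using fun i => distinguished_div hN (b i)
  obtain ⟨Q, hQ⟩ := sum_red _ _ _ _ hr
  obtain ⟨Q', hQ'⟩ := sum_red _ _ _ _ hr'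
  rw [hQ, hQ', ← coe_sum_sq, ← coe_sum_sq, ← gP_coe] at e
  obtain ⟨E, hE⟩ := distinguished_dvd hN (H ^ 2 * F - (∑ i, r i ^ 2 + gP n * ∑ i, r' i ^ 2))
    ⟨Q + (gP n : Polynomial R0) * Q', by
      rw [Polynomial.coe_sub, Polynomial.coe_mul, Polynomial.coe_pow, e, Polynomial.coe_add,
        Polynomial.coe_mul (gP n)]
      ring⟩
  obtain ⟨δ, hδ⟩ := hd
  obtain ⟨t0, t1, ht0, ht1, ht⟩ := polyPart n δ F H (-E) (∑ i, r i ^ 2) (∑ i, r' i ^ 2) hF.monic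
    (by omega) hH.monic.ne_zero (IsSumSq.sum_sq _ _) (IsSumSq.sum_sq _ _)
    (by linear_combination hE)
  refine ⟨_, _, ht0.mapHom Polynomial.coeToPowerSeries.ringHom,
    ht1.mapHom Polynomial.coeToPowerSeries.ringHom, ?_⟩
  rw [← gP_coe]
  have := congrArg (Polynomial.coeToPowerSeries.ringHom (R := R0)) ht
  rw [map_add, map_mul] at this
  exact this

theorem psPart (n : ℕ) (hn : n ≠ 0) (f h : A0) (hf : f ≠ 0) (hh : h ≠ 0)
    (hT : InT (gA n) (h ^ 2 * f)) : InT (gA n) f := by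
  obtain ⟨m, f1, rfl, hf1⟩ := xx_pow_factor f hf
  obtain ⟨k, h1, rfl, hh1⟩ := xx_pow_factor h hh
  have hf1' : redx f1 ≠ 0 := by rwa [Ne, redx_ker]
  have hh1' : redx h1 ≠ 0 := by rwa [Ne, redx_ker]
  have hnd : ¬ xx ∣ h1 ^ 2 * f1 := by
    rw [← redx_ker, map_mul, map_pow]
    exact mul_ne_zero (pow_ne_zero _ hh1') hf1'
  have e1 : (xx ^ k * h1) ^ 2 * (xx ^ m * f1) = xx ^ (2 * k + m) * (h1 ^ 2 * f1) := by ring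
  rw [e1] at hT
  obtain ⟨hev, hT1⟩ := pow_parity (InT (gA n)) xx xx_ne_zero (inT_div n hn) _ hnd _ hT
  have hm : Even m := by
    rwa [Nat.even_add, iff_true_left (even_two_mul k)] at hev
  obtain ⟨F, w, hF, hw, rfl⟩ := weier f1 hf1
  obtain ⟨H, w', hH, hw', rfl⟩ := weier h1 hh1
  obtain ⟨z, hz⟩ := hw'.exists_left_inv
  have hT2 : InT (gA n) ((H : A0) ^ 2 * F * w) := by
    have := hT1.sq_mul z
    have e2 : z ^ 2 * (((H : A0) * w') ^ 2 * (F * w)) = (z * w') ^ 2 * ((H : A0) ^ 2 * F * w) := by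
      ring
    rw [e2, hz, one_pow, one_mul] at this
    exact this
  have hsq : IsSumSq ((PowerSeries.X : R0) ^ (2 * H.natDegree + F.natDegree) * redx w) := by
    obtain ⟨s0, s1, h0, h1, e⟩ := hT2
    have e' := congrArg redx e
    rw [map_mul, map_mul, map_pow, map_add, map_mul, redx_gA n hn, redx_dist _ hF,
      redx_dist _ hH] at e'
    rw [pow_add, mul_comm 2, pow_mul, e']
    exact (h0.mapHom redx).add ((h1.mapHom redx).sq_mul _)
  have hwu : IsUnit (PowerSeries.constantCoeff (redx w)) := (hw.map redx).map _
  obtain ⟨hev2, hsw⟩ := pow_parity IsSumSq (PowerSeries.X : R0) PowerSeries.X_ne_zero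
    (fun t ht hd => isSumSq_div (PowerSeries.constantCoeff (R := ℝ)) realQ_real _
      (fun r => PowerSeries.X_dvd_iff.2) ht (PowerSeries.X_dvd_iff.1 hd)) (redx w)
    (by rw [PowerSeries.X_dvd_iff]; exact hwu.ne_zero) _ hsq
  have hFe : Even F.natDegree := by
    rwa [Nat.even_add, iff_true_left (even_two_mul _)] at hev2
  have hpos : 0 < PowerSeries.constantCoeff (PowerSeries.constantCoeff w) := by
    have h2 : 0 ≤ PowerSeries.constantCoeff (redx w) :=
      (hsw.mapHom (PowerSeries.constantCoeff (R := ℝ))).nonneg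
    have h3 : PowerSeries.constantCoeff (redx w) =
        PowerSeries.constantCoeff (PowerSeries.constantCoeff w) := by
      rw [← PowerSeries.coeff_zero_eq_constantCoeff_apply (redx w), PowerSeries.coeff_map,
        PowerSeries.coeff_zero_eq_constantCoeff_apply]
    rw [← h3]
    exact lt_of_le_of_ne h2 hwu.ne_zero.symm
  obtain ⟨s, hs, rfl⟩ := unit_sqrt_s18 w hpos
  obtain ⟨z', hz'⟩ := hs.exists_left_inv
  have hT3 : InT (gA n) ((H : A0) ^ 2 * F) := by
    have := hT2.sq_mul z'
    have e2 : z' ^ 2 * ((H : A0) ^ 2 * F * s ^ 2) = (z' * s) ^ 2 * ((H : A0) ^ 2 * F) := by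
      ring
    rw [e2, hz', one_pow, one_mul] at this
    exact this
  obtain ⟨l, rfl⟩ := hm
  have := (dist_inT n F H hF hH hFe hT3).sq_mul (xx ^ l * s)
  convert this using 1
  ring


/-- proper preorderings of a field -/
structure PrePos {K : Type*} [Field K] (P : Set K) : Prop where
  sq : ∀ a : K, a ^ 2 ∈ P
  add : ∀ a ∈ P, ∀ b ∈ P, a + b ∈ P
  mul : ∀ a ∈ P, ∀ b ∈ P, a * b ∈ P
  neg : (-1 : K) ∉ P

theorem PrePos.zero_mem {K : Type*} [Field K] {P : Set K} (h : PrePos P) : (0 : K) ∈ P := by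
  simpa using h.sq 0

theorem PrePos.one_mem {K : Type*} [Field K] {P : Set K} (h : PrePos P) : (1 : K) ∈ P := by
  simpa using h.sq 1

theorem PrePos.extend {K : Type*} [Field K] {P : Set K} (h : PrePos P) (a : K) (ha : a ∉ P) :
    ∃ P', PrePos P' ∧ P ⊆ P' ∧ -a ∈ P' := by
  refine ⟨{t | ∃ p ∈ P, ∃ q ∈ P, t = p - a * q}, ⟨?_, ?_, ?_, ?_⟩, ?_, ?_⟩
  · intro b; exact ⟨b ^ 2, h.sq b, 0, h.zero_mem, by ring⟩
  · rintro _ ⟨p, hp, q, hq, rfl⟩ _ ⟨p', hp', q', hq', rfl⟩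
    exact ⟨p + p', h.add _ hp _ hp', q + q', h.add _ hq _ hq', by ring⟩
  · rintro _ ⟨p, hp, q, hq, rfl⟩ _ ⟨p', hp', q', hq', rfl⟩
    exact ⟨p * p' + a ^ 2 * (q * q'), h.add _ (h.mul _ hp _ hp') _
      (h.mul _ (h.sq a) _ (h.mul _ hq _ hq')), p * q' + q * p',
      h.add _ (h.mul _ hp _ hq') _ (h.mul _ hq _ hp'), by ring⟩
  · rintro ⟨p, hp, q, hq, e⟩
    have hq0 : q ≠ 0 := by
      rintro rfl
      apply h.neg
      rw [e]; simpa using hp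
    apply ha
    have e2 : a = (1 + p) * (q * (q⁻¹) ^ 2) := by
      field_simp
      linear_combination e
    rw [e2]
    exact h.mul _ (h.add _ h.one_mem _ hp) _ (h.mul _ hq _ (h.sq _))
  · intro p hp; exact ⟨p, hp, 0, h.zero_mem, by ring⟩
  · exact ⟨0, h.zero_mem, 1, h.one_mem, by ring⟩

theorem PrePos.exists_ordering {K : Type*} [Field K] {P : Set K} (h : PrePos P) :
    ∃ Q, IsOrderingF Q ∧ P ⊆ Q := by
  obtain ⟨Q, hPQ, hQ⟩ := zorn_subset_nonempty {Q : Set K | PrePos Q} (by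
    intro c hc hch ⟨Q0, hQ0⟩
    refine ⟨⋃₀ c, ⟨?_, ?_, ?_, ?_⟩, fun s hs => Set.subset_sUnion_of_mem hs⟩
    · intro a; exact ⟨Q0, hQ0, (hc hQ0).sq a⟩
    · rintro a ⟨A, hA, ha⟩ b ⟨B, hB, hb⟩
      rcases hch.total hA hB with h1 | h1
      · exact ⟨B, hB, (hc hB).add _ (h1 ha) _ hb⟩
      · exact ⟨A, hA, (hc hA).add _ ha _ (h1 hb)⟩
    · rintro a ⟨A, hA, ha⟩ b ⟨B, hB, hb⟩
      rcases hch.total hA hB with h1 | h1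
      · exact ⟨B, hB, (hc hB).mul _ (h1 ha) _ hb⟩
      · exact ⟨A, hA, (hc hA).mul _ ha _ (h1 hb)⟩
    · rintro ⟨A, hA, ha⟩; exact (hc hA).neg ha) P h
  have hp : PrePos Q := hQ.prop
  refine ⟨Q, ⟨hp.add, hp.mul, ?_, ?_⟩, hPQ⟩
  · intro a
    by_contra! hcon
    obtain ⟨P', h1, h2, h3⟩ := hp.extend a hcon.1
    exact hcon.2 (hQ.le_of_ge h1 h2 h3)
  · intro a ha hna
    by_contra h0
    apply hp.neg
    have e : (-1 : K) = a * (-a) * (a⁻¹) ^ 2 := by field_simp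
    rw [e]
    exact hp.mul _ (hp.mul _ ha _ hna) _ (hp.sq _)

theorem artin {K : Type*} [Field K] (h2 : (2 : K) ≠ 0) (g f : K)
    (hf : ∀ P : Set K, IsOrderingF P → g ∈ P → f ∈ P) : InT g f := by
  by_contra hcon
  have hadd : ∀ a b : K, InT g a → InT g b → InT g (a + b) := by
    rintro _ _ ⟨s0, s1, h0, h1, rfl⟩ ⟨t0, t1, h0', h1', rfl⟩
    exact ⟨s0 + t0, s1 + t1, h0.add h0', h1.add h1', by ring⟩
  have hmul : ∀ a b : K, InT g a → InT g b → InT g (a * b) := by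
    rintro _ _ ⟨s0, s1, h0, h1, rfl⟩ ⟨t0, t1, h0', h1', rfl⟩
    exact ⟨s0 * t0 + g ^ 2 * (s1 * t1), s0 * t1 + s1 * t0,
      (h0.mul h0').add ((h1.mul h1').sq_mul g), (h0.mul h1').add (h1.mul h0'), by ring⟩
  have hsq : ∀ a : K, InT g (a ^ 2) := fun a =>
    ⟨a ^ 2, 0, by rw [sq]; exact IsSumSq.mul_self a, IsSumSq.zero, by ring⟩
  have hT : PrePos {t : K | InT g t} := by
    refine ⟨hsq, fun a ha b hb => hadd a b ha hb, fun a ha b hb => hmul a b ha hb, ?_⟩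
    intro hneg
    apply hcon
    have e : f = ((f + 1) / 2) ^ 2 + (-1) * ((f - 1) / 2) ^ 2 := by field_simp; ring
    rw [e]
    exact hadd _ _ (hsq _) (hmul _ _ hneg (hsq _))
  obtain ⟨P', hP', hsub, hnf⟩ := hT.extend f hcon
  obtain ⟨Q, hQ, hQs⟩ := hP'.exists_ordering
  have hg : g ∈ Q := hQs (hsub ⟨0, 1, IsSumSq.zero, by simp, by ring⟩)
  have h0 := hQ.2.2.2 f (hf Q hQ hg) (hQs hnf)
  apply hcon
  rw [h0]; simpa using hsq 0

theorem clear_den {A K : Type*} [CommRing A] [IsDomain A] [Field K] [Algebra A K]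
    [IsFractionRing A K] {s : K} (hs : IsSumSq s) :
    ∃ (d s' : A), d ≠ 0 ∧ IsSumSq s' ∧ algebraMap A K d ^ 2 * s = algebraMap A K s' := by
  induction hs using IsSumSq.rec' with
  | zero => exact ⟨1, 0, one_ne_zero, IsSumSq.zero, by simp⟩
  | sq_add hx hs ih =>
    obtain ⟨a, rfl⟩ := hx
    obtain ⟨d, s', hd, hs', e⟩ := ih
    obtain ⟨p, q, hq, rfl⟩ := IsFractionRing.div_surjective (A := A) a
    have hq0 := nonZeroDivisors.ne_zero hq
    have hq1 : algebraMap A K q ≠ 0 := by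
      rwa [Ne, map_eq_zero_iff _ (IsFractionRing.injective A K)]
    refine ⟨d * q, (d * p) * (d * p) + q ^ 2 * s', mul_ne_zero hd hq0,
      (IsSumSq.mul_self _).add (hs'.sq_mul q), ?_⟩
    simp only [map_mul, map_add, map_pow, ← e]
    field_simp

theorem artin_ring {A K : Type*} [CommRing A] [IsDomain A] [Field K] [Algebra A K]
    [IsFractionRing A K] (g f : A) (h : InT (algebraMap A K g) (algebraMap A K f)) :
    ∃ d, d ≠ 0 ∧ InT g (d ^ 2 * f) := by
  obtain ⟨s0, s1, h0, h1, e⟩ := h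
  obtain ⟨d, t0, hd, ht0, e0⟩ := clear_den (A := A) h0
  obtain ⟨d', t1, hd', ht1, e1⟩ := clear_den (A := A) h1
  refine ⟨d * d', mul_ne_zero hd hd', d' ^ 2 * t0, d ^ 2 * t1, ht0.sq_mul _, ht1.sq_mul _, ?_⟩
  apply IsFractionRing.injective A K
  simp only [map_mul, map_add, map_pow, ← e0, ← e1, e]
  ring

theorem InT.map {S S' : Type*} [CommRing S] [CommRing S'] (φ : S →+* S') {g t : S}
    (h : InT g t) : InT (φ g) (φ t) := by
  obtain ⟨s0, s1, h0, h1, rfl⟩ := h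
  exact ⟨_, _, h0.mapHom φ, h1.mapHom φ, by simp⟩

/-- `0 ↦ some ()`, `1 ↦ none` -/
def idxEquiv : Fin 2 ≃ Option Unit where
  toFun i := if i = 0 then some () else none
  invFun o := o.elim 1 fun _ => 0
  left_inv := by decide
  right_inv := by decide

theorem exists_iso : ∃ e : PS ≃+* A0, e psX = xx ∧ e psY = PowerSeries.X := by
  refine ⟨((MvPowerSeries.renameEquiv ℝ idxEquiv).trans
    (MvPowerSeries.optionEquivLeft Unit ℝ)).toRingEquiv, ?_, ?_⟩
  · have h : MvPowerSeries.renameEquiv ℝ idxEquiv psX = MvPowerSeries.X (some ()) := by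
      exact MvPowerSeries.rename_X _ _
    change MvPowerSeries.optionEquivLeft Unit ℝ (MvPowerSeries.renameEquiv ℝ idxEquiv psX) = _
    rw [h, MvPowerSeries.optionEquivLeft_X_some]; rfl
  · have h : MvPowerSeries.renameEquiv ℝ idxEquiv psY = MvPowerSeries.X none := by
      exact MvPowerSeries.rename_X _ _
    change MvPowerSeries.optionEquivLeft Unit ℝ (MvPowerSeries.renameEquiv ℝ idxEquiv psY) = _
    rw [h, MvPowerSeries.optionEquivLeft_X_none]

theorem two_ne_zero_FF : (2 : FF) ≠ 0 := by
  rw [show (2 : FF) = ι 2 from (map_ofNat _ 2).symm, Ne,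
    map_eq_zero_iff ι (IsFractionRing.injective PS FF)]
  intro h
  have := congrArg (MvPowerSeries.constantCoeff (σ := Fin 2) (R := ℝ)) h
  rw [map_ofNat, map_zero] at this
  exact two_ne_zero this

theorem InT.mem_preorderingGen {A : Type*} [CommRing A] {g t : A} (h : InT g t) :
    t ∈ preorderingGen {g} := by
  obtain ⟨s0, s1, h0, h1, rfl⟩ := h
  have key : ∀ s : A, IsSumSq s → s ∈ Subsemiring.closure ({g} ∪ {a | ∃ b, a = b ^ 2}) := by
    intro s hs
    obtain ⟨m, a, rfl⟩ := hs.exists_fin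
    exact Subsemiring.sum_mem _ fun i _ => Subsemiring.subset_closure (Or.inr ⟨a i, rfl⟩)
  exact Subsemiring.add_mem _ (key _ h0)
    (Subsemiring.mul_mem _ (Subsemiring.subset_closure (Or.inl rfl)) (key _ h1))


/-- Let `n` be odd, `n ≥ 3`. The preordering of `ℝ[[x,y]]` generated
by `y² − x^n` is saturated: every `f ∈ ℝ[[x,y]]` nonnegative at every ordering of
`ℝ((x,y))` at which `y² − x^n ≥ 0` belongs to this preordering. -/
theorem preordering_y2_sub_xn_saturated (n : ℕ) (hodd : Odd n) (hn : 3 ≤ n) (f : PS)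
    (hf : ∀ P : Set FF, IsOrderingF P → ι (psY ^ 2 - psX ^ n) ∈ P → ι f ∈ P) :
    f ∈ preorderingGen {psY ^ 2 - psX ^ n} := by

  apply InT.mem_preorderingGen
  by_cases h0 : f = 0
  · exact ⟨0, 0, IsSumSq.zero, IsSumSq.zero, by simp [h0]⟩
  obtain ⟨d, hd, hT⟩ := artin_ring (K := FF) _ _ (artin two_ne_zero_FF _ _ hf)
  obtain ⟨e, hx, hy⟩ := exists_iso
  have hg : e (psY ^ 2 - psX ^ n) = gA n := by
    rw [map_sub, map_pow, map_pow, hx, hy]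
  have hT' := hT.map (e : PS →+* A0)
  rw [map_mul, map_pow] at hT'
  simp only [RingEquiv.coe_toRingHom, hg] at hT'
  have h1 := psPart n (by omega) (e f) (e d) (by simpa using h0) (by simpa using hd) hT'
  have h2 := h1.map (e.symm : A0 →+* PS)
  rw [← hg] at h2
  simpa using h2
end
end
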